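/- arXiv:2409.14787 — 2 statements merged into one kernel-verified Lean document; each statement's English description precedes it below -/
import Mathlib

section
/- For every even integer n ≥ 18, writing n = i + 8(t+1) with t ≥ 1 an integer and 0 < i ≤ 8, the graph G''_n = G'_t⟨S_{i/2}⟩ is a brick on n vertices whose number of perfect matchings is exactly (5n + 8 − i)/8 = ⌈5n/8⌉. -/
open SimpleGraph

/-- The number of perfect matchings of a graph. -/
noncomputable def numPM {V : Type*} (G : SimpleGraph V) : ℕ :=
  Set.ncard {M : G.Subgraph | M.IsPerfectMatching}

/-- A graph is 3-connected if it has at least 4 vertices and deleting any set of at most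
two vertices leaves a connected graph. -/
def ThreeConnected {V : Type*} [Fintype V] (G : SimpleGraph V) : Prop :=
  4 ≤ Fintype.card V ∧
    ∀ s : Set V, s.ncard ≤ 2 → (G.induce (sᶜ : Set V)).Connected

/-- A brick: a 3-connected graph such that deleting any two distinct vertices leaves
a graph with a perfect matching (Edmonds–Lovász–Pulleyblank characterization). -/
def IsBrick {V : Type*} [Fintype V] (G : SimpleGraph V) : Prop :=
  ThreeConnected G ∧
    ∀ x y : V, x ≠ y →
      ∃ M : (G.induce {v : V | v ≠ x ∧ v ≠ y}).Subgraph, M.IsPerfectMatching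

/-- A brick is extremal when its number of perfect matchings equals |E| - |V| + 1. -/
def IsExtremal {V : Type*} [Fintype V] (G : SimpleGraph V) : Prop :=
  numPM G + Fintype.card V = G.edgeSet.ncard + 1

/-- The set `S = {u₀¹, u₀³, u} ∪ {uₛ², uₛ⁴ : 0 ≤ s ≤ t}` of vertices of `G_t`
(here `Sum.inl (s, j)` is the vertex `u_s^{j+1}` and `Sum.inr false` is `u`;
`Sum.inr true` will be the extra vertex `u'` of `G'_t`). -/
def Sset (t : ℕ) : Set ((Fin (t + 1) × Fin 4) ⊕ Bool) :=
  {p | p = Sum.inl (0, 0) ∨ p = Sum.inl (0, 2) ∨ p = Sum.inr false ∨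
       ∃ s : Fin (t + 1), p = Sum.inl (s, 1) ∨ p = Sum.inl (s, 3)}

/-- The graph `G'_t`: the vertex `Sum.inl (s, j)` is `u_s^{j+1}`, `Sum.inr false` is `u`
and `Sum.inr true` is `u'`.  The edges are the path edges `u_s^1 u_s^2 u_s^3 u_s^4`
for `0 ≤ s ≤ t`, the edges `u_s^1 u_{s+1}^1` and `u_s^4 u_{s+1}^3` for `0 ≤ s ≤ t−1`,
the edges `u u_t^1` and `u u_t^4`, and the edges from `u'` to every vertex of `S`. -/
def G't (t : ℕ) : SimpleGraph ((Fin (t + 1) × Fin 4) ⊕ Bool) :=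
  SimpleGraph.fromRel (fun p q =>
    (∃ (s : Fin (t + 1)) (j j' : Fin 4), (j' : ℕ) = (j : ℕ) + 1 ∧
        p = Sum.inl (s, j) ∧ q = Sum.inl (s, j')) ∨
    (∃ s s' : Fin (t + 1), (s' : ℕ) = (s : ℕ) + 1 ∧
        ((p = Sum.inl (s, 0) ∧ q = Sum.inl (s', 0)) ∨
         (p = Sum.inl (s, 3) ∧ q = Sum.inl (s', 2)))) ∨
    (p = Sum.inl (Fin.last t, 0) ∧ q = Sum.inr false) ∨
    (p = Sum.inl (Fin.last t, 3) ∧ q = Sum.inr false) ∨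
    (p ∈ Sset t ∧ q = Sum.inr true))

/-- The sets `S₁ = S \ {u_t², u_t⁴, u}`, `S₂ = S \ {u_t⁴, u}`, `S₃ = S \ {u}`, `S₄ = S`. -/
def Ssub (t : ℕ) : ℕ → Set ((Fin (t + 1) × Fin 4) ⊕ Bool)
  | 1 => Sset t \ {Sum.inl (Fin.last t, 1), Sum.inl (Fin.last t, 3), Sum.inr false}
  | 2 => Sset t \ {Sum.inl (Fin.last t, 3), Sum.inr false}
  | 3 => Sset t \ {Sum.inr false}
  | _ => Sset t

/-- Vertices of the graph obtained from `G` by simultaneous triangle-insertions at all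
vertices of `S'`: a vertex is either `(v, none)` for an untouched vertex `v ∉ S'`, or
`(v, some w)` for `v ∈ S'` and `w` a neighbor of `v`, the triangle vertex of `v`
facing `w`.  (When every vertex of `S'` has degree 3, each `v ∈ S'` is replaced by
a triangle whose vertex facing `w` is joined to `w`.) -/
abbrev ExpandVerts {V : Type*} (G : SimpleGraph V) (S' : Set V) : Type _ :=
  {p : V × Option V //
    (p.1 ∉ S' ∧ p.2 = none) ∨ (p.1 ∈ S' ∧ ∃ w, p.2 = some w ∧ G.Adj p.1 w)}

noncomputable instance expandVertsFintype {V : Type*} [Fintype V] (G : SimpleGraph V)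
    (S' : Set V) : Fintype (ExpandVerts G S') := by
  classical exact Subtype.fintype _

/-- The graph obtained from `G` by triangle-insertions at all vertices of `S'`:
two untouched vertices are adjacent iff they were adjacent in `G`; the triangle
vertex of `v` facing `w` is adjacent to the other two triangle vertices of `v`,
and to `w` (to the triangle vertex of `w` facing `v`, if `w ∈ S'`). -/
def expand {V : Type*} (G : SimpleGraph V) (S' : Set V) :
    SimpleGraph (ExpandVerts G S') :=
  SimpleGraph.fromRel (fun p q =>
    (p.1.2 = none ∧ q.1.2 = none ∧ G.Adj p.1.1 q.1.1) ∨
    (p.1.2 = none ∧ q.1.2 = some p.1.1) ∨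
    (∃ w w' : V, p.1.2 = some w ∧ q.1.2 = some w' ∧
      ((p.1.1 = q.1.1 ∧ w ≠ w') ∨ (q.1.1 = w ∧ p.1.1 = w'))))


section ExpandGeneral
variable {V : Type*} {G : SimpleGraph V} {S' : Set V}

/-- `p` is a vertex of the expansion from which one can leave its blob towards `w`. -/
def Face (p : ExpandVerts G S') (w : V) : Prop := p.1.2 = none ∨ p.1.2 = some w

theorem expand_adj (p q : ExpandVerts G S') :
    (expand G S').Adj p q ↔ (p.1.1 = q.1.1 ∧ p ≠ q) ∨
      (G.Adj p.1.1 q.1.1 ∧ Face p q.1.1 ∧ Face q p.1.1) := by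
  obtain ⟨⟨v, a⟩, hp⟩ := p
  obtain ⟨⟨w, b⟩, hq⟩ := q
  simp only [expand, SimpleGraph.fromRel_adj, Face, ne_eq, Subtype.mk.injEq, Prod.mk.injEq]
  have h1 : G.Adj v w → v ≠ w := fun h => h.ne
  have h2 : G.Adj v w ↔ G.Adj w v := G.adj_comm v w
  rcases a with _ | a <;> rcases b with _ | b <;> simp at hp hq ⊢ <;> grind [SimpleGraph.adj_comm]

/-- The vertex of the blob of `v` facing the neighbor `w`. -/
theorem exists_face (v w : V) (h : G.Adj v w) : ∃ p : ExpandVerts G S', p.1.1 = v ∧ Face p w := by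
  by_cases hv : v ∈ S'
  · exact ⟨⟨(v, some w), Or.inr ⟨hv, w, rfl, h⟩⟩, rfl, Or.inr rfl⟩
  · exact ⟨⟨(v, none), Or.inl ⟨hv, rfl⟩⟩, rfl, Or.inl rfl⟩

theorem face_unique {p q : ExpandVerts G S'} {w : V} (h : p.1.1 = q.1.1) (hp : Face p w)
    (hq : Face q w) : p = q := by
  obtain ⟨⟨v, a⟩, hp'⟩ := p
  obtain ⟨⟨v', b⟩, hq'⟩ := q
  simp only [Face, Subtype.mk.injEq, Prod.mk.injEq] at *
  grind

theorem blob_notMem {p q : ExpandVerts G S'} (h : p.1.1 = q.1.1) (hv : p.1.1 ∉ S') : p = q := by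
  obtain ⟨⟨v, a⟩, hp'⟩ := p
  obtain ⟨⟨v', b⟩, hq'⟩ := q
  simp only [Subtype.mk.injEq, Prod.mk.injEq] at *
  grind

theorem face_notMem (p : ExpandVerts G S') (hv : p.1.1 ∉ S') (w : V) : Face p w := by
  obtain ⟨⟨v, a⟩, hp'⟩ := p
  simp only [Face] at *
  grind

theorem face_mem (p : ExpandVerts G S') (hv : p.1.1 ∈ S') :
    ∃ w, G.Adj p.1.1 w ∧ ∀ w', Face p w' ↔ w' = w := by
  obtain ⟨⟨v, a⟩, hp'⟩ := p
  simp only [Face] at *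
  grind

/-- `p` is matched to the outside of its blob. -/
def Out (H : SimpleGraph V) (p : ExpandVerts G S') : Prop := ∃ w, Face p w ∧ H.Adj p.1.1 w

/-- The lift of an edge set `H` of `G` to the expansion. -/
def LiftAdj (H : SimpleGraph V) (p q : ExpandVerts G S') : Prop :=
  (p.1.1 = q.1.1 ∧ p ≠ q ∧ ¬ Out H p ∧ ¬ Out H q) ∨
    (H.Adj p.1.1 q.1.1 ∧ Face p q.1.1 ∧ Face q p.1.1)

theorem LiftAdj.symm {H : SimpleGraph V} {p q : ExpandVerts G S'} (h : LiftAdj H p q) :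
    LiftAdj H q p := by
  rcases h with ⟨h1, h2, h3, h4⟩ | ⟨h1, h2, h3⟩
  · exact Or.inl ⟨h1.symm, h2.symm, h4, h3⟩
  · exact Or.inr ⟨h1.symm, h3, h2⟩

theorem LiftAdj.adj {H : SimpleGraph V} (hH : H ≤ G) {p q : ExpandVerts G S'}
    (h : LiftAdj H p q) : (expand G S').Adj p q := by
  rw [expand_adj]
  rcases h with ⟨h1, h2, h3, h4⟩ | ⟨h1, h2, h3⟩
  · exact Or.inl ⟨h1, h2⟩
  · exact Or.inr ⟨hH h1, h2, h3⟩

/-- The lift as a subgraph. -/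
def liftSub (H : SimpleGraph V) (hH : H ≤ G) : (expand G S').Subgraph where
  verts := Set.univ
  Adj p q := LiftAdj H p q
  adj_sub h := h.adj hH
  edge_vert _ := trivial
  symm := ⟨fun _ _ h => h.symm⟩

/-- Every vertex of `S'` has degree three. -/
def Cub (G : SimpleGraph V) (S' : Set V) : Prop :=
  ∀ v ∈ S', ∃ a b c, a ≠ b ∧ a ≠ c ∧ b ≠ c ∧ ∀ w, G.Adj v w ↔ w = a ∨ w = b ∨ w = c

/-- The edge sets `H` corresponding to perfect matchings of the expansion. -/
def Cfg (G : SimpleGraph V) (S' : Set V) (H : SimpleGraph V) : Prop :=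
  H ≤ G ∧ ∀ v, (∃! w, H.Adj v w) ∨ (v ∈ S' ∧ ∀ w, G.Adj v w → H.Adj v w)

theorem out_lift {H : SimpleGraph V} (hH : H ≤ G) (p : ExpandVerts G S') {w : V} (hw : Face p w)
    (hv : H.Adj p.1.1 w) (hu : ∀ w', Face p w' → H.Adj p.1.1 w' → w' = w) :
    ∃ q : ExpandVerts G S', q.1.1 = w ∧ Face q p.1.1 ∧ LiftAdj H p q ∧ ∀ q', LiftAdj H p q' → q' = q := by
  obtain ⟨q, hq, hqf⟩ := exists_face (G := G) (S' := S') w p.1.1 (hH hv).symm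
  subst hq
  refine ⟨q, rfl, hqf, Or.inr ⟨hv, hw, hqf⟩, ?_⟩
  rintro q' (⟨h1, h2, h3, h4⟩ | ⟨h1, h2, h3⟩)
  · exact absurd ⟨_, hw, hv⟩ h3
  · have := hu _ h2 h1
    exact face_unique this h3 hqf

theorem triple_blob (hc : Cub G S') (p : ExpandVerts G S') (hv : p.1.1 ∈ S') :
    ∃ q r : ExpandVerts G S', ∃ a b c, q.1.1 = p.1.1 ∧ r.1.1 = p.1.1 ∧ a ≠ b ∧ a ≠ c ∧ b ≠ c ∧
      (∀ w, G.Adj p.1.1 w ↔ w = a ∨ w = b ∨ w = c) ∧ p ≠ q ∧ p ≠ r ∧ q ≠ r ∧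
      (∀ w, Face p w ↔ w = a) ∧ (∀ w, Face q w ↔ w = b) ∧ (∀ w, Face r w ↔ w = c) ∧
      ∀ s : ExpandVerts G S', s.1.1 = p.1.1 → s = p ∨ s = q ∨ s = r := by
  have key : ∀ a b c, a ≠ b → a ≠ c → b ≠ c → (∀ w, G.Adj p.1.1 w ↔ w = a ∨ w = b ∨ w = c) →
      (∀ w, Face p w ↔ w = a) → ∃ q r : ExpandVerts G S', q.1.1 = p.1.1 ∧ r.1.1 = p.1.1 ∧
      p ≠ q ∧ p ≠ r ∧ q ≠ r ∧ (∀ w, Face q w ↔ w = b) ∧ (∀ w, Face r w ↔ w = c) ∧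
      ∀ s : ExpandVerts G S', s.1.1 = p.1.1 → s = p ∨ s = q ∨ s = r := by
    intro a b c hab hac hbc hG hpa
    obtain ⟨q, hq, hqf⟩ := exists_face (G := G) (S' := S') p.1.1 b ((hG b).2 (by simp))
    obtain ⟨r, hr, hrf⟩ := exists_face (G := G) (S' := S') p.1.1 c ((hG c).2 (by simp))
    have hq' := face_mem q (by rw [hq]; exact hv)
    have hr' := face_mem r (by rw [hr]; exact hv)
    obtain ⟨b', -, hb'⟩ := hq'
    obtain ⟨c', -, hc'⟩ := hr'
    have e1 := (hb' b).1 hqf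
    have e2 := (hc' c).1 hrf
    subst e1 e2
    refine ⟨q, r, hq, hr, ?_, ?_, ?_, hb', hc', ?_⟩
    · rintro rfl; exact hab ((hb' a).1 ((hpa a).2 rfl))
    · rintro rfl; exact hac ((hc' a).1 ((hpa a).2 rfl))
    · rintro rfl; exact hbc ((hc' b).1 hqf)
    · intro s hs
      obtain ⟨w, hw, hsw⟩ := face_mem s (by rw [hs]; exact hv)
      rw [hs, hG] at hw
      rcases hw with rfl | rfl | rfl
      · exact Or.inl (face_unique hs ((hsw w).2 rfl) ((hpa w).2 rfl))
      · exact Or.inr (Or.inl (face_unique (hs.trans hq.symm) ((hsw w).2 rfl) hqf))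
      · exact Or.inr (Or.inr (face_unique (hs.trans hr.symm) ((hsw w).2 rfl) hrf))
  obtain ⟨a, b, c, hab, hac, hbc, hG⟩ := hc _ hv
  obtain ⟨w, hw, hpw⟩ := face_mem p hv
  rcases (hG w).1 hw with rfl | rfl | rfl
  · obtain ⟨q, r, h⟩ := key w b c hab hac hbc hG hpw
    exact ⟨q, r, w, b, c, by grind⟩
  · obtain ⟨q, r, h⟩ := key w a c hab.symm hbc hac (by grind) hpw
    exact ⟨q, r, w, a, c, by grind⟩
  · obtain ⟨q, r, h⟩ := key w a b hac.symm hbc.symm hab (by grind) hpw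
    exact ⟨q, r, w, a, b, by grind⟩

theorem lift_unique (hc : Cub G S') {H : SimpleGraph V} (hH : H ≤ G) (p : ExpandVerts G S')
    (hv : (∃! w, H.Adj p.1.1 w) ∨ (p.1.1 ∈ S' ∧ ∀ w, G.Adj p.1.1 w → H.Adj p.1.1 w)) :
    ∃! q, LiftAdj H p q := by
  by_cases hS : p.1.1 ∈ S'
  · obtain ⟨q, r, a, b, c, hq, hr, hab, hac, hbc, hG, hpq, hpr, hqr, hpf, hqf, hrf, hall⟩ :=
      triple_blob hc p hS
    by_cases ha : H.Adj p.1.1 a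
    · obtain ⟨q, h1, h2, h3, h4⟩ := out_lift hH p ((hpf a).2 rfl) ha
        (fun w' hw' _ => (hpf w').1 hw')
      exact ⟨q, h3, h4⟩
    · have hu : ∃! w, H.Adj p.1.1 w := by
        rcases hv with h | h
        · exact h
        · exact absurd (h.2 a ((hG a).2 (by simp))) ha
      have hpo : ¬ Out H p := by
        rintro ⟨w, hw, hw'⟩
        rw [(hpf w).1 hw] at hw'
        exact ha hw'
      have hqo : Out H q ↔ H.Adj p.1.1 b := by simp [Out, hqf, hq]
      have hro : Out H r ↔ H.Adj p.1.1 c := by simp [Out, hrf, hr]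
      obtain ⟨w, hw, huw⟩ := hu
      have hout : ∀ q', LiftAdj H p q' → p.1.1 = q'.1.1 ∧ p ≠ q' ∧ ¬ Out H q' := by
        rintro q' (⟨h1, h2, h3, h4⟩ | ⟨h1, h2, h3⟩)
        · exact ⟨h1, h2, h4⟩
        · exact absurd ⟨_, h2, h1⟩ hpo
      rcases (hG w).1 (hH hw) with rfl | rfl | rfl
      · exact absurd hw ha
      · have hnc : ¬ H.Adj p.1.1 c := fun h => hbc (huw c h).symm
        refine ⟨r, Or.inl ⟨hr.symm, hpr, hpo, by rwa [hro]⟩, fun q' hq' => ?_⟩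
        obtain ⟨e1, e2, e3⟩ := hout q' hq'
        rcases hall q' e1.symm with rfl | rfl | rfl
        · exact absurd rfl e2
        · exact absurd (hqo.2 hw) e3
        · rfl
      · have hnc : ¬ H.Adj p.1.1 b := fun h => hbc (huw b h)
        refine ⟨q, Or.inl ⟨hq.symm, hpq, hpo, by rwa [hqo]⟩, fun q' hq' => ?_⟩
        obtain ⟨e1, e2, e3⟩ := hout q' hq'
        rcases hall q' e1.symm with rfl | rfl | rfl
        · exact absurd rfl e2
        · rfl
        · exact absurd (hro.2 hw) e3
  · have hu : ∃! w, H.Adj p.1.1 w := by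
      rcases hv with h | h
      · exact h
      · exact absurd h.1 hS
    obtain ⟨w, hw, huw⟩ := hu
    obtain ⟨q, h1, h2, h3, h4⟩ := out_lift hH p (face_notMem p hS w) hw
        (fun w' _ hw' => huw w' hw')
    exact ⟨q, h3, h4⟩

theorem liftSub_pm (hc : Cub G S') {H : SimpleGraph V} (h : Cfg G S' H) :
    (liftSub H h.1 : (expand G S').Subgraph).IsPerfectMatching := by
  rw [Subgraph.isPerfectMatching_iff]
  intro p
  exact lift_unique hc h.1 p (h.2 p.1.1)

/-- The projection of a subgraph of the expansion to `G`. -/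
def proj (M : (expand G S').Subgraph) : SimpleGraph V where
  Adj v w := v ≠ w ∧ ∃ p q : ExpandVerts G S', p.1.1 = v ∧ q.1.1 = w ∧ M.Adj p q
  symm := ⟨fun v w ⟨h, p, q, h1, h2, h3⟩ => ⟨h.symm, q, p, h2, h1, h3.symm⟩⟩
  loopless := ⟨fun v h => h.1 rfl⟩

theorem proj_adj {M : (expand G S').Subgraph} {v w : V} (h : (proj M).Adj v w) :
    ∃ p q : ExpandVerts G S', p.1.1 = v ∧ q.1.1 = w ∧ M.Adj p q ∧ G.Adj v w ∧ Face p w ∧ Face q v := by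
  obtain ⟨h, p, q, h1, h2, h3⟩ := h
  have := M.adj_sub h3
  rw [expand_adj] at this
  subst h1 h2
  rcases this with h' | h'
  · exact absurd h'.1 h
  · exact ⟨p, q, rfl, rfl, h3, h'⟩

theorem proj_face {M : (expand G S').Subgraph} {p q : ExpandVerts G S'}
    (h : (proj M).Adj p.1.1 q.1.1) (hp : Face p q.1.1) (hq : Face q p.1.1) : M.Adj p q := by
  obtain ⟨p', q', h1, h2, h3, h4, h5, h6⟩ := proj_adj h
  rwa [← face_unique h1 h5 hp, ← face_unique h2 h6 hq]

theorem eq_lift (hc : Cub G S') {M : (expand G S').Subgraph} (hM : M.IsPerfectMatching)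
    (p q : ExpandVerts G S') : M.Adj p q ↔ LiftAdj (proj M) p q := by
  rw [Subgraph.isPerfectMatching_iff] at hM
  have hout : ∀ p : ExpandVerts G S', Out (proj M) p ↔ ∃ q, q.1.1 ≠ p.1.1 ∧ M.Adj p q := by
    intro p
    constructor
    · rintro ⟨w, hw, h⟩
      obtain ⟨p', q', h1, h2, h3, h4, h5, h6⟩ := proj_adj h
      have := face_unique h1 h5 hw
      subst this h2
      exact ⟨q', h4.ne', h3⟩
    · rintro ⟨q, hq, h⟩
      have := M.adj_sub h
      rw [expand_adj] at this
      rcases this with h' | h'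
      · exact absurd h'.1.symm hq
      · exact ⟨q.1.1, h'.2.1, hq.symm, p, q, rfl, rfl, h⟩
  constructor
  · intro h
    by_cases e : p.1.1 = q.1.1
    · refine Or.inl ⟨e, (M.adj_sub h).ne, ?_, ?_⟩
      · rw [hout]; rintro ⟨q', h1, h2⟩
        have := (hM p).unique h h2
        subst this; exact h1 e.symm
      · rw [hout]; rintro ⟨q', h1, h2⟩
        have := (hM q).unique h.symm h2
        subst this; exact h1 e
    · have := M.adj_sub h
      rw [expand_adj] at this
      rcases this with h' | h'
      · exact absurd h'.1 e
      · exact Or.inr ⟨⟨e, p, q, rfl, rfl, h⟩, h'.2⟩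
  · rintro (⟨h1, h2, h3, h4⟩ | ⟨h1, h2, h3⟩)
    · by_cases hS : p.1.1 ∈ S'
      · obtain ⟨a, b, -, -, -, ha, hb, -, -, -, -, hpa, hpb, hab, -, -, -, hall⟩ :=
          triple_blob hc p hS
        rw [hout] at h3 h4
        push Not at h3 h4
        obtain ⟨p', hp', -⟩ := hM p
        obtain ⟨q', hq', -⟩ := hM q
        have e1 : p'.1.1 = p.1.1 := by
          by_contra e; exact h3 p' e hp'
        have e2 : q'.1.1 = p.1.1 := by
          by_contra e; exact h4 q' (by rwa [← h1]) hq'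
        have n1 := (M.adj_sub hp').ne
        have n2 := (M.adj_sub hq').ne
        by_contra hn
        have key : q' = p' := by
          have := hall p' e1
          have := hall q' e2
          have := hall q h1.symm
          have : p' ≠ q := by rintro rfl; exact hn hp'
          have : q' ≠ p := by rintro rfl; exact hn hq'.symm
          grind
        subst key
        exact h2 ((hM q').unique hp'.symm hq'.symm)
      · exact absurd (blob_notMem h1 hS) h2
    · exact proj_face h1 h2 h3

theorem proj_cfg (hc : Cub G S') {M : (expand G S').Subgraph} (hM : M.IsPerfectMatching) :
    Cfg G S' (proj M) := by
  refine ⟨fun v w h => (proj_adj h).choose_spec.choose_spec.2.2.2.1, fun v => ?_⟩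
  have hM' := hM
  rw [Subgraph.isPerfectMatching_iff] at hM'
  by_cases hS : v ∈ S'
  · obtain ⟨a0, _, _, -, -, -, h0⟩ := hc v hS
    obtain ⟨p, hp, -⟩ := exists_face (G := G) (S' := S') v a0 ((h0 a0).2 (by simp))
    subst hp
    obtain ⟨q, r, a, b, c, hq, hr, hab, hac, hbc, hG, hpq, hpr, hqr, hpf, hqf, hrf, hall⟩ :=
      triple_blob hc p hS
    have hpo : Out (proj M) p ↔ (proj M).Adj p.1.1 a := by simp [Out, hpf]
    have hqo : Out (proj M) q ↔ (proj M).Adj p.1.1 b := by simp [Out, hqf, hq]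
    have hro : Out (proj M) r ↔ (proj M).Adj p.1.1 c := by simp [Out, hrf, hr]
    have inner : ∀ s s' : ExpandVerts G S', M.Adj s s' → s'.1.1 = s.1.1 → ¬ Out (proj M) s ∧ ¬ Out (proj M) s' := by
      intro s s' h e
      rcases (eq_lift hc hM s s').1 h with h' | h'
      · exact ⟨h'.2.2.1, h'.2.2.2⟩
      · exact absurd e.symm h'.1.ne
    have outer : ∀ s s' : ExpandVerts G S', M.Adj s s' → s'.1.1 ≠ s.1.1 → Out (proj M) s := by
      intro s s' h e
      rcases (eq_lift hc hM s s').1 h with h' | h'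
      · exact absurd h'.1.symm e
      · exact ⟨_, h'.2.1, h'.1⟩
    have hle : ∀ w, (proj M).Adj p.1.1 w → w = a ∨ w = b ∨ w = c := by
      intro w h
      exact (hG w).1 (proj_adj h).choose_spec.choose_spec.2.2.2.1
    have alt : (Out (proj M) p ∧ Out (proj M) q ∧ Out (proj M) r) ∨
        (Out (proj M) p ∧ ¬ Out (proj M) q ∧ ¬ Out (proj M) r) ∨
        (¬ Out (proj M) p ∧ Out (proj M) q ∧ ¬ Out (proj M) r) ∨
        (¬ Out (proj M) p ∧ ¬ Out (proj M) q ∧ Out (proj M) r) := by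
      have m1 : ∀ s s' : ExpandVerts G S', ¬ Out (proj M) s → ¬ Out (proj M) s' → s ≠ s' →
          s.1.1 = s'.1.1 → M.Adj s s' := fun s s' h1 h2 h3 h4 =>
        (eq_lift hc hM s s').2 (Or.inl ⟨h4, h3, h1, h2⟩)
      have m2 : ∀ s : ExpandVerts G S', s.1.1 = p.1.1 → ¬ Out (proj M) s →
          ∃ s', s' ≠ s ∧ s'.1.1 = p.1.1 ∧ ¬ Out (proj M) s' := by
        intro s hs h
        obtain ⟨s', h', -⟩ := hM' s
        have e : s'.1.1 = s.1.1 := by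
          by_contra e; exact h (outer _ _ h' e)
        exact ⟨s', (M.adj_sub h').ne', e.trans hs, (inner _ _ h' e).2⟩
      by_cases op : Out (proj M) p <;> by_cases oq : Out (proj M) q <;>
        by_cases or' : Out (proj M) r <;> simp only [op, oq, or'] <;> simp
      · obtain ⟨s, h1, h2, h3⟩ := m2 r hr or'
        rcases hall s h2 with rfl | rfl | rfl <;> contradiction
      · obtain ⟨s, h1, h2, h3⟩ := m2 q hq oq
        rcases hall s h2 with rfl | rfl | rfl <;> contradiction
      · obtain ⟨s, h1, h2, h3⟩ := m2 p rfl op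
        rcases hall s h2 with rfl | rfl | rfl <;> contradiction
      · exact hqr ((hM' p).unique (m1 p q op oq hpq hq.symm) (m1 p r op or' hpr hr.symm))
    rw [hpo, hqo, hro] at alt
    rcases alt with h | h | h | h
    · right; refine ⟨hS, fun w hw => ?_⟩
      rcases (hG w).1 hw with rfl | rfl | rfl
      exacts [h.1, h.2.1, h.2.2]
    · left; refine ⟨a, h.1, fun w hw => ?_⟩
      rcases hle w hw with rfl | rfl | rfl
      exacts [rfl, absurd hw h.2.1, absurd hw h.2.2]
    · left; refine ⟨b, h.2.1, fun w hw => ?_⟩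
      rcases hle w hw with rfl | rfl | rfl
      exacts [absurd hw h.1, rfl, absurd hw h.2.2]
    · left; refine ⟨c, h.2.2, fun w hw => ?_⟩
      rcases hle w hw with rfl | rfl | rfl
      exacts [absurd hw h.1, absurd hw h.2.1, rfl]
  · left
    let p : ExpandVerts G S' := ⟨(v, none), Or.inl ⟨hS, rfl⟩⟩
    obtain ⟨q, hq, hqu⟩ := hM' p
    have : q.1.1 ≠ v := by
      intro e
      exact (M.adj_sub hq).ne (blob_notMem (p := p) e.symm hS)
    refine ⟨q.1.1, ⟨this.symm, p, q, rfl, rfl, hq⟩, ?_⟩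
    intro w hw
    obtain ⟨p', q', h1, h2, h3, h4, h5, h6⟩ := proj_adj hw
    have e : p = p' := blob_notMem (p := p) h1.symm hS
    subst e
    rw [← h2, hqu _ h3]

theorem proj_lift (hc : Cub G S') {H : SimpleGraph V} (h : Cfg G S' H) :
    proj (liftSub H h.1 : (expand G S').Subgraph) = H := by
  ext v w
  constructor
  · rintro ⟨h, p, q, rfl, rfl, h'⟩
    rcases h' with h' | h'
    · exact absurd h'.1 h
    · exact h'.1
  · intro hvw
    obtain ⟨p, hp, hpf⟩ := exists_face (G := G) (S' := S') v w (h.1 hvw)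
    obtain ⟨q, hq, hqf⟩ := exists_face (G := G) (S' := S') w v (h.1 hvw).symm
    subst hp hq
    exact ⟨hvw.ne, p, q, rfl, rfl, Or.inr ⟨hvw, hpf, hqf⟩⟩

theorem numPM_expand (hc : Cub G S') : numPM (expand G S') = Set.ncard {H | Cfg G S' H} := by
  unfold numPM
  refine Set.ncard_congr (fun M _ => proj M) (fun M hM => proj_cfg hc hM) ?_ ?_
  · intro M N hM hN h
    apply Subgraph.ext
    · rw [hM.2.verts_eq_univ, hN.2.verts_eq_univ]
    · funext p q
      rw [eq_iff_iff, eq_lift hc hM, eq_lift hc hN, h]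
  · intro H hH
    exact ⟨liftSub H hH.1, liftSub_pm hc hH, proj_lift hc hH⟩

end ExpandGeneral

section ExpandBrick
variable {V : Type*} {G : SimpleGraph V} {S' : Set V}

/-- An edge set which is a perfect matching of `G - v - w`. -/
def DelPM (G : SimpleGraph V) (v w : V) (H : SimpleGraph V) : Prop :=
  H ≤ G ∧ (∀ y, ¬ H.Adj v y) ∧ (∀ y, ¬ H.Adj w y) ∧ ∀ z, z ≠ v → z ≠ w → ∃! y, H.Adj z y

theorem induce_pm {W : Type*} {K : SimpleGraph W} (s : Set W) (R : W → W → Prop)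
    (hs : ∀ p q, R p q → R q p) (hK : ∀ p q, R p q → K.Adj p q)
    (h : ∀ p ∈ s, ∃ q ∈ s, R p q ∧ ∀ q' ∈ s, R p q' → q' = q) :
    ∃ M : (K.induce s).Subgraph, M.IsPerfectMatching := by
  let M : (K.induce s).Subgraph :=
    { verts := Set.univ
      Adj := fun p q => R p.1 q.1
      adj_sub := fun h => hK _ _ h
      edge_vert := fun _ => trivial
      symm := ⟨fun _ _ h => hs _ _ h⟩ }
  refine ⟨M, ?_⟩
  rw [Subgraph.isPerfectMatching_iff]
  rintro ⟨p, hp⟩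
  obtain ⟨q, hq, h1, h2⟩ := h p hp
  exact ⟨⟨q, hq⟩, h1, fun q' hq' => Subtype.ext (h2 q'.1 q'.2 hq')⟩

theorem bicritical_expand (hc : Cub G S') (hG : ∀ v w, v ≠ w → ∃ H, DelPM G v w H)
    (x y : ExpandVerts G S') (hxy : x ≠ y) :
    ∃ M : ((expand G S').induce {v | v ≠ x ∧ v ≠ y}).Subgraph, M.IsPerfectMatching := by
  by_cases hb : x.1.1 = y.1.1
  · have hS : x.1.1 ∈ S' := by
      by_contra h; exact hxy (blob_notMem hb h)
    have key : ∀ z : ExpandVerts G S', ∀ c, z ≠ x → z ≠ y → z.1.1 = x.1.1 → G.Adj x.1.1 c → 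
        (∀ w, Face z w ↔ w = c) →
        (∀ s : ExpandVerts G S', s.1.1 = x.1.1 → s = x ∨ s = y ∨ s = z) → 
        ¬ Face x c → ¬ Face y c →
        ∃ M : ((expand G S').induce {v | v ≠ x ∧ v ≠ y}).Subgraph, M.IsPerfectMatching := by
      intro z c hzx hzy hz hadj hzf hall hx hy
      obtain ⟨H, hle, hv, hw, hH⟩ := hG x.1.1 c hadj.ne
      let H' : SimpleGraph V := H ⊔ SimpleGraph.edge x.1.1 c
      have hadj' : ∀ a b, H'.Adj a b ↔ H.Adj a b ∨ (a = x.1.1 ∧ b = c) ∨ (a = c ∧ b = x.1.1) := by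
        intro a b
        simp only [H', sup_adj, edge_adj]
        have := hadj.ne
        grind
      have hle' : H' ≤ G := by
        intro a b hab
        rw [hadj'] at hab
        rcases hab with h | ⟨rfl, rfl⟩ | ⟨rfl, rfl⟩
        exacts [hle h, hadj, hadj.symm]
      have hu : ∀ a, ∃! b, H'.Adj a b := by
        intro a
        by_cases h1 : a = x.1.1
        · refine ⟨c, (hadj' _ _).2 (by simp [h1]), fun b hb => ?_⟩
          replace hb := (hadj' _ _).1 hb
          have := hadj.ne
          have := hv b
          grind
        by_cases h2 : a = c
        · refine ⟨x.1.1, (hadj' _ _).2 (by simp [h2]), fun b hb => ?_⟩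
          replace hb := (hadj' _ _).1 hb
          have := hadj.ne
          have := hw b
          grind
        obtain ⟨b, hb, hb'⟩ := hH a h1 h2
        refine ⟨b, (hadj' _ _).2 (Or.inl hb), fun b' h => ?_⟩
        replace h := (hadj' _ _).1 h
        grind
      have hno : ∀ p x' : ExpandVerts G S', p ≠ x → p ≠ y → x'.1.1 = x.1.1 → ¬ Face x' c →
          ¬ LiftAdj H' p x' := by
        rintro p x' hpx hpy e hf (⟨h1, h2, h3, h4⟩ | ⟨h1, h2, h3⟩)
        · rcases hall p (h1.trans e) with rfl | rfl | rfl
          · exact hpx rfl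
          · exact hpy rfl
          · exact h3 ⟨c, (hzf c).2 rfl, (hadj' _ _).2 (by simp [hz])⟩
        · rw [hadj'] at h1
          rcases h1 with h | ⟨h, h'⟩ | ⟨h, h'⟩
          · rw [e] at h; exact hv _ h.symm
          · rw [e] at h'; exact hadj.ne h'
          · rw [h] at h3; exact hf h3
      refine induce_pm _ (LiftAdj H') (fun _ _ h => h.symm) (fun _ _ h => h.adj hle') ?_
      rintro p ⟨hpx, hpy⟩
      obtain ⟨q, hq, hq'⟩ := lift_unique hc hle' p (Or.inl (hu _))
      refine ⟨q, ⟨?_, ?_⟩, hq, fun q' _ h => hq' q' h⟩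
      · rintro rfl; exact hno p q hpx hpy rfl hx hq
      · rintro rfl; exact hno p q hpx hpy hb.symm hy hq
    obtain ⟨q, r, a, b, c, hq, hr, hab, hac, hbc, hG', hpq, hpr, hqr, hpf, hqf, hrf, hall⟩ :=
      triple_blob hc x hS
    rcases hall y hb.symm with rfl | rfl | rfl
    · exact absurd rfl hxy
    · exact key r c hpr.symm hqr.symm hr ((hG' c).2 (by simp)) hrf hall
        (by rw [hpf]; exact hac.symm) (by rw [hqf]; exact hbc.symm)
    · exact key q b hpq.symm hqr hq ((hG' b).2 (by simp)) hqf (by grind)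
        (by rw [hpf]; exact hab.symm) (by rw [hrf]; exact hbc)
  · obtain ⟨H, hle, hv, hw, hH⟩ := hG _ _ hb
    refine induce_pm _ (LiftAdj H) (fun _ _ h => h.symm) (fun _ _ h => h.adj hle) ?_
    rintro p ⟨hpx, hpy⟩
    have inblob : ∀ x y : ExpandVerts G S', x.1.1 ≠ y.1.1 → (∀ z, ¬ H.Adj x.1.1 z) → p ≠ x →
        p.1.1 = x.1.1 → ∃ q : ExpandVerts G S', (q ≠ x ∧ q ≠ y) ∧ LiftAdj H p q ∧
        ∀ q' : ExpandVerts G S', (q' ≠ x ∧ q' ≠ y) → LiftAdj H p q' → q' = q := by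
      intro x y hb hv hpx e
      have hS : p.1.1 ∈ S' := by
        by_contra h; exact hpx (blob_notMem e h)
      obtain ⟨q, r, a, b, c, hq, hr, hab, hac, hbc, hG', hpq, hpr, hqr, hpf, hqf, hrf, hall⟩ :=
        triple_blob hc p hS
      have hout : ∀ s : ExpandVerts G S', s.1.1 = x.1.1 → ¬ Out H s := by
        rintro s hs ⟨w, -, h⟩
        rw [hs] at h; exact hv _ h
      have hin : ∀ s, LiftAdj H p s → s.1.1 = p.1.1 ∧ s ≠ p := by
        rintro s (⟨h1, h2, h3, h4⟩ | ⟨h1, h2, h3⟩)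
        · exact ⟨h1.symm, h2.symm⟩
        · rw [e] at h1; exact absurd h1 (hv _)
      have hyb : ∀ s : ExpandVerts G S', s.1.1 = p.1.1 → s ≠ y := by
        rintro s hs rfl; exact hb (by rw [← e, hs])
      rcases hall x e.symm with rfl | rfl | rfl
      · exact absurd rfl hpx
      · refine ⟨r, ⟨hqr.symm, hyb r hr⟩, Or.inl ⟨hr.symm, hpr, hout p e, hout r (hr.trans e)⟩, ?_⟩
        rintro q' ⟨h1, h2⟩ h3
        obtain ⟨h4, h5⟩ := hin q' h3
        rcases hall q' h4 with h | h | h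
        exacts [absurd h h5, absurd h h1, h]
      · refine ⟨q, ⟨hqr, hyb q hq⟩, Or.inl ⟨hq.symm, hpq, hout p e, hout q (hq.trans e)⟩, ?_⟩
        rintro q' ⟨h1, h2⟩ h3
        obtain ⟨h4, h5⟩ := hin q' h3
        rcases hall q' h4 with h | h | h
        exacts [absurd h h5, h, absurd h h1]
    by_cases h1 : p.1.1 = x.1.1
    · exact inblob x y hb hv hpx h1
    by_cases h2 : p.1.1 = y.1.1
    · obtain ⟨q, h1, h2, h3⟩ := inblob y x (Ne.symm hb) hw hpy h2
      exact ⟨q, ⟨h1.2, h1.1⟩, h2, fun q' h => h3 q' ⟨h.2, h.1⟩⟩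
    obtain ⟨q, hq, hq'⟩ := lift_unique hc hle p (Or.inl (hH _ h1 h2))
    refine ⟨q, ⟨?_, ?_⟩, hq, fun q' _ h => hq' q' h⟩
    · rintro rfl
      rcases hq with h | h
      exacts [h1 h.1, hv _ h.1.symm]
    · rintro rfl
      rcases hq with h | h
      exacts [h2 h.1, hw _ h.1.symm]

/-- `PathTo G r v L`: there is a walk from `v` to `r` with interior vertices `L`. -/
inductive PathTo (G : SimpleGraph V) (r : V) : V → List V → Prop
  | nil (v : V) : G.Adj v r → PathTo G r v []
  | cons (v w : V) (L : List V) : G.Adj v w → PathTo G r w L → PathTo G r v (w :: L)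

theorem PathTo.head {r v : V} {L : List V} (h : PathTo G r v L) : G.Adj v (L.headD r) := by
  cases h <;> simpa

theorem reach_path {X : Set (ExpandVerts G S')} {r : V} (hr : ∀ x ∈ X, x.1.1 ≠ r) {v : V}
    {L : List V} (h : PathTo G r v L) : ∀ p : ((Xᶜ : Set (ExpandVerts G S'))), p.1.1.1 = v →
    Face p.1 (L.headD r) → (∀ z ∈ L, ∀ x ∈ X, x.1.1 ≠ z) →
    ∃ q : ((Xᶜ : Set (ExpandVerts G S'))), q.1.1.1 = r ∧ ((expand G S').induce Xᶜ).Reachable p q := by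
  induction h with
  | nil v h =>
    intro p hp hf _
    obtain ⟨q, hq, hqf⟩ := exists_face (G := G) (S' := S') r v h.symm
    refine ⟨⟨q, fun hX => hr q hX hq⟩, hq, Adj.reachable ?_⟩
    subst hp hq
    exact (expand_adj _ _).2 (Or.inr ⟨h, hf, hqf⟩)
  | cons v w L h hL ih =>
    intro p hp hf hcl
    obtain ⟨q, hq, hqf⟩ := exists_face (G := G) (S' := S') w v h.symm
    obtain ⟨q', hq', hqf'⟩ := exists_face (G := G) (S' := S') w _ hL.head
    have hqX : q ∈ Xᶜ := fun hX => hcl w (by simp) q hX hq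
    have hqX' : q' ∈ Xᶜ := fun hX => hcl w (by simp) q' hX hq'
    obtain ⟨s, hs, hreach⟩ := ih ⟨q', hqX'⟩ hq' hqf' (fun z hz => hcl z (by simp [hz]))
    refine ⟨s, hs, Reachable.trans (v := ⟨q, hqX⟩) (Adj.reachable ?_) (Reachable.trans ?_ hreach)⟩
    · subst hp hq
      exact (expand_adj _ _).2 (Or.inr ⟨h, hf, hqf⟩)
    · by_cases e : q = q'
      · subst e; exact Reachable.refl _
      · exact Adj.reachable ((expand_adj _ _).2 (Or.inl ⟨hq.trans hq'.symm, e⟩))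

/-- The deleted vertex `x` blocks the path with interior `L` starting at `v`. -/
def Blocks (r v : V) (x : ExpandVerts G S') (L : List V) : Prop :=
  x.1.1 ∈ L ∨ (x.1.1 = v ∧ Face x (L.headD r))

theorem connected_of_paths {X : Set (ExpandVerts G S')} {r : V} (hr : ∀ x ∈ X, x.1.1 ≠ r)
    (hne : ∃ w, G.Adj r w)
    (h : ∀ p ∉ X, p.1.1 ≠ r → ∃ L, PathTo G r p.1.1 L ∧ ∀ x ∈ X, ¬ Blocks r p.1.1 x L) :
    ((expand G S').induce Xᶜ).Connected := by
  obtain ⟨w0, hw0⟩ := hne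
  obtain ⟨p0, hp0, -⟩ := exists_face (G := G) (S' := S') r w0 hw0
  have hp0X : p0 ∈ Xᶜ := fun hX => hr p0 hX hp0
  have key : ∀ p : ((Xᶜ : Set (ExpandVerts G S'))), 
      ((expand G S').induce Xᶜ).Reachable p ⟨p0, hp0X⟩ := by
    have blob : ∀ p : ((Xᶜ : Set (ExpandVerts G S'))), p.1.1.1 = r → 
        ((expand G S').induce Xᶜ).Reachable p ⟨p0, hp0X⟩ := by
      rintro ⟨q, hq⟩ hqr
      by_cases e : q = p0
      · subst e; exact Reachable.refl _
      · exact Adj.reachable ((expand_adj _ _).2 (Or.inl ⟨hqr.trans hp0.symm, e⟩))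
    rintro ⟨p, hp⟩
    by_cases e : p.1.1 = r
    · exact blob _ e
    · obtain ⟨L, hL, hb⟩ := h p hp e
      obtain ⟨q, hq, hqf⟩ := exists_face (G := G) (S' := S') _ _ hL.head
      have hqX : q ∈ Xᶜ := fun hX => hb q hX (Or.inr ⟨hq, hqf⟩)
      obtain ⟨s, hs, hreach⟩ := reach_path hr hL ⟨q, hqX⟩ hq hqf
        (fun z hz x hx e => hb x hx (Or.inl (e ▸ hz)))
      refine Reachable.trans ?_ (hreach.trans (blob s hs))
      by_cases e : p = q
      · subst e; exact Reachable.refl _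
      · exact Adj.reachable ((expand_adj _ _).2 (Or.inl ⟨hq.symm, e⟩))
  have : Nonempty ((Xᶜ : Set (ExpandVerts G S'))) := ⟨⟨p0, hp0X⟩⟩
  exact ⟨fun p q => (key p).trans (key q).symm⟩

theorem blocks_unique {X : Set (ExpandVerts G S')} {r : V} {p x : ExpandVerts G S'} (hp : p ∉ X)
    (hx : x ∈ X) {L L' : List V} (hd : L.Disjoint L') (hv : p.1.1 ∉ L) (hv' : p.1.1 ∉ L')
    (hh : L.headD r ≠ L'.headD r) (h : Blocks r p.1.1 x L) (h' : Blocks r p.1.1 x L') : False := by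
  rcases h with h | ⟨h1, h2⟩ <;> rcases h' with h' | ⟨h1', h2'⟩
  · exact hd h h'
  · rw [h1'] at h; exact hv h
  · rw [h1] at h'; exact hv' h'
  · by_cases hS : x.1.1 ∈ S'
    · obtain ⟨w, -, hw⟩ := face_mem x hS
      exact hh (((hw _).1 h2).trans ((hw _).1 h2').symm)
    · exact hp (blob_notMem h1 hS ▸ hx)

theorem card_three {W : Type*} [Finite W] {X : Set W} (hX : X.ncard ≤ 2) {a b c : W} (ha : a ∈ X)
    (hb : b ∈ X) (hc : c ∈ X) (hab : a ≠ b) (hac : a ≠ c) (hbc : b ≠ c) : False := by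
  have h1 : ({a, b, c} : Set W).ncard = 3 := Set.ncard_eq_three.2 ⟨a, b, c, hab, hac, hbc, rfl⟩
  have h2 : ({a, b, c} : Set W) ⊆ X := by
    intro x hx
    simp at hx
    rcases hx with rfl | rfl | rfl <;> assumption
  have := Set.ncard_le_ncard h2 (Set.toFinite X)
  omega

theorem three_paths [Finite V] {X : Set (ExpandVerts G S')} (hX : X.ncard ≤ 2) {r : V}
    {p : ExpandVerts G S'} (hp : p ∉ X) {L1 L2 L3 : List V} (h1 : PathTo G r p.1.1 L1)
    (h2 : PathTo G r p.1.1 L2) (h3 : PathTo G r p.1.1 L3) (d12 : L1.Disjoint L2)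
    (d13 : L1.Disjoint L3) (d23 : L2.Disjoint L3) (n1 : p.1.1 ∉ L1) (n2 : p.1.1 ∉ L2)
    (n3 : p.1.1 ∉ L3) (e12 : L1.headD r ≠ L2.headD r) (e13 : L1.headD r ≠ L3.headD r)
    (e23 : L2.headD r ≠ L3.headD r) :
    ∃ L, PathTo G r p.1.1 L ∧ ∀ x ∈ X, ¬ Blocks r p.1.1 x L := by
  by_contra hcon
  push Not at hcon
  obtain ⟨x1, hx1, b1⟩ := hcon L1 h1
  obtain ⟨x2, hx2, b2⟩ := hcon L2 h2
  obtain ⟨x3, hx3, b3⟩ := hcon L3 h3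
  refine card_three hX hx1 hx2 hx3 ?_ ?_ ?_
  · rintro rfl; exact blocks_unique hp hx1 d12 n1 n2 e12 b1 b2
  · rintro rfl; exact blocks_unique hp hx1 d13 n1 n3 e13 b1 b3
  · rintro rfl; exact blocks_unique hp hx2 d23 n2 n3 e23 b2 b3

theorem two_paths [Finite V] {X : Set (ExpandVerts G S')} (hX : X.ncard ≤ 2) {r : V}
    {p : ExpandVerts G S'} (hp : p ∉ X) {L1 L2 : List V} (h1 : PathTo G r p.1.1 L1)
    (h2 : PathTo G r p.1.1 L2) (d12 : L1.Disjoint L2)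
    (n1 : p.1.1 ∉ L1) (n2 : p.1.1 ∉ L2) (e12 : L1.headD r ≠ L2.headD r)
    {x0 : ExpandVerts G S'} (hx0 : x0 ∈ X) (m1 : x0.1.1 ∉ L1) (m2 : x0.1.1 ∉ L2)
    (m3 : x0.1.1 ≠ p.1.1) :
    ∃ L, PathTo G r p.1.1 L ∧ ∀ x ∈ X, ¬ Blocks r p.1.1 x L := by
  by_contra hcon
  push Not at hcon
  obtain ⟨x1, hx1, b1⟩ := hcon L1 h1
  obtain ⟨x2, hx2, b2⟩ := hcon L2 h2
  refine card_three hX hx1 hx2 hx0 ?_ ?_ ?_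
  · rintro rfl; exact blocks_unique hp hx1 d12 n1 n2 e12 b1 b2
  · rintro rfl
    rcases b1 with b | b
    exacts [m1 b, m3 b.1]
  · rintro rfl
    rcases b2 with b | b
    exacts [m2 b, m3 b.1]

end ExpandBrick

section GraphG
variable {t : ℕ}

/-- The vertex type of `G'_t`. -/
abbrev VT (t : ℕ) := (Fin (t + 1) × Fin 4) ⊕ Bool

theorem adj_ll (s s' : Fin (t + 1)) (j j' : Fin 4) :
    (G't t).Adj (Sum.inl (s, j)) (Sum.inl (s', j')) ↔
      (s = s' ∧ ((j' : ℕ) = j + 1 ∨ (j : ℕ) = j' + 1)) ∨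
      (j = 0 ∧ j' = 0 ∧ ((s' : ℕ) = s + 1 ∨ (s : ℕ) = s' + 1)) ∨
      (j = 3 ∧ j' = 2 ∧ (s' : ℕ) = s + 1) ∨ (j = 2 ∧ j' = 3 ∧ (s : ℕ) = s' + 1) := by
  simp only [G't, fromRel_adj, ne_eq, Sum.inl.injEq, Prod.mk.injEq, reduceCtorEq, and_false,
    or_false]
  constructor
  · rintro ⟨hne, (⟨a, b, c, h, ⟨rfl, rfl⟩, rfl, rfl⟩ | ⟨a, b, h, (⟨⟨rfl, rfl⟩, rfl, rfl⟩ | ⟨⟨rfl, rfl⟩, rfl, rfl⟩)⟩) |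
      (⟨a, b, c, h, ⟨rfl, rfl⟩, rfl, rfl⟩ | ⟨a, b, h, (⟨⟨rfl, rfl⟩, rfl, rfl⟩ | ⟨⟨rfl, rfl⟩, rfl, rfl⟩)⟩)⟩ <;> simp [h]
  · rintro (⟨rfl, h | h⟩ | ⟨rfl, rfl, h | h⟩ | ⟨rfl, rfl, h⟩ | ⟨rfl, rfl, h⟩)
    · exact ⟨by rintro ⟨-, rfl⟩; omega, Or.inl (Or.inl ⟨s, j, j', h, ⟨rfl, rfl⟩, rfl, rfl⟩)⟩
    · exact ⟨by rintro ⟨-, rfl⟩; omega, Or.inr (Or.inl ⟨s, j', j, h, ⟨rfl, rfl⟩, rfl, rfl⟩)⟩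
    · exact ⟨by rintro ⟨rfl, -⟩; omega, Or.inl (Or.inr ⟨s, s', h, Or.inl ⟨⟨rfl, rfl⟩, rfl, rfl⟩⟩)⟩
    · exact ⟨by rintro ⟨rfl, -⟩; omega, Or.inr (Or.inr ⟨s', s, h, Or.inl ⟨⟨rfl, rfl⟩, rfl, rfl⟩⟩)⟩
    · exact ⟨by rintro ⟨rfl, -⟩; omega, Or.inl (Or.inr ⟨s, s', h, Or.inr ⟨⟨rfl, rfl⟩, rfl, rfl⟩⟩)⟩
    · exact ⟨by rintro ⟨rfl, -⟩; omega, Or.inr (Or.inr ⟨s', s, h, Or.inr ⟨⟨rfl, rfl⟩, rfl, rfl⟩⟩)⟩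

theorem adj_lf (s : Fin (t + 1)) (j : Fin 4) :
    (G't t).Adj (Sum.inl (s, j)) (Sum.inr false) ↔ (s : ℕ) = t ∧ (j = 0 ∨ j = 3) := by
  have h : s = Fin.last t ↔ (s : ℕ) = t := Fin.ext_iff
  fin_cases j <;> simp [G't, fromRel_adj, h]

theorem adj_lt (s : Fin (t + 1)) (j : Fin 4) :
    (G't t).Adj (Sum.inl (s, j)) (Sum.inr true) ↔
      ((s : ℕ) = 0 ∧ (j = 0 ∨ j = 2)) ∨ j = 1 ∨ j = 3 := by
  have h : s = 0 ↔ (s : ℕ) = 0 := Fin.ext_iff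
  rw [← h]
  fin_cases j <;> simp [G't, fromRel_adj, Sset]

theorem adj_ft : (G't t).Adj (Sum.inr false) (Sum.inr true) := by
  simp [G't, fromRel_adj, Sset]

theorem adj_fl (s : Fin (t + 1)) (j : Fin 4) :
    (G't t).Adj (Sum.inr false) (Sum.inl (s, j)) ↔ (s : ℕ) = t ∧ (j = 0 ∨ j = 3) := by
  rw [SimpleGraph.adj_comm, adj_lf]

theorem adj_tl (s : Fin (t + 1)) (j : Fin 4) :
    (G't t).Adj (Sum.inr true) (Sum.inl (s, j)) ↔
      ((s : ℕ) = 0 ∧ (j = 0 ∨ j = 2)) ∨ j = 1 ∨ j = 3 := by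
  rw [SimpleGraph.adj_comm, adj_lt]

/-- The left neighbor. -/
def prv (s : Fin (t + 1)) (j : Fin 4) : VT t :=
  Fin.cases (motive := fun _ => VT t) (Sum.inr true) (fun s' => Sum.inl (s'.castSucc, j)) s

/-- The right neighbor. -/
def nxt (s : Fin (t + 1)) (j : Fin 4) : VT t :=
  Fin.lastCases (motive := fun _ => VT t) (Sum.inr false) (fun s' => Sum.inl (s'.succ, j)) s

theorem eq_prv (w : VT t) (s : Fin (t + 1)) (j : Fin 4) : w = prv s j ↔
    ((s : ℕ) = 0 ∧ w = Sum.inr true) ∨ ∃ s' : Fin (t + 1), (s : ℕ) = s' + 1 ∧ w = Sum.inl (s', j) := by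
  refine Fin.cases ?_ (fun i => ?_) s
  · simp [prv]
  · simp [prv]
    constructor
    · intro h; exact ⟨i.castSucc, by simp, h⟩
    · rintro ⟨s', h, rfl⟩
      congr 2
      ext; simp [h]

theorem eq_nxt (w : VT t) (s : Fin (t + 1)) (j : Fin 4) : w = nxt s j ↔
    ((s : ℕ) = t ∧ w = Sum.inr false) ∨ ∃ s' : Fin (t + 1), (s' : ℕ) = s + 1 ∧ w = Sum.inl (s', j) := by
  refine Fin.lastCases ?_ (fun i => ?_) s
  · simp [nxt]
    intro s' h; omega
  · simp [nxt]
    constructor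
    · intro h; exact Or.inr ⟨i.succ, by simp, h⟩
    · rintro (⟨h, rfl⟩ | ⟨s', h, rfl⟩)
      · omega
      · congr 2
        ext; simp [h]

theorem nb0 (s : Fin (t + 1)) (w : VT t) : (G't t).Adj (Sum.inl (s, 0)) w ↔
    w = prv s 0 ∨ w = Sum.inl (s, 1) ∨ w = nxt s 0 := by
  rw [eq_prv, eq_nxt]
  rcases w with ⟨s', j⟩ | _ | _
  · rw [adj_ll]; fin_cases j <;> simp <;> grind
  · rw [adj_lf]; simp
  · rw [adj_lt]; simp

theorem nb1 (s : Fin (t + 1)) (w : VT t) : (G't t).Adj (Sum.inl (s, 1)) w ↔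
    w = Sum.inl (s, 0) ∨ w = Sum.inl (s, 2) ∨ w = Sum.inr true := by
  rcases w with ⟨s', j⟩ | _ | _
  · rw [adj_ll]; fin_cases j <;> simp <;> grind
  · rw [adj_lf]; simp
  · rw [adj_lt]; simp

theorem nb2 (s : Fin (t + 1)) (w : VT t) : (G't t).Adj (Sum.inl (s, 2)) w ↔
    w = prv s 3 ∨ w = Sum.inl (s, 1) ∨ w = Sum.inl (s, 3) := by
  rw [eq_prv]
  rcases w with ⟨s', j⟩ | _ | _
  · rw [adj_ll]; fin_cases j <;> simp <;> grind
  · rw [adj_lf]; simp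
  · rw [adj_lt]; simp

theorem nb3 (s : Fin (t + 1)) (w : VT t) : (G't t).Adj (Sum.inl (s, 3)) w ↔
    w = Sum.inl (s, 2) ∨ w = Sum.inr true ∨ w = nxt s 2 := by
  rw [eq_nxt]
  rcases w with ⟨s', j⟩ | _ | _
  · rw [adj_ll]; fin_cases j <;> simp <;> grind
  · rw [adj_lf]; simp
  · rw [adj_lt]; simp

theorem nbf (w : VT t) : (G't t).Adj (Sum.inr false) w ↔
    w = Sum.inl (Fin.last t, 0) ∨ w = Sum.inl (Fin.last t, 3) ∨ w = Sum.inr true := by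
  rcases w with ⟨s', j⟩ | _ | _
  · rw [adj_fl]; fin_cases j <;> simp <;> grind
  · simp
  · simp [adj_ft]

theorem ds0 (s : Fin (t + 1)) :
    prv s 0 ≠ Sum.inl (s, 1) ∧ prv s 0 ≠ nxt s 0 ∧ Sum.inl (s, 1) ≠ nxt s 0 := by
  refine ⟨?_, ?_, ?_⟩
  · rw [ne_comm, ne_eq, eq_prv]; grind
  · intro h
    have h1 := (eq_nxt _ s 0).1 h
    have h2 := (eq_prv _ s 0).1 rfl
    grind
  · rw [ne_eq, eq_nxt]; grind

theorem ds2 (s : Fin (t + 1)) :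
    prv s 3 ≠ Sum.inl (s, 1) ∧ prv s 3 ≠ Sum.inl (s, 3) ∧ (Sum.inl (s, 1) : VT t) ≠ Sum.inl (s, 3) := by
  refine ⟨?_, ?_, by simp⟩ <;> rw [ne_comm, ne_eq] <;> simp only [eq_prv] <;> grind

theorem ds3 (s : Fin (t + 1)) :
    (Sum.inl (s, 2) : VT t) ≠ Sum.inr true ∧ Sum.inl (s, 2) ≠ nxt s 2 ∧ Sum.inr true ≠ nxt s 2 := by
  refine ⟨by simp, ?_, ?_⟩ <;> rw [ne_eq] <;> simp only [eq_nxt] <;> grind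

theorem cub_G't (S' : Set (VT t)) (hS : Sum.inr true ∉ S') : Cub (G't t) S' := by
  rintro (⟨s, j⟩ | _ | _) hv
  · fin_cases j
    · exact ⟨_, _, _, (ds0 s).1, (ds0 s).2.1, (ds0 s).2.2, nb0 s⟩
    · exact ⟨_, _, _, by simp, by simp, by simp, nb1 s⟩
    · exact ⟨_, _, _, (ds2 s).1, (ds2 s).2.1, (ds2 s).2.2, nb2 s⟩
    · exact ⟨_, _, _, (ds3 s).1, (ds3 s).2.1, (ds3 s).2.2, nb3 s⟩
  · exact ⟨_, _, _, by simp, by simp, by simp, nbf⟩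
  · exact absurd hv hS

end GraphG

section Connectivity
variable {t : ℕ}

/-- The vertex `u_s^{j+1}` for `s ≤ t`, and `u` for larger `s`. -/
def U (t s : ℕ) (j : Fin 4) : VT t :=
  if h : s < t + 1 then Sum.inl (⟨s, h⟩, j) else Sum.inr false

theorem U_ne (s : ℕ) (j : Fin 4) : U t s j ≠ Sum.inr true := by
  unfold U; split_ifs <;> simp

theorem U_eq (s s' : ℕ) (j j' : Fin 4) :
    U t s j = U t s' j' ↔ (s ≤ t ∧ s = s' ∧ j = j') ∨ (t < s ∧ t < s') := by
  unfold U; split_ifs <;> simp <;> omega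

theorem a01 {s : ℕ} (h : s ≤ t) : (G't t).Adj (U t s 0) (U t s 1) := by
  simp [U, Nat.lt_succ_of_le h, adj_ll]

theorem a12 {s : ℕ} (h : s ≤ t) : (G't t).Adj (U t s 1) (U t s 2) := by
  simp [U, Nat.lt_succ_of_le h, adj_ll]

theorem a23 {s : ℕ} (h : s ≤ t) : (G't t).Adj (U t s 2) (U t s 3) := by
  simp [U, Nat.lt_succ_of_le h, adj_ll]

theorem a00 {s : ℕ} (h : s ≤ t) : (G't t).Adj (U t s 0) (U t (s + 1) 0) := by
  unfold U
  split_ifs with h1 h2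
  · simp [adj_ll]
  · rw [adj_lf]; simp; omega
  · omega
  · omega

theorem a32 {s : ℕ} (h : s ≤ t) : (G't t).Adj (U t s 3) (U t (s + 1) 2) := by
  unfold U
  split_ifs with h1 h2
  · simp [adj_ll]
  · rw [adj_lf]; simp; omega
  · omega
  · omega

theorem a1t {s : ℕ} (h : s ≤ t) : (G't t).Adj (U t s 1) (Sum.inr true) := by
  simp [U, Nat.lt_succ_of_le h, adj_lt]

theorem a3t {s : ℕ} (h : s ≤ t) : (G't t).Adj (U t s 3) (Sum.inr true) := by
  simp [U, Nat.lt_succ_of_le h, adj_lt]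

theorem a0t : (G't t).Adj (U t 0 0) (Sum.inr true) := by
  simp [U, adj_lt]

theorem a2t : (G't t).Adj (U t 0 2) (Sum.inr true) := by
  simp [U, adj_lt]

theorem aft (j : Fin 4) : (G't t).Adj (U t (t + 1) j) (Sum.inr true) := by
  simp [U, adj_ft]

theorem U_last (j : Fin 4) : U t (t + 1) j = Sum.inr false := by simp [U]

theorem V_cases (v : VT t) : v = Sum.inr true ∨ v = U t (t + 1) 0 ∨ ∃ s ≤ t, ∃ j, v = U t s j := by
  rcases v with ⟨s, j⟩ | _ | _
  · exact Or.inr (Or.inr ⟨s, by omega, j, by simp [U]; omega⟩)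
  · exact Or.inr (Or.inl (by simp [U]))
  · exact Or.inl rfl

open PathTo in
/-- Three independent paths from every vertex to `u'`. -/
theorem fan3 (v : VT t) (hv : v ≠ Sum.inr true) : ∃ L1 L2 L3 : List (VT t),
    PathTo (G't t) (Sum.inr true) v L1 ∧ PathTo (G't t) (Sum.inr true) v L2 ∧
    PathTo (G't t) (Sum.inr true) v L3 ∧ L1.Disjoint L2 ∧ L1.Disjoint L3 ∧ L2.Disjoint L3 ∧
    v ∉ L1 ∧ v ∉ L2 ∧ v ∉ L3 ∧ L1.headD (Sum.inr true) ≠ L2.headD (Sum.inr true) ∧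
    L1.headD (Sum.inr true) ≠ L3.headD (Sum.inr true) ∧
    L2.headD (Sum.inr true) ≠ L3.headD (Sum.inr true) := by
  rcases V_cases v with rfl | rfl | ⟨s, hs, j, rfl⟩
  · exact absurd rfl hv
  · refine ⟨[], [U t t 0, U t t 1], [U t t 3], nil _ (aft 0),
      cons _ _ _ (a00 le_rfl).symm (cons _ _ _ (a01 le_rfl) (nil _ (a1t le_rfl))),
      cons _ _ _ ?_ (nil _ (a3t le_rfl)), ?_⟩
    · have := (a32 (t := t) le_rfl).symm
      rwa [U_last] at this ⊢
    · simp [List.Disjoint, U_eq, U_ne, (U_ne _ _).symm]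
  · obtain rfl | rfl | rfl | rfl : j = 0 ∨ j = 1 ∨ j = 2 ∨ j = 3 := by fin_cases j <;> simp
    · rcases s with _ | s
      · refine ⟨[], [U t 0 1], if 0 < t then [U t 1 0, U t 1 1] else [U t (0 + 1) 0], nil _ a0t,
          cons _ _ _ (a01 hs) (nil _ (a1t hs)), ?_, ?_⟩
        · split_ifs with h
          · exact cons _ _ _ (a00 hs) (cons _ _ _ (a01 h) (nil _ (a1t h)))
          · obtain rfl : t = 0 := by omega
            exact cons _ _ _ (a00 hs) (nil _ (aft 0))
        · split_ifs with h <;> simp [List.Disjoint, U_eq, U_ne, (U_ne _ _).symm] <;> omega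
      · refine ⟨[U t (s + 1) 1], [U t s 0, U t s 1], if s + 1 < t then [U t (s + 2) 0, U t (s + 2) 1] 
            else [U t (s + 2) 0], cons _ _ _ (a01 hs) (nil _ (a1t hs)),
          cons _ _ _ (a00 (by omega)).symm (cons _ _ _ (a01 (by omega)) (nil _ (a1t (by omega)))), ?_, ?_⟩
        · split_ifs with h
          · exact cons _ _ _ (a00 hs) (cons _ _ _ (a01 h) (nil _ (a1t h)))
          · obtain rfl : t = s + 1 := by omega
            exact cons _ _ _ (a00 hs) (nil _ (aft 0))
        · split_ifs with h <;> simp [List.Disjoint, U_eq, U_ne, (U_ne _ _).symm] <;> omega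
    · refine ⟨[], [U t s 2, U t s 3], if s < t then [U t s 0, U t (s + 1) 0, U t (s + 1) 1] 
            else [U t s 0, U t (s + 1) 0], nil _ (a1t hs),
          cons _ _ _ (a12 hs) (cons _ _ _ (a23 hs) (nil _ (a3t hs))), ?_, ?_⟩
      · split_ifs with h
        · exact cons _ _ _ (a01 hs).symm (cons _ _ _ (a00 hs) (cons _ _ _ (a01 h) (nil _ (a1t h))))
        · obtain rfl : t = s := by omega
          exact cons _ _ _ (a01 hs).symm (cons _ _ _ (a00 hs) (nil _ (aft 0)))
      · split_ifs with h <;> simp [List.Disjoint, U_eq, U_ne, (U_ne _ _).symm] <;> omega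
    · rcases s with _ | s
      · refine ⟨[], [U t 0 1], [U t 0 3], nil _ a2t, cons _ _ _ (a12 hs).symm (nil _ (a1t hs)),
          cons _ _ _ (a23 hs) (nil _ (a3t hs)), ?_⟩
        simp [List.Disjoint, U_eq, U_ne, (U_ne _ _).symm]
      · refine ⟨[U t s 3], [U t (s + 1) 1], [U t (s + 1) 3],
          cons _ _ _ (a32 (by omega)).symm (nil _ (a3t (by omega))),
          cons _ _ _ (a12 hs).symm (nil _ (a1t hs)),
          cons _ _ _ (a23 hs) (nil _ (a3t hs)), ?_⟩
        simp [List.Disjoint, U_eq, U_ne, (U_ne _ _).symm]; try omega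
    · refine ⟨[], [U t s 2, U t s 1], if s < t then [U t (s + 1) 2, U t (s + 1) 1] 
            else [U t (s + 1) 2], nil _ (a3t hs),
          cons _ _ _ (a23 hs).symm (cons _ _ _ (a12 hs).symm (nil _ (a1t hs))), ?_, ?_⟩
      · split_ifs with h
        · exact cons _ _ _ (a32 hs) (cons _ _ _ (a12 h).symm (nil _ (a1t h)))
        · obtain rfl : t = s := by omega
          exact cons _ _ _ (a32 hs) (nil _ (aft 2))
      · split_ifs with h <;> simp [List.Disjoint, U_eq, U_ne, (U_ne _ _).symm] <;> omega

/-- Right-going top path. -/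
def topR (t : ℕ) : ℕ → ℕ → List (VT t)
  | _, 0 => []
  | s, k + 1 => U t (s + 1) 0 :: topR t (s + 1) k

/-- Right-going bottom path. -/
def botR (t : ℕ) : ℕ → ℕ → List (VT t)
  | _, 0 => []
  | s, k + 1 => U t (s + 1) 2 :: U t (s + 1) 3 :: botR t (s + 1) k

/-- Left-going top path. -/
def topL (t : ℕ) : ℕ → List (VT t)
  | 0 => []
  | s + 1 => U t s 0 :: topL t s

/-- Left-going bottom path. -/
def botL (t : ℕ) : ℕ → List (VT t)
  | 0 => []
  | s + 1 => U t s 3 :: U t s 2 :: botL t s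

theorem topR_path (s k : ℕ) (h : s + k = t) :
    PathTo (G't t) (Sum.inr false) (U t s 0) (topR t s k) := by
  induction k generalizing s with
  | zero => 
    have := a00 (t := t) (s := s) (by omega)
    obtain rfl : s = t := by omega
    rw [U_last] at this
    exact PathTo.nil _ this
  | succ k ih => exact PathTo.cons _ _ _ (a00 (by omega)) (ih (s + 1) (by omega))

theorem botR_path (s k : ℕ) (h : s + k = t) :
    PathTo (G't t) (Sum.inr false) (U t s 3) (botR t s k) := by
  induction k generalizing s with
  | zero => 
    have := a32 (t := t) (s := s) (by omega)
    obtain rfl : s = t := by omega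
    rw [U_last] at this
    exact PathTo.nil _ this
  | succ k ih =>
    exact PathTo.cons _ _ _ (a32 (by omega))
      (PathTo.cons _ _ _ (a23 (by omega)) (ih (s + 1) (by omega)))

theorem topL_path (s : ℕ) (h : s ≤ t) : PathTo (G't t) (U t 0 1) (U t s 0) (topL t s) := by
  induction s with
  | zero => exact PathTo.nil _ (a01 (by omega))
  | succ s ih => exact PathTo.cons _ _ _ (a00 (by omega)).symm (ih (by omega))

theorem botL_path (s : ℕ) (h : s ≤ t) : PathTo (G't t) (U t 0 1) (U t s 2) (botL t s) := by
  induction s with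
  | zero => exact PathTo.nil _ (a12 (by omega)).symm
  | succ s ih =>
    exact PathTo.cons _ _ _ (a32 (by omega)).symm
      (PathTo.cons _ _ _ (a23 (by omega)).symm (ih (by omega)))

theorem topR_mem (s k : ℕ) (z : VT t) (hz : z ∈ topR t s k) :
    ∃ s', s < s' ∧ s' ≤ s + k ∧ z = U t s' 0 := by
  induction k generalizing s with
  | zero => simp [topR] at hz
  | succ k ih =>
    simp only [topR, List.mem_cons] at hz
    rcases hz with rfl | hz
    · exact ⟨s + 1, by omega, by omega, rfl⟩
    · obtain ⟨s', h1, h2, h3⟩ := ih _ hz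
      exact ⟨s', by omega, by omega, h3⟩

theorem botR_mem (s k : ℕ) (z : VT t) (hz : z ∈ botR t s k) :
    ∃ s', s < s' ∧ s' ≤ s + k ∧ (z = U t s' 2 ∨ z = U t s' 3) := by
  induction k generalizing s with
  | zero => simp [botR] at hz
  | succ k ih =>
    simp only [botR, List.mem_cons] at hz
    rcases hz with rfl | rfl | hz
    · exact ⟨s + 1, by omega, by omega, Or.inl rfl⟩
    · exact ⟨s + 1, by omega, by omega, Or.inr rfl⟩
    · obtain ⟨s', h1, h2, h3⟩ := ih _ hz
      exact ⟨s', by omega, by omega, h3⟩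

theorem topL_mem (s : ℕ) (z : VT t) (hz : z ∈ topL t s) : ∃ s', s' < s ∧ z = U t s' 0 := by
  induction s with
  | zero => simp [topL] at hz
  | succ s ih =>
    simp only [topL, List.mem_cons] at hz
    rcases hz with rfl | hz
    · exact ⟨s, by omega, rfl⟩
    · obtain ⟨s', h1, h3⟩ := ih hz
      exact ⟨s', by omega, h3⟩

theorem botL_mem (s : ℕ) (z : VT t) (hz : z ∈ botL t s) :
    ∃ s', s' < s ∧ (z = U t s' 2 ∨ z = U t s' 3) := by
  induction s with
  | zero => simp [botL] at hz
  | succ s ih =>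
    simp only [botL, List.mem_cons] at hz
    rcases hz with rfl | rfl | hz
    · exact ⟨s, by omega, Or.inr rfl⟩
    · exact ⟨s, by omega, Or.inl rfl⟩
    · obtain ⟨s', h1, h3⟩ := ih hz
      exact ⟨s', by omega, h3⟩

open PathTo in
/-- Two independent paths to `u` avoiding `u'`. -/
theorem fan2 (s : ℕ) (hs : s ≤ t) (j : Fin 4) : ∃ L1 L2 : List (VT t),
    PathTo (G't t) (Sum.inr false) (U t s j) L1 ∧ PathTo (G't t) (Sum.inr false) (U t s j) L2 ∧
    (∀ z ∈ L1, ∃ s' ≤ t, ∃ j', z = U t s' j' ∧ (s < s' ∧ j' = 0 ∨ s = s' ∧ j' < j)) ∧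
    (∀ z ∈ L2, ∃ s' ≤ t, ∃ j', z = U t s' j' ∧ (s < s' ∧ j' ≠ 0 ∨ s = s' ∧ j < j')) ∧
    (L1.headD (Sum.inr false) ≠ L2.headD (Sum.inr false)) := by
  have hk : s + (t - s) = t := by omega
  have ht := topR_path s _ hk
  have hb := botR_path s _ hk
  have mt := topR_mem (t := t) s (t - s)
  have mb := botR_mem (t := t) s (t - s)
  have mt' : ∀ z ∈ topR t s (t - s), ∀ j : Fin 4, ∃ s' ≤ t, ∃ j', z = U t s' j' ∧
      (s < s' ∧ j' = 0 ∨ s = s' ∧ j' < j) := by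
    intro z hz j
    obtain ⟨s', h1, h2, h3⟩ := mt z hz
    exact ⟨s', by omega, 0, h3, Or.inl ⟨h1, rfl⟩⟩
  have mb' : ∀ z ∈ botR t s (t - s), ∀ j : Fin 4, ∃ s' ≤ t, ∃ j', z = U t s' j' ∧
      (s < s' ∧ j' ≠ 0 ∨ s = s' ∧ j < j') := by
    intro z hz j
    obtain ⟨s', h1, h2, h3 | h3⟩ := mb z hz
    · exact ⟨s', by omega, 2, h3, Or.inl ⟨h1, by decide⟩⟩
    · exact ⟨s', by omega, 3, h3, Or.inl ⟨h1, by decide⟩⟩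
  have hdt : (topR t s (t - s)).headD (Sum.inr false) = U t (s + 1) 0 := by
    rcases h : t - s with _ | k
    · obtain rfl : s = t := by omega
      simp [topR, U_last]
    · simp [topR]
  have hdb : (botR t s (t - s)).headD (Sum.inr false) = U t (s + 1) 2 := by
    rcases h : t - s with _ | k
    · obtain rfl : s = t := by omega
      simp [botR, U_last]
    · simp [botR]
  obtain rfl | rfl | rfl | rfl : j = 0 ∨ j = 1 ∨ j = 2 ∨ j = 3 := by fin_cases j <;> simp
  · refine ⟨_, _, ht, cons _ _ _ (a01 hs) (cons _ _ _ (a12 hs) (cons _ _ _ (a23 hs) hb)),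
      fun z hz => mt' z hz _, ?_, ?_⟩
    · intro z hz
      simp only [List.mem_cons] at hz
      rcases hz with rfl | rfl | rfl | hz
      · exact ⟨s, hs, _, rfl, Or.inr ⟨rfl, by decide⟩⟩
      · exact ⟨s, hs, _, rfl, Or.inr ⟨rfl, by decide⟩⟩
      · exact ⟨s, hs, _, rfl, Or.inr ⟨rfl, by decide⟩⟩
      · exact mb' z hz _
    · rw [hdt]; simp [U_eq]; omega
  · refine ⟨_, _, cons _ _ _ (a01 hs).symm ht, (cons _ _ _ (a12 hs) (cons _ _ _ (a23 hs) hb)), ?_, ?_, ?_⟩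
    · intro z hz
      simp only [List.mem_cons] at hz
      rcases hz with rfl | hz
      · exact ⟨s, hs, _, rfl, Or.inr ⟨rfl, by decide⟩⟩
      · exact mt' z hz _
    · intro z hz
      simp only [List.mem_cons] at hz
      rcases hz with rfl | rfl | hz
      · exact ⟨s, hs, _, rfl, Or.inr ⟨rfl, by decide⟩⟩
      · exact ⟨s, hs, _, rfl, Or.inr ⟨rfl, by decide⟩⟩
      · exact mb' z hz _
    · simp [U_eq]; omega
  · refine ⟨_, _, cons _ _ _ (a12 hs).symm (cons _ _ _ (a01 hs).symm ht), (cons _ _ _ (a23 hs) hb), ?_, ?_, ?_⟩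
    · intro z hz
      simp only [List.mem_cons] at hz
      rcases hz with rfl | rfl | hz
      · exact ⟨s, hs, _, rfl, Or.inr ⟨rfl, by decide⟩⟩
      · exact ⟨s, hs, _, rfl, Or.inr ⟨rfl, by decide⟩⟩
      · exact mt' z hz _
    · intro z hz
      simp only [List.mem_cons] at hz
      rcases hz with rfl | hz
      · exact ⟨s, hs, _, rfl, Or.inr ⟨rfl, by decide⟩⟩
      · exact mb' z hz _
    · simp [U_eq]; omega
  · refine ⟨_, _, cons _ _ _ (a23 hs).symm (cons _ _ _ (a12 hs).symm (cons _ _ _ (a01 hs).symm ht)), hb, ?_, ?_, ?_⟩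
    · intro z hz
      simp only [List.mem_cons] at hz
      rcases hz with rfl | rfl | rfl | hz
      · exact ⟨s, hs, _, rfl, Or.inr ⟨rfl, by decide⟩⟩
      · exact ⟨s, hs, _, rfl, Or.inr ⟨rfl, by decide⟩⟩
      · exact ⟨s, hs, _, rfl, Or.inr ⟨rfl, by decide⟩⟩
      · exact mt' z hz _
    · exact fun z hz => mb' z hz _
    · rw [hdb]; simp [U_eq]; omega

open PathTo in
/-- A path to `u_0^2` avoiding `u` and `u'`. -/
theorem left_path (s : ℕ) (hs : s ≤ t) (j : Fin 4) (hne : U t s j ≠ U t 0 1) : ∃ L : List (VT t),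
    PathTo (G't t) (U t 0 1) (U t s j) L ∧ ∀ z ∈ L, ∃ s' ≤ t, ∃ j', z = U t s' j' := by
  have ht := topL_path s hs
  have hb := botL_path s hs
  have mt : ∀ z ∈ topL t s, ∃ s' ≤ t, ∃ j', z = U t s' j' := by
    intro z hz
    obtain ⟨s', h1, h2⟩ := topL_mem s z hz
    exact ⟨s', by omega, _, h2⟩
  have mb : ∀ z ∈ botL t s, ∃ s' ≤ t, ∃ j', z = U t s' j' := by
    intro z hz
    obtain ⟨s', h1, h2 | h2⟩ := botL_mem s z hz
    · exact ⟨s', by omega, _, h2⟩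
    · exact ⟨s', by omega, _, h2⟩
  obtain rfl | rfl | rfl | rfl : j = 0 ∨ j = 1 ∨ j = 2 ∨ j = 3 := by fin_cases j <;> simp
  · exact ⟨_, ht, mt⟩
  · refine ⟨_, cons _ _ _ (a01 hs).symm ht, ?_⟩
    intro z hz
    simp only [List.mem_cons] at hz
    rcases hz with rfl | hz
    exacts [⟨s, hs, _, rfl⟩, mt z hz]
  · exact ⟨_, hb, mb⟩
  · refine ⟨_, cons _ _ _ (a23 hs).symm hb, ?_⟩
    intro z hz
    simp only [List.mem_cons] at hz
    rcases hz with rfl | hz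
    exacts [⟨s, hs, _, rfl⟩, mb z hz]

theorem expand_conn (S' : Set (VT t)) (hS : Sum.inr true ∉ S')
    (X : Set (ExpandVerts (G't t) S')) (hX : X.ncard ≤ 2) :
    ((expand (G't t) S').induce Xᶜ).Connected := by
  by_cases h1 : ∀ x ∈ X, x.1.1 ≠ Sum.inr true
  · refine connected_of_paths h1 ⟨Sum.inr false, adj_ft.symm⟩ ?_
    intro p hp hpr
    obtain ⟨L1, L2, L3, k1, k2, k3, k4, k5, k6, k7, k8, k9, k10, k11, k12⟩ := fan3 _ hpr
    exact three_paths hX hp k1 k2 k3 k4 k5 k6 k7 k8 k9 k10 k11 k12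
  · push Not at h1
    obtain ⟨x0, hx0, e0⟩ := h1
    have hp0 : ∀ p ∉ X, p.1.1 ≠ Sum.inr true := by
      intro p hp e
      exact hp (blob_notMem (p := x0) (e0.trans e.symm) (by rwa [e0]) ▸ hx0)
    by_cases h2 : ∀ x ∈ X, x.1.1 ≠ Sum.inr false
    · refine connected_of_paths h2 ⟨Sum.inr true, adj_ft⟩ ?_
      intro p hp hpr
      rcases V_cases p.1.1 with e | e | ⟨s, hs, j, e⟩
      · exact absurd e (hp0 p hp)
      · rw [U_last] at e; exact absurd e hpr
      · obtain ⟨L1, L2, k1, k2, k3, k4, k5⟩ := fan2 s hs j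
        refine two_paths hX hp (L1 := L1) (L2 := L2) (by rwa [e]) (by rwa [e]) ?_ ?_ ?_ k5 hx0 ?_ ?_ ?_
        · intro z hz hz'
          obtain ⟨s1, h1, j1, rfl, h⟩ := k3 z hz
          obtain ⟨s2, h2, j2, h3, h'⟩ := k4 _ hz'
          rw [U_eq] at h3
          rcases h3 with ⟨-, rfl, rfl⟩ | h3
          · grind
          · omega
        · intro hz
          rw [e] at hz
          obtain ⟨s1, h1, j1, h, h'⟩ := k3 _ hz
          rw [U_eq] at h; grind
        · intro hz
          rw [e] at hz
          obtain ⟨s1, h1, j1, h, h'⟩ := k4 _ hz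
          rw [U_eq] at h; grind
        · intro hz
          rw [e0] at hz
          obtain ⟨s1, h1, j1, h, h'⟩ := k3 _ hz
          exact U_ne _ _ h.symm
        · intro hz
          rw [e0] at hz
          obtain ⟨s1, h1, j1, h, h'⟩ := k4 _ hz
          exact U_ne _ _ h.symm
        · rw [e0, e]; exact (U_ne _ _).symm
    · push Not at h2
      obtain ⟨x1, hx1, e1⟩ := h2
      have hall : ∀ x ∈ X, x = x0 ∨ x = x1 := by
        intro x hx
        by_contra hcon
        push Not at hcon
        refine card_three hX hx hx0 hx1 hcon.1 hcon.2 ?_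
        rintro rfl
        rw [e0] at e1; simp at e1
      have hroot : ∀ x ∈ X, x.1.1 ≠ U t 0 1 := by
        intro x hx
        rcases hall x hx with rfl | rfl
        · rw [e0]; exact (U_ne _ _).symm
        · rw [e1, ← U_last 0]; simp [U_eq]
      refine connected_of_paths hroot ⟨_, a12 (by omega)⟩ ?_
      intro p hp hpr
      rcases V_cases p.1.1 with e | e | ⟨s, hs, j, e⟩
      · exact absurd e (hp0 p hp)
      · have ht0 := a00 (t := t) le_rfl
        have hb0 := a32 (t := t) le_rfl
        rw [U_last] at ht0 hb0
        rw [U_last] at e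
        have k1 := PathTo.cons _ _ _ ht0.symm (topL_path t le_rfl)
        have k2 := PathTo.cons _ _ _ hb0.symm (PathTo.cons _ _ _ (a23 (t := t) le_rfl).symm (botL_path t le_rfl))
        rw [← e] at k1 k2
        have k3 : ∀ z ∈ U t t 0 :: topL t t, ∃ s' ≤ t, z = U t s' 0 := by
          intro z hz
          rw [List.mem_cons] at hz
          rcases hz with rfl | hz
          · exact ⟨t, le_rfl, rfl⟩
          · obtain ⟨s', h1, h2⟩ := topL_mem _ _ hz
            exact ⟨s', by omega, h2⟩
        have k4 : ∀ z ∈ U t t 3 :: U t t 2 :: botL t t, ∃ s' ≤ t, z = U t s' 2 ∨ z = U t s' 3 := by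
          intro z hz
          rw [List.mem_cons, List.mem_cons] at hz
          rcases hz with rfl | rfl | hz
          · exact ⟨t, le_rfl, Or.inr rfl⟩
          · exact ⟨t, le_rfl, Or.inl rfl⟩
          · obtain ⟨s', h1, h2⟩ := botL_mem _ _ hz
            exact ⟨s', by omega, h2⟩
        refine two_paths hX hp k1 k2 ?_ ?_ ?_ ?_ hx0 ?_ ?_ ?_
        · intro z hz hz'
          obtain ⟨s1, h1, rfl⟩ := k3 z hz
          obtain ⟨s2, h2, h3 | h3⟩ := k4 _ hz'
          · simp [U_eq] at h3; omega
          · simp [U_eq] at h3; omega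
        · intro hz
          rw [e, ← U_last 0] at hz
          obtain ⟨s1, h1, h⟩ := k3 _ hz
          simp [U_eq] at h; omega
        · intro hz
          rw [e, ← U_last 0] at hz
          obtain ⟨s1, h1, h | h⟩ := k4 _ hz
          · simp [U_eq] at h; omega
          · simp [U_eq] at h; omega
        · simp [U_eq]
        · intro hz
          rw [e0] at hz
          obtain ⟨s1, h1, h⟩ := k3 _ hz
          exact U_ne _ _ h.symm
        · intro hz
          rw [e0] at hz
          obtain ⟨s1, h1, h | h⟩ := k4 _ hz <;> exact U_ne _ _ h.symm
        · rw [e0, e]; simp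
      · rw [e] at hpr
        obtain ⟨L, k1, k2⟩ := left_path s hs j hpr
        rw [e]
        refine ⟨L, k1, ?_⟩
        rintro x hx (h | ⟨h, -⟩)
        · obtain ⟨s', h1, j', h2⟩ := k2 _ h
          rcases hall x hx with rfl | rfl
          · rw [e0] at h2; exact U_ne _ _ h2.symm
          · rw [e1, ← U_last 0, U_eq] at h2; omega
        · rcases hall x hx with rfl | rfl
          · rw [e0] at h; exact U_ne _ _ h.symm
          · rw [e1, ← U_last 0, U_eq] at h; omega

end Connectivity

section Transfer

/-- Edge indicators of a layer `s`: the edges to the next layer (top and bottom), the edges from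
`u_s^2` and `u_s^4` to `u'`, and the three edges of the path. -/
abbrev Lay := Bool × Bool × Bool × Bool × Bool × Bool × Bool

namespace Lay
def d (l : Lay) : Bool := l.1
def e (l : Lay) : Bool := l.2.1
def p (l : Lay) : Bool := l.2.2.1
def q (l : Lay) : Bool := l.2.2.2.1
def a (l : Lay) : Bool := l.2.2.2.2.1
def b (l : Lay) : Bool := l.2.2.2.2.2.1
def c (l : Lay) : Bool := l.2.2.2.2.2.2
end Lay

/-- The degree conditions inside a layer. -/
def okL (M : Fin 4 → ℕ → Bool) (d e : Bool) (l : Lay) : Bool :=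
  M 0 (d.toNat + l.a.toNat + l.d.toNat) && M 1 (l.a.toNat + l.b.toNat + l.p.toNat) &&
  M 2 (e.toNat + l.b.toNat + l.c.toNat) && M 3 (l.c.toNat + l.q.toNat + l.e.toNat)

/-- Top horizontal edges. -/
def dd {k : ℕ} (d : Bool) (F : Fin k → Lay) : Fin (k + 1) → Bool :=
  Fin.cons d (fun s => (F s).d)

/-- Bottom horizontal edges. -/
def ee {k : ℕ} (e : Bool) (F : Fin k → Lay) : Fin (k + 1) → Bool :=
  Fin.cons e (fun s => (F s).e)

/-- Validity of an assignment for `k` layers followed by `u`. -/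
def Valid {k : ℕ} (m : Fin k → Fin 4 → ℕ → Bool) (mu : ℕ → Bool) (d e : Bool) (c : ℕ)
    (x : (Fin k → Lay) × Bool) : Prop :=
  (∀ s : Fin k, okL (m s) (dd d x.1 s.castSucc) (ee e x.1 s.castSucc) (x.1 s) = true) ∧
  mu ((dd d x.1 (Fin.last k)).toNat + (ee e x.1 (Fin.last k)).toNat + x.2.toNat) = true ∧
  c + (∑ s : Fin k, ((x.1 s).p.toNat + (x.1 s).q.toNat)) + x.2.toNat = 1

theorem valid_cons {k : ℕ} (m : Fin (k + 1) → Fin 4 → ℕ → Bool) (mu : ℕ → Bool) (d e : Bool)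
    (c : ℕ) (l : Lay) (F : Fin k → Lay) (r : Bool) :
    Valid m mu d e c ((Fin.cons l F : Fin (k + 1) → Lay), r) ↔
      okL (m 0) d e l = true ∧
        Valid (Fin.tail m) mu l.d l.e (c + l.p.toNat + l.q.toNat) (F, r) := by
  unfold Valid
  have h1 : ∀ d, dd d (Fin.cons l F : Fin (k + 1) → Lay) = Fin.cons d (dd l.d F) := by
    intro d; unfold dd; congr 1; funext s; refine Fin.cases ?_ (fun s => ?_) s <;> simp
  have h2 : ∀ d, ee d (Fin.cons l F : Fin (k + 1) → Lay) = Fin.cons d (ee l.e F) := by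
    intro d; unfold ee; congr 1; funext s; refine Fin.cases ?_ (fun s => ?_) s <;> simp
  simp only [h1, h2, Fin.forall_fin_succ, Fin.sum_univ_succ, Fin.cons_zero, Fin.cons_succ,
    Fin.castSucc_zero, ← Fin.succ_castSucc, ← Fin.succ_last, Fin.tail, and_assoc, add_assoc]

theorem valid_zero (m : Fin 0 → Fin 4 → ℕ → Bool) (mu : ℕ → Bool) (d e : Bool)
    (c : ℕ) (F : Fin 0 → Lay) (r : Bool) :
    Valid m mu d e c (F, r) ↔ mu (d.toNat + e.toNat + r.toNat) = true ∧ c + r.toNat = 1 := by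
  simp [Valid, dd, ee]

instance {k : ℕ} (m : Fin k → Fin 4 → ℕ → Bool) (mu : ℕ → Bool) (d e : Bool) (c : ℕ)
    (x : (Fin k → Lay) × Bool) : Decidable (Valid m mu d e c x) := by
  unfold Valid; infer_instance

/-- Number of valid assignments. -/
def cnt {k : ℕ} (m : Fin k → Fin 4 → ℕ → Bool) (mu : ℕ → Bool) (d e : Bool) (c : ℕ) : ℕ :=
  ∑ x : (Fin k → Lay) × Bool, if Valid m mu d e c x then 1 else 0

theorem cnt_zero (m : Fin 0 → Fin 4 → ℕ → Bool) (mu : ℕ → Bool) (d e : Bool) (c : ℕ) :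
    cnt m mu d e c = ∑ r : Bool, if mu (d.toNat + e.toNat + r.toNat) = true ∧ c + r.toNat = 1
      then 1 else 0 := by
  unfold cnt
  rw [Fintype.sum_prod_type]
  simp [valid_zero]

theorem cnt_succ {k : ℕ} (m : Fin (k + 1) → Fin 4 → ℕ → Bool) (mu : ℕ → Bool) (d e : Bool)
    (c : ℕ) : cnt m mu d e c = ∑ l : Lay, if okL (m 0) d e l = true then
      cnt (Fin.tail m) mu l.d l.e (c + l.p.toNat + l.q.toNat) else 0 := by
  unfold cnt
  rw [Fintype.sum_prod_type, ← (Fin.consEquiv (fun _ => Lay)).sum_comp, Fintype.sum_prod_type]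
  refine Finset.sum_congr rfl fun l _ => ?_
  rw [Fintype.sum_prod_type]
  simp only [Fin.consEquiv, Equiv.coe_fn_mk, valid_cons]
  by_cases h : okL (m 0) d e l = true
  · simp [h]
  · simp [h]

/-- The allowed degrees when counting. -/
def msk (μ : Bool) (n : ℕ) : Bool := n == 1 || (μ && n == 3)

/-- The allowed degrees in a layer when counting. -/
def msk4 (x y z w : Bool) (j : Fin 4) : ℕ → Bool := msk (![x, y, z, w] j)

theorem cnt_big {k : ℕ} (m : Fin k → Fin 4 → ℕ → Bool) (mu : ℕ → Bool) (d e : Bool) (c : ℕ) :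
    cnt m mu d e (c + 2) = 0 := by
  unfold cnt
  refine Finset.sum_eq_zero fun x _ => if_neg ?_
  rintro ⟨-, -, h⟩
  omega

/-- The values of the transfer recursion. -/
def Vals {k : ℕ} (m : Fin k → Fin 4 → ℕ → Bool) (mu : ℕ → Bool) (z x : ℕ) : Prop :=
  cnt m mu false false 0 = z ∧ cnt m mu true false 1 = 1 ∧ cnt m mu false true 1 = 1 ∧
  cnt m mu true true 0 = x ∧ cnt m mu false false 1 = 0 ∧ cnt m mu true false 0 = 0 ∧
  cnt m mu false true 0 = 0 ∧ cnt m mu true true 1 = 0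

theorem vals_zero (m : Fin 0 → Fin 4 → ℕ → Bool) (b : Bool) : Vals m (msk b) 1 b.toNat := by
  simp only [Vals, cnt_zero, msk]
  revert b; decide

set_option maxHeartbeats 2000000 in
set_option linter.unusedSimpArgs false in
theorem vals_succ {k : ℕ} (m : Fin (k + 1) → Fin 4 → ℕ → Bool) (mu : ℕ → Bool) (y w : Bool)
    (h0 : m 0 = msk4 false y false w) (z x : ℕ) (h : Vals (Fin.tail m) mu z x) :
    Vals m mu (z + 2 + y.toNat + w.toNat + x) 1 := by
  have h2 : ∀ d e, cnt (Fin.tail m) mu d e 2 = 0 := fun d e => cnt_big _ _ _ _ 0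
  have h3 : ∀ d e, cnt (Fin.tail m) mu d e 3 = 0 := fun d e => cnt_big _ _ _ _ 1
  obtain ⟨e1, e2, e3, e4, e5, e6, e7, e8⟩ := h
  simp only [Vals, cnt_succ m, h0]
  cases y <;> cases w <;>
  simp [Fintype.sum_prod_type, okL, Lay.a, Lay.b, Lay.c, Lay.d, Lay.e, Lay.p, Lay.q, msk4, msk, h2, h3, e1, e2, e3,
    e4, e5, e6, e7, e8] <;> omega

set_option linter.unusedSimpArgs false in
theorem first_count {k : ℕ} (m : Fin (k + 1) → Fin 4 → ℕ → Bool) (mu : ℕ → Bool)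
    (h0 : m 0 = msk4 true true true true) (z x : ℕ) (h : Vals (Fin.tail m) mu z x) :
    cnt m mu false false 0 + cnt m mu true false 1 + cnt m mu false true 1 = z + x + 8 := by
  have h2 : ∀ d e, cnt (Fin.tail m) mu d e 2 = 0 := fun d e => cnt_big _ _ _ _ 0
  have h3 : ∀ d e, cnt (Fin.tail m) mu d e 3 = 0 := fun d e => cnt_big _ _ _ _ 1
  obtain ⟨e1, e2, e3, e4, e5, e6, e7, e8⟩ := h
  simp only [cnt_succ m, h0]
  simp [Fintype.sum_prod_type, okL, Lay.a, Lay.b, Lay.c, Lay.d, Lay.e, Lay.p, Lay.q, msk4, msk, h2, h3, e1, e2, e3,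
    e4, e5, e6, e7, e8]
  omega

/-- Count for `k` layers, all but the last one generic. -/
theorem vals_gen {k : ℕ} (m : Fin (k + 1) → Fin 4 → ℕ → Bool) (y w b : Bool)
    (hg : ∀ s : Fin k, m s.castSucc = msk4 false true false true)
    (hl : m (Fin.last k) = msk4 false y false w) :
    Vals m (msk b) (3 + y.toNat + w.toNat + b.toNat + 5 * k) 1 := by
  induction k with
  | zero =>
    have := vals_succ m (msk b) y w hl _ _ (vals_zero _ b)
    convert this using 1; omega
  | succ k ih =>
    have h1 := ih (Fin.tail m) (fun s => by simpa [Fin.tail] using hg s.succ) (by simpa [Fin.tail] using hl)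
    have := vals_succ m (msk b) true true (hg 0) _ _ h1
    convert this using 1; simp; omega

theorem total_count {k : ℕ} (m : Fin (k + 2) → Fin 4 → ℕ → Bool) (y w b : Bool)
    (h0 : m 0 = msk4 true true true true)
    (hg : ∀ s : Fin (k + 2), s ≠ 0 → s ≠ Fin.last (k + 1) → m s = msk4 false true false true)
    (hl : m (Fin.last (k + 1)) = msk4 false y false w) :
    cnt m (msk b) false false 0 + cnt m (msk b) true false 1 + cnt m (msk b) false true 1 =
      12 + y.toNat + w.toNat + b.toNat + 5 * k := by
  have := first_count m (msk b) h0 _ _ (vals_gen (Fin.tail m) y w b (fun s => by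
    refine hg s.castSucc.succ (Fin.succ_ne_zero _) ?_
    rw [← Fin.succ_last, ne_eq, Fin.succ_inj]
    exact Fin.castSucc_ne_last _) hl)
  omega

/-- Deletion masks. -/
def dmk (D : Fin 4 → Bool) (j : Fin 4) (n : ℕ) : Bool := if D j then n == 0 else n == 1

def umk (D : Bool) (n : ℕ) : Bool := if D then n == 0 else n == 1

def Good {k : ℕ} (D : Fin k → Fin 4 → Bool) (Du : Bool) (d e : Bool) (c : ℕ) : Prop :=
  ∃ x, Valid (fun s => dmk (D s)) (umk Du) d e c x

theorem good_succ {k : ℕ} (D : Fin (k + 1) → Fin 4 → Bool) (Du : Bool) (d e : Bool) (c : ℕ) (l : Lay)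
    (h : okL (dmk (D 0)) d e l = true)
    (h' : Good (Fin.tail D) Du l.d l.e (c + l.p.toNat + l.q.toNat)) : Good D Du d e c := by
  obtain ⟨⟨F, r⟩, hx⟩ := h'
  exact ⟨(Fin.cons l F, r), (valid_cons _ _ _ _ _ _ _ _).2 ⟨h, hx⟩⟩

theorem good_zero (D : Fin 0 → Fin 4 → Bool) (Du : Bool) (d e : Bool) (c : ℕ) (r : Bool)
    (h : umk Du (d.toNat + e.toNat + r.toNat) = true) (h' : c + r.toNat = 1) : Good D Du d e c :=
  ⟨(Fin.elim0, r), (valid_zero _ _ _ _ _ _ _).2 ⟨h, h'⟩⟩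

def nb (D : Fin 4 → Bool) : ℕ := (D 0).toNat + (D 1).toNat + (D 2).toNat + (D 3).toNat

/-- reachable in one layer -/
def reach (D : Fin 4 → Bool) (d e : Bool) (c : ℕ) (d' e' : Bool) (c' : ℕ) : Prop :=
  ∃ l : Lay, okL (dmk D) d e l = true ∧ l.d = d' ∧ l.e = e' ∧ c + l.p.toNat + l.q.toNat = c'

instance (D d e c d' e' c') : Decidable (reach D d e c d' e' c') := by unfold reach; infer_instance

theorem reach_good {k : ℕ} {D : Fin (k + 1) → Fin 4 → Bool} {Du : Bool} {d e : Bool} {c : ℕ} {d' e' c'}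
    (h : reach (D 0) d e c d' e' c') (h' : Good (Fin.tail D) Du d' e' c') : Good D Du d e c := by
  obtain ⟨l, h1, rfl, rfl, rfl⟩ := h
  exact good_succ D Du d e c l h1 h'

set_option maxRecDepth 100000 in
theorem r0 : reach (fun _ => false) false false 0 false false 0 ∧
    reach (fun _ => false) false false 0 true false 1 ∧
    reach (fun _ => false) true false 1 false true 1 ∧
    reach (fun _ => false) false true 1 false true 1 ∧
    reach (fun _ => false) false false 1 false false 1 := by decide +kernel

set_option maxRecDepth 100000 in
theorem r1 : ∀ j : Fin 4, (reach (fun i => i == j) false false 1 false true 1 ∨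
    reach (fun i => i == j) false false 1 true false 1) ∧
    (reach (fun i => i == j) false false 0 false false 1 ∨ reach (fun i => i == j) true false 1 false false 1 ∨
     reach (fun i => i == j) false true 1 false false 1) := by decide +kernel

set_option maxRecDepth 100000 in
theorem r2 : ∀ j j' : Fin 4, j < j' → ∃ x ∈ [(false, false, 0), (true, false, 1), (false, true, 1)],
    ∃ y ∈ [(false, false, 0), (true, false, 1), (false, true, 1)],
    reach (fun i => i == j || i == j') x.1 x.2.1 x.2.2 y.1 y.2.1 y.2.2 := by decide +kernel

theorem D_zero (D : Fin 4 → Bool) (h : nb D = 0) : D = fun _ => false := by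
  revert D; decide +kernel

theorem D_one (D : Fin 4 → Bool) (h : nb D = 1) : ∃ j, D = fun i => i == j := by
  revert D; decide +kernel

theorem D_two (D : Fin 4 → Bool) (h : nb D = 2) : ∃ j j', j < j' ∧ D = fun i => i == j || i == j' := by
  revert D; decide +kernel

theorem good0 {k : ℕ} (D : Fin k → Fin 4 → Bool) (Du : Bool) (h : Du.toNat + ∑ s, nb (D s) = 0) :
    Good D Du false false 0 ∧ Good D Du true false 1 ∧ Good D Du false true 1 := by
  induction k with
  | zero =>
    obtain rfl : Du = false := by cases Du <;> simp_all
    exact ⟨good_zero _ _ _ _ _ true rfl rfl, good_zero _ _ _ _ _ false rfl rfl,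
      good_zero _ _ _ _ _ false rfl rfl⟩
  | succ k ih =>
    rw [Fin.sum_univ_succ] at h
    obtain ⟨i1, i2, i3⟩ := ih (Fin.tail D) (by simp only [Fin.tail]; omega)
    have hD := D_zero (D 0) (by omega)
    obtain ⟨r1, r2, r3, r4, r5⟩ := r0
    rw [← hD] at r1 r2 r3 r4 r5
    exact ⟨reach_good r1 i1, reach_good r3 i3, reach_good r4 i3⟩

theorem good1 {k : ℕ} (D : Fin k → Fin 4 → Bool) (Du : Bool) (h : Du.toNat + ∑ s, nb (D s) = 1) :
    Good D Du false false 1 := by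
  induction k with
  | zero =>
    obtain rfl : Du = true := by cases Du <;> simp_all
    exact good_zero _ _ _ _ _ false rfl rfl
  | succ k ih =>
    rw [Fin.sum_univ_succ] at h
    by_cases h0 : nb (D 0) = 0
    · have i := ih (Fin.tail D) (by simp only [Fin.tail]; omega)
      have hD := D_zero (D 0) (by omega)
      have r := r0.2.2.2.2
      rw [← hD] at r
      exact reach_good r i
    · obtain ⟨i1, i2, i3⟩ := good0 (Fin.tail D) Du (by simp only [Fin.tail]; omega)
      obtain ⟨j, hD⟩ := D_one (D 0) (by omega)
      have r := (r1 j).1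
      rw [← hD] at r
      rcases r with r | r
      · exact reach_good r i3
      · exact reach_good r i2

theorem good2 {k : ℕ} (D : Fin k → Fin 4 → Bool) (Du : Bool) (h : Du.toNat + ∑ s, nb (D s) = 2) :
    Good D Du false false 0 ∨ Good D Du true false 1 ∨ Good D Du false true 1 := by
  induction k with
  | zero => cases Du <;> simp at h
  | succ k ih =>
    rw [Fin.sum_univ_succ] at h
    by_cases h0 : nb (D 0) = 0
    · have i := ih (Fin.tail D) (by simp only [Fin.tail]; omega)
      have hD := D_zero (D 0) (by omega)
      obtain ⟨r1, r2, r3, r4, r5⟩ := r0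
      rw [← hD] at r1 r2 r3 r4 r5
      rcases i with i | i | i
      · exact Or.inl (reach_good r1 i)
      · exact Or.inl (reach_good r2 i)
      · exact Or.inr (Or.inl (reach_good r3 i))
    by_cases h1 : nb (D 0) = 1
    · have i := good1 (Fin.tail D) Du (by simp only [Fin.tail]; omega)
      obtain ⟨j, hD⟩ := D_one (D 0) (by omega)
      have r := (r1 j).2
      rw [← hD] at r
      exact r.imp (reach_good · i) (Or.imp (reach_good · i) (reach_good · i))
    · obtain ⟨i1, i2, i3⟩ := good0 (Fin.tail D) Du (by simp only [Fin.tail]; omega)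
      obtain ⟨j, j', hj, hD⟩ := D_two (D 0) (by omega)
      have r := r2 j j' hj
      rw [← hD] at r
      simp only [List.mem_cons, List.not_mem_nil, or_false, exists_eq_or_imp, exists_eq_left] at r
      rcases r with (r | r | r) | (r | r | r) | (r | r | r)
      · exact Or.inl (reach_good r i1)
      · exact Or.inl (reach_good r i2)
      · exact Or.inl (reach_good r i3)
      · exact Or.inr (Or.inl (reach_good r i1))
      · exact Or.inr (Or.inl (reach_good r i2))
      · exact Or.inr (Or.inl (reach_good r i3))
      · exact Or.inr (Or.inr (reach_good r i1))
      · exact Or.inr (Or.inr (reach_good r i2))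
      · exact Or.inr (Or.inr (reach_good r i3))

end Transfer

section Encoding
variable {t : ℕ}

/-- Truth value of a proposition. -/
noncomputable def bb (P : Prop) : Bool := @decide P (Classical.dec P)

theorem bb_true {P : Prop} : bb P = true ↔ P := by simp [bb]

theorem bb_false {P : Prop} : bb P = false ↔ ¬ P := by simp [bb]

/-- The degree in a spanning subgraph. -/
noncomputable def hdeg {V : Type*} [Fintype V] (H : SimpleGraph V) (v : V) : ℕ :=
  ∑ w, (bb (H.Adj v w)).toNat

theorem hdeg_zero {V : Type*} [Fintype V] (H : SimpleGraph V) (v : V) :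
    hdeg H v = 0 ↔ ∀ w, ¬ H.Adj v w := by
  simp [hdeg, bb_false]

theorem hdeg_one {V : Type*} [Fintype V] (H : SimpleGraph V) (v : V) :
    hdeg H v = 1 ↔ ∃! w, H.Adj v w := by
  classical
  have : hdeg H v = (Finset.univ.filter (fun w => H.Adj v w)).card := by
    rw [Finset.card_filter, hdeg]
    refine Finset.sum_congr rfl fun w _ => ?_
    by_cases h : H.Adj v w
    · simp [h, bb]
    · simp [h, bb]
  rw [this, Finset.card_eq_one]
  constructor
  · rintro ⟨a, ha⟩
    have hh : ∀ w, H.Adj v w ↔ w = a := by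
      intro w
      have := Finset.ext_iff.1 ha w
      simpa using this
    exact ⟨a, (hh a).2 rfl, fun w hw => (hh w).1 hw⟩
  · rintro ⟨a, ha, hb⟩
    refine ⟨a, ?_⟩
    ext w
    simp only [Finset.mem_filter, Finset.mem_univ, true_and, Finset.mem_singleton]
    exact ⟨hb w, fun h => h ▸ ha⟩

theorem hdeg_sum {V : Type*} [Fintype V] {G H : SimpleGraph V} (hH : H ≤ G) {v a b c : V}
    (hab : a ≠ b) (hac : a ≠ c) (hbc : b ≠ c) (hn : ∀ w, G.Adj v w ↔ w = a ∨ w = b ∨ w = c) :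
    hdeg H v = (bb (H.Adj v a)).toNat + (bb (H.Adj v b)).toNat + (bb (H.Adj v c)).toNat := by
  classical
  rw [hdeg, ← Finset.sum_subset (Finset.subset_univ {a, b, c})]
  · rw [Finset.sum_insert (by simp [hab, hac]), Finset.sum_pair hbc, add_assoc]
  · intro w _ hw
    have : ¬ H.Adj v w := by
      intro h
      have := (hn w).1 (hH h)
      simp at hw
      tauto
    simp [bb_false.2 this]

theorem hdeg_three {V : Type*} [Fintype V] {G H : SimpleGraph V} (hH : H ≤ G) {v a b c : V}
    (hab : a ≠ b) (hac : a ≠ c) (hbc : b ≠ c) (hn : ∀ w, G.Adj v w ↔ w = a ∨ w = b ∨ w = c) :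
    hdeg H v = 3 ↔ ∀ w, G.Adj v w → H.Adj v w := by
  rw [hdeg_sum hH hab hac hbc hn]
  have h1 : (∀ w, G.Adj v w → H.Adj v w) ↔ bb (H.Adj v a) = true ∧ bb (H.Adj v b) = true ∧
      bb (H.Adj v c) = true := by
    simp only [bb_true, hn, forall_eq_or_imp, forall_eq]
  rw [h1]
  cases bb (H.Adj v a) <;> cases bb (H.Adj v b) <;> cases bb (H.Adj v c) <;> simp

/-- Edge indicators of a layer. -/
noncomputable def encL (H : SimpleGraph (VT t)) (s : Fin (t + 1)) : Lay :=
  (bb (H.Adj (Sum.inl (s, 0)) (nxt s 0)), bb (H.Adj (Sum.inl (s, 3)) (nxt s 2)),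
   bb (H.Adj (Sum.inl (s, 1)) (Sum.inr true)), bb (H.Adj (Sum.inl (s, 3)) (Sum.inr true)),
   bb (H.Adj (Sum.inl (s, 0)) (Sum.inl (s, 1))), bb (H.Adj (Sum.inl (s, 1)) (Sum.inl (s, 2))),
   bb (H.Adj (Sum.inl (s, 2)) (Sum.inl (s, 3))))

noncomputable def enc0 (H : SimpleGraph (VT t)) : Bool := bb (H.Adj (Sum.inl (0, 0)) (Sum.inr true))
noncomputable def enc2 (H : SimpleGraph (VT t)) : Bool := bb (H.Adj (Sum.inl (0, 2)) (Sum.inr true))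
noncomputable def encu (H : SimpleGraph (VT t)) : Bool := bb (H.Adj (Sum.inr false) (Sum.inr true))

theorem dd_prv (H : SimpleGraph (VT t)) (s : Fin (t + 1)) :
    dd (enc0 H) (encL H) s.castSucc = bb (H.Adj (Sum.inl (s, 0)) (prv s 0)) := by
  refine Fin.cases ?_ (fun s => ?_) s
  · simp [dd, enc0, prv]
  · rw [← Fin.succ_castSucc, dd, Fin.cons_succ]
    simp [Lay.d, encL, prv, nxt, H.adj_comm]

theorem ee_prv (H : SimpleGraph (VT t)) (s : Fin (t + 1)) :
    ee (enc2 H) (encL H) s.castSucc = bb (H.Adj (Sum.inl (s, 2)) (prv s 3)) := by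
  refine Fin.cases ?_ (fun s => ?_) s
  · simp [ee, enc2, prv]
  · rw [← Fin.succ_castSucc, ee, Fin.cons_succ]
    simp [Lay.e, encL, prv, nxt, H.adj_comm]

theorem hdeg0 {H : SimpleGraph (VT t)} (hH : H ≤ G't t) (s : Fin (t + 1)) :
    hdeg H (Sum.inl (s, 0)) = (dd (enc0 H) (encL H) s.castSucc).toNat + (encL H s).a.toNat +
      (encL H s).d.toNat := by
  rw [hdeg_sum hH (ds0 s).1 (ds0 s).2.1 (ds0 s).2.2 (nb0 s), dd_prv]; rfl

theorem hdeg1 {H : SimpleGraph (VT t)} (hH : H ≤ G't t) (s : Fin (t + 1)) :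
    hdeg H (Sum.inl (s, 1)) = (encL H s).a.toNat + (encL H s).b.toNat + (encL H s).p.toNat := by
  rw [hdeg_sum hH (by simp) (by simp) (by simp) (nb1 s), H.adj_comm _ (Sum.inl (s, 0))]; rfl

theorem hdeg2 {H : SimpleGraph (VT t)} (hH : H ≤ G't t) (s : Fin (t + 1)) :
    hdeg H (Sum.inl (s, 2)) = (ee (enc2 H) (encL H) s.castSucc).toNat + (encL H s).b.toNat +
      (encL H s).c.toNat := by
  rw [hdeg_sum hH (ds2 s).1 (ds2 s).2.1 (ds2 s).2.2 (nb2 s), ee_prv,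
    H.adj_comm _ (Sum.inl (s, 1))]; rfl

theorem hdeg3 {H : SimpleGraph (VT t)} (hH : H ≤ G't t) (s : Fin (t + 1)) :
    hdeg H (Sum.inl (s, 3)) = (encL H s).c.toNat + (encL H s).q.toNat + (encL H s).e.toNat := by
  rw [hdeg_sum hH (ds3 s).1 (ds3 s).2.1 (ds3 s).2.2 (nb3 s), H.adj_comm _ (Sum.inl (s, 2))]; rfl

theorem hdegf {H : SimpleGraph (VT t)} (hH : H ≤ G't t) :
    hdeg H (Sum.inr false) = (dd (enc0 H) (encL H) (Fin.last _)).toNat +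
      (ee (enc2 H) (encL H) (Fin.last _)).toNat + (encu H).toNat := by
  rw [hdeg_sum hH (by simp) (by simp) (by simp) nbf, ← Fin.succ_last, dd, ee, Fin.cons_succ, Fin.cons_succ]
  simp [Lay.d, Lay.e, encL, nxt, H.adj_comm, encu]

theorem hdegt {H : SimpleGraph (VT t)} (hH : H ≤ G't t) :
    hdeg H (Sum.inr true) = (enc0 H).toNat + (enc2 H).toNat +
      (∑ s, ((encL H s).p.toNat + (encL H s).q.toNat)) + (encu H).toNat := by
  have h0 : (∑ s : Fin (t + 1), (bb (H.Adj (Sum.inl (s, 0)) (Sum.inr true))).toNat) = (enc0 H).toNat := by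
    rw [Finset.sum_eq_single 0]
    · rfl
    · intro s _ hs
      rw [bb_false.2]; rfl
      intro h
      have := (adj_lt s 0).1 (hH h)
      simp at this
      exact hs this
    · simp
  have h2 : (∑ s : Fin (t + 1), (bb (H.Adj (Sum.inl (s, 2)) (Sum.inr true))).toNat) = (enc2 H).toNat := by
    rw [Finset.sum_eq_single 0]
    · rfl
    · intro s _ hs
      rw [bb_false.2]; rfl
      intro h
      have := (adj_lt s 2).1 (hH h)
      simp at this
      exact hs this
    · simp
  have ht : bb (H.Adj (Sum.inr true) (Sum.inr true)) = false := bb_false.2 (by simp)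
  simp only [hdeg, Fintype.sum_sum_type, Fintype.sum_prod_type, Fin.sum_univ_four, Finset.sum_add_distrib,
    Fintype.sum_bool, H.adj_comm (Sum.inr true) (Sum.inl _), h0, h2, ht,
    H.adj_comm (Sum.inr true) (Sum.inr false)]
  simp only [Lay.p, Lay.q, encL, encu, Bool.toNat_false]
  omega

theorem valid_enc {H : SimpleGraph (VT t)} (hH : H ≤ G't t) (δ : VT t → ℕ → Bool) (c : ℕ) :
    Valid (fun s j => δ (Sum.inl (s, j))) (δ (Sum.inr false)) (enc0 H) (enc2 H)
      (c + (enc0 H).toNat + (enc2 H).toNat) (encL H, encu H) ↔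
    (∀ v, v ≠ Sum.inr true → δ v (hdeg H v) = true) ∧ c + hdeg H (Sum.inr true) = 1 := by
  unfold Valid okL
  rw [hdegt hH]
  simp only [← hdegf hH, ← hdeg0 hH, ← hdeg1 hH, ← hdeg2 hH, ← hdeg3 hH, Bool.and_eq_true,
    ← and_assoc]
  constructor
  · rintro ⟨⟨h1, h2⟩, h3⟩
    refine ⟨?_, by omega⟩
    rintro (⟨s, j⟩ | _ | _) hv
    · have := h1 s
      fin_cases j
      exacts [this.1.1.1, this.1.1.2, this.1.2, this.2]
    · exact h2
    · exact absurd rfl hv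
  · rintro ⟨h1, h2⟩
    exact ⟨⟨fun s => ⟨⟨⟨h1 _ (by simp), h1 _ (by simp)⟩, h1 _ (by simp)⟩, h1 _ (by simp)⟩,
      h1 _ (by simp)⟩, by omega⟩

theorem enc_inj {H K : SimpleGraph (VT t)} (hH : H ≤ G't t)
    (h0 : enc0 H = enc0 K) (h2 : enc2 H = enc2 K) (hu : encu H = encu K) (hL : encL H = encL K) :
    H ≤ K := by
  have hbb : ∀ {P Q : Prop}, bb P = bb Q → P → Q := fun h hP => bb_true.1 (h ▸ bb_true.2 hP)
  have hl : ∀ s, encL H s = encL K s := fun s => congrFun hL s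
  simp only [encL, Prod.mk.injEq] at hl
  have hd : ∀ s, H.Adj (Sum.inl (s, 0)) (prv s 0) → K.Adj (Sum.inl (s, 0)) (prv s 0) := by
    intro s
    apply hbb
    rw [← dd_prv, ← dd_prv, h0, hL]
  have he : ∀ s, H.Adj (Sum.inl (s, 2)) (prv s 3) → K.Adj (Sum.inl (s, 2)) (prv s 3) := by
    intro s
    apply hbb
    rw [← ee_prv, ← ee_prv, h2, hL]
  have main : ∀ v w, v ≠ Sum.inr true → H.Adj v w → K.Adj v w := by
    rintro (⟨s, j⟩ | _ | _) w hv h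
    · obtain ⟨l1, l2, l3, l4, l5, l6, l7⟩ := hl s
      obtain rfl | rfl | rfl | rfl : j = 0 ∨ j = 1 ∨ j = 2 ∨ j = 3 := by fin_cases j <;> simp
      · rcases (nb0 s w).1 (hH h) with rfl | rfl | rfl
        exacts [hd s h, hbb l5 h, hbb l1 h]
      · rcases (nb1 s w).1 (hH h) with rfl | rfl | rfl
        exacts [(hbb l5 h.symm).symm, hbb l6 h, hbb l3 h]
      · rcases (nb2 s w).1 (hH h) with rfl | rfl | rfl
        exacts [he s h, (hbb l6 h.symm).symm, hbb l7 h]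
      · rcases (nb3 s w).1 (hH h) with rfl | rfl | rfl
        exacts [(hbb l7 h.symm).symm, hbb l4 h, hbb l2 h]
    · obtain ⟨l1, l2, l3, l4, l5, l6, l7⟩ := hl (Fin.last t)
      rw [show nxt (Fin.last t) 0 = Sum.inr false by simp [nxt]] at l1
      rw [show nxt (Fin.last t) 2 = Sum.inr false by simp [nxt]] at l2
      rcases (nbf w).1 (hH h) with rfl | rfl | rfl
      exacts [(hbb l1 h.symm).symm, (hbb l2 h.symm).symm, hbb hu h]
    · exact absurd rfl hv
  intro v w h
  by_cases hv : v = Sum.inr true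
  · have hw : w ≠ Sum.inr true := by rintro rfl; exact h.ne hv
    exact (main w v hw h.symm).symm
  · exact main v w hv h

/-- The oriented edges of the decoded graph. -/
def decR (d0 e0 r : Bool) (F : Fin (t + 1) → Lay) : VT t → VT t → Prop
  | Sum.inl (s, 0), w => (w = Sum.inl (s, 1) ∧ (F s).a = true) ∨ (w = nxt s 0 ∧ (F s).d = true) ∨
      ((s : ℕ) = 0 ∧ w = Sum.inr true ∧ d0 = true)
  | Sum.inl (s, 1), w => (w = Sum.inl (s, 2) ∧ (F s).b = true) ∨ (w = Sum.inr true ∧ (F s).p = true)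
  | Sum.inl (s, 2), w => (w = Sum.inl (s, 3) ∧ (F s).c = true) ∨
      ((s : ℕ) = 0 ∧ w = Sum.inr true ∧ e0 = true)
  | Sum.inl (s, 3), w => (w = nxt s 2 ∧ (F s).e = true) ∨ (w = Sum.inr true ∧ (F s).q = true)
  | Sum.inr false, w => w = Sum.inr true ∧ r = true
  | Sum.inr true, _ => False

theorem decR_sub (d0 e0 r : Bool) (F : Fin (t + 1) → Lay) (v w : VT t) (h : decR d0 e0 r F v w) :
    (G't t).Adj v w := by
  rcases v with ⟨s, j⟩ | _ | _
  · obtain rfl | rfl | rfl | rfl : j = 0 ∨ j = 1 ∨ j = 2 ∨ j = 3 := by fin_cases j <;> simp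
    · rw [nb0, eq_prv]
      simp only [decR] at h; tauto
    · rw [nb1]
      simp only [decR] at h; tauto
    · rw [nb2, eq_prv]
      simp only [decR] at h; tauto
    · rw [nb3]
      simp only [decR] at h; tauto
  · rw [nbf]
    simp only [decR] at h; tauto
  · exact h.elim

theorem dec_exists (d0 e0 r : Bool) (F : Fin (t + 1) → Lay) :
    ∃ H : SimpleGraph (VT t), H ≤ G't t ∧ enc0 H = d0 ∧ enc2 H = e0 ∧ encu H = r ∧ encL H = F := by
  have hbb : ∀ {P : Prop} {b : Bool}, (P ↔ b = true) → bb P = b := by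
    intro P b h
    rw [Bool.eq_iff_iff, bb_true, h]
  have hadj : ∀ v w, (SimpleGraph.fromRel (decR d0 e0 r F)).Adj v w ↔
      (decR d0 e0 r F v w ∨ decR d0 e0 r F w v) := by
    intro v w
    rw [fromRel_adj]
    constructor
    · exact fun h => h.2
    · intro h
      exact ⟨h.elim (fun h => (decR_sub _ _ _ _ _ _ h).ne) (fun h => (decR_sub _ _ _ _ _ _ h).ne'), h⟩
  have hsucc : ∀ (s : Fin (t + 1)) j, nxt s j ≠ Sum.inr true := by
    intro s j h
    have := (eq_nxt _ _ _).1 h.symm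
    simp at this
  refine ⟨SimpleGraph.fromRel (decR d0 e0 r F), ?_, ?_, ?_, ?_, ?_⟩
  · intro v w h
    rcases (hadj v w).1 h with h | h
    · exact decR_sub _ _ _ _ _ _ h
    · exact (decR_sub _ _ _ _ _ _ h).symm
  · apply hbb
    rw [hadj]
    simp [decR, (hsucc _ _).symm]
  · apply hbb
    rw [hadj]
    simp [decR]
  · apply hbb
    rw [hadj]
    simp [decR]
  · funext s
    have n0 := (eq_nxt _ s 0).1 rfl
    have n2 := (eq_nxt _ s 2).1 rfl
    refine Prod.ext (hbb ?_) (Prod.ext (hbb ?_) (Prod.ext (hbb ?_) (Prod.ext (hbb ?_) (Prod.ext (hbb ?_) (Prod.ext (hbb ?_) (hbb ?_))))))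
    · rw [hadj]
      rcases n0 with ⟨h1, h2⟩ | ⟨s', h1, h2⟩
      · simp [decR, h2, Lay.d]
      · have h3 : (Sum.inl (s, 0) : VT t) ≠ nxt s' 0 := by
          rw [ne_eq, eq_nxt]
          simp
          omega
        simp [decR, h2, Lay.d, h3]
    · rw [hadj]
      rcases n2 with ⟨h1, h2⟩ | ⟨s', h1, h2⟩
      · simp [decR, h2, Lay.e]
      · have h3 : s ≠ s' := by rintro rfl; omega
        simp [decR, h2, Lay.e, h3]
    · rw [hadj]; simp [decR, Lay.p]
    · rw [hadj]; simp [decR, Lay.q, (hsucc _ _).symm]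
    · rw [hadj]; simp [decR, Lay.a, eq_nxt]
    · rw [hadj]; simp [decR, Lay.b]
    · rw [hadj]; simp [decR, Lay.c, eq_nxt]
end Encoding

section Final
variable {t : ℕ}

theorem cfg_iff (S' : Set (VT t)) (hS : Sum.inr true ∉ S') (H : SimpleGraph (VT t)) :
    Cfg (G't t) S' H ↔ H ≤ G't t ∧ ((∀ v, v ≠ Sum.inr true → msk (bb (v ∈ S')) (hdeg H v) = true) ∧
      0 + hdeg H (Sum.inr true) = 1) := by
  unfold Cfg
  refine and_congr_right fun hH => ?_
  have hv : ∀ v, v ≠ Sum.inr true → (msk (bb (v ∈ S')) (hdeg H v) = true ↔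
      ((∃! w, H.Adj v w) ∨ (v ∈ S' ∧ ∀ w, (G't t).Adj v w → H.Adj v w))) := by
    intro v hv
    obtain ⟨a, b, c, h1, h2, h3, h4⟩ := cub_G't {v | v ≠ Sum.inr true} (by simp) v hv
    rw [← hdeg_one, ← hdeg_three hH h1 h2 h3 h4]
    simp [msk, bb_true]
  rw [zero_add, hdeg_one]
  constructor
  · intro h
    refine ⟨fun v h' => (hv v h').2 (h v), ?_⟩
    rcases h (Sum.inr true) with h | h
    · exact h
    · exact absurd h.1 hS
  · rintro ⟨h1, h2⟩ v
    by_cases h : v = Sum.inr true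
    · subst h; exact Or.inl h2
    · exact (hv v h).1 (h1 v h)

theorem cfg_count (S' : Set (VT t)) (hS : Sum.inr true ∉ S') :
    Set.ncard {H | Cfg (G't t) S' H} =
      cnt (fun s j => msk (bb (Sum.inl (s, j) ∈ S'))) (msk (bb (Sum.inr false ∈ S'))) false false 0 +
      cnt (fun s j => msk (bb (Sum.inl (s, j) ∈ S'))) (msk (bb (Sum.inr false ∈ S'))) true false 1 +
      cnt (fun s j => msk (bb (Sum.inl (s, j) ∈ S'))) (msk (bb (Sum.inr false ∈ S'))) false true 1 := by
  set m : Fin (t + 1) → Fin 4 → ℕ → Bool := fun s j => msk (bb (Sum.inl (s, j) ∈ S')) with hm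
  set mu := msk (bb (Sum.inr false ∈ S')) with hmu
  let enc : SimpleGraph (VT t) → (Bool × Bool) × ((Fin (t + 1) → Lay) × Bool) :=
    fun H => ((enc0 H, enc2 H), (encL H, encu H))
  have hinj : Set.InjOn enc {H | Cfg (G't t) S' H} := by
    intro H hH K hK h
    simp only [enc, Prod.mk.injEq] at h
    obtain ⟨⟨h1, h2⟩, h3, h4⟩ := h
    exact le_antisymm (enc_inj hH.1 h1 h2 h4 h3) (enc_inj hK.1 h1.symm h2.symm h4.symm h3.symm)
  have himg : enc '' {H | Cfg (G't t) S' H} =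
      ↑(Finset.univ.filter (fun x : (Bool × Bool) × ((Fin (t + 1) → Lay) × Bool) =>
        Valid m mu x.1.1 x.1.2 (0 + x.1.1.toNat + x.1.2.toNat) x.2)) := by
    ext ⟨⟨d0, e0⟩, F, r⟩
    simp only [Set.mem_image, Set.mem_ofPred_eq, Finset.coe_filter, Finset.mem_univ, true_and]
    constructor
    · rintro ⟨H, hH, h⟩
      simp only [enc, Prod.mk.injEq] at h
      obtain ⟨⟨rfl, rfl⟩, rfl, rfl⟩ := h
      rw [cfg_iff S' hS] at hH
      exact (valid_enc hH.1 (fun v => msk (bb (v ∈ S'))) 0).2 hH.2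
    · intro h
      obtain ⟨H, hH, rfl, rfl, rfl, rfl⟩ := dec_exists d0 e0 r F
      refine ⟨H, ?_, rfl⟩
      rw [cfg_iff S' hS]
      exact ⟨hH, (valid_enc hH (fun v => msk (bb (v ∈ S'))) 0).1 h⟩
  rw [← hinj.ncard_image, himg, Set.ncard_coe_finset, Finset.card_filter,
    Fintype.sum_prod_type, Fintype.sum_prod_type]
  simp only [Fintype.sum_bool, Bool.toNat_true, Bool.toNat_false]
  have := cnt_big m mu true true 0
  simp only [cnt] at this ⊢
  simp only [zero_add, add_zero] at this ⊢
  rw [show (1 + 1 : ℕ) = 2 from rfl, this]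
  omega

theorem bicrit (v w : VT t) (hvw : v ≠ w) : ∃ H, DelPM (G't t) v w H := by
  classical
  let δ : VT t → ℕ → Bool := fun z => umk (decide (z = v ∨ z = w))
  let D : Fin (t + 1) → Fin 4 → Bool := fun s j => decide (Sum.inl (s, j) = v ∨ Sum.inl (s, j) = w)
  let Du : Bool := decide ((Sum.inr false : VT t) = v ∨ Sum.inr false = w)
  let Dt : Bool := decide ((Sum.inr true : VT t) = v ∨ Sum.inr true = w)
  have hsum : Du.toNat + (∑ s, nb (D s)) + Dt.toNat = 2 := by
    have h1 : (∑ z : VT t, (decide (z = v ∨ z = w)).toNat) = 2 := by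
      have : ∀ z : VT t, (decide (z = v ∨ z = w)).toNat = if z ∈ ({v, w} : Finset (VT t)) then 1 else 0 := by
        intro z
        by_cases h : z = v ∨ z = w <;> simp [h]
      simp only [this, Finset.sum_ite_mem, Finset.univ_inter]
      simp [Finset.card_pair hvw]
    rw [Fintype.sum_sum_type, Fintype.sum_prod_type] at h1
    simp only [Fin.sum_univ_four, Fintype.sum_bool] at h1
    simp only [nb, D, Du, Dt]
    omega
  have fin : ∀ (c : ℕ) (d0 e0 : Bool), c = Dt.toNat → Good D Du d0 e0 (c + d0.toNat + e0.toNat) →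
      ∃ H, DelPM (G't t) v w H := by
    rintro c d0 e0 hc ⟨⟨F, r⟩, hx⟩
    obtain ⟨H, hH, rfl, rfl, rfl, rfl⟩ := dec_exists d0 e0 r F
    obtain ⟨h1, h2⟩ := (valid_enc hH δ c).1 hx
    have hdel : ∀ z, (z = v ∨ z = w) → hdeg H z = 0 := by
      intro z hz
      by_cases hzt : z = Sum.inr true
      · subst hzt
        have : Dt = true := decide_eq_true hz
        rw [hc, this] at h2
        simpa using h2
      · have := h1 z hzt
        simpa [δ, umk, hz] using this
    refine ⟨H, hH, (hdeg_zero _ _).1 (hdel v (Or.inl rfl)), (hdeg_zero _ _).1 (hdel w (Or.inr rfl)), ?_⟩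
    intro z hzv hzw
    rw [← hdeg_one]
    by_cases hzt : z = Sum.inr true
    · subst hzt
      have : Dt = false := decide_eq_false (by tauto)
      rw [hc, this] at h2
      simpa using h2
    · have := h1 z hzt
      simpa [δ, umk, hzv, hzw] using this
  rcases hDt : Dt with _ | _
  · rw [hDt] at hsum
    rcases good2 D Du (by simpa using hsum) with h | h | h
    · exact fin 0 _ _ (by simp [hDt]) h
    · exact fin 0 _ _ (by simp [hDt]) h
    · exact fin 0 _ _ (by simp [hDt]) h
  · rw [hDt] at hsum
    exact fin 1 _ _ (by simp [hDt]) (good1 D Du (by simpa using hsum))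

theorem card_expand (S' : Set (VT t)) (hS : Sum.inr true ∉ S') :
    Fintype.card (ExpandVerts (G't t) S') = ∑ v : VT t, (1 + 2 * (bb (v ∈ S')).toNat) := by
  classical
  rw [Fintype.card_subtype, Finset.card_filter, Fintype.sum_prod_type]
  refine Finset.sum_congr rfl fun v _ => ?_
  rw [Fintype.sum_option]
  by_cases hv : v ∈ S'
  · obtain ⟨a, b, c, h1, h2, h3, h4⟩ := cub_G't S' hS v hv
    simp only [hv]
    simp only [not_true_eq_false, false_and, true_and, reduceCtorEq, and_false, Option.some.injEq,
      exists_const, if_false, false_or, exists_eq_left', h4]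
    rw [← Finset.card_filter]
    have : (Finset.univ.filter (fun w => w = a ∨ w = b ∨ w = c)) = {a, b, c} := by
      ext w; simp
    rw [this, Finset.card_insert_of_notMem (by simp [h1, h2]), Finset.card_pair h3]
    simp [bb]
  · simp [hv, bb]

theorem mem_Sset_l (s : Fin (t + 1)) (j : Fin 4) : (Sum.inl (s, j) : VT t) ∈ Sset t ↔
    (s = 0 ∧ (j = 0 ∨ j = 2)) ∨ j = 1 ∨ j = 3 := by
  fin_cases j <;> simp [Sset]

theorem mem_Ssub (h : ℕ) (h0 : 0 < h) (h4 : h ≤ 4) : Sum.inr true ∉ Ssub t h ∧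
    (Sum.inr false ∈ Ssub t h ↔ 4 ≤ h) ∧ ∀ (s : Fin (t + 1)) (j : Fin 4), (Sum.inl (s, j) ∈ Ssub t h ↔
      ((s = 0 ∧ (j = 0 ∨ j = 2)) ∨ j = 1 ∨ j = 3) ∧
      ¬ (s = Fin.last t ∧ (j = 1 ∧ h < 2 ∨ j = 3 ∧ h < 3))) := by
  have ht : (Sum.inr true : VT t) ∉ Sset t := by simp [Sset]
  have hf : (Sum.inr false : VT t) ∈ Sset t := by simp [Sset]
  interval_cases h
  · refine ⟨fun h => ht h.1, by simp [Ssub], fun s j => ?_⟩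
    simp only [Ssub, Set.mem_sdiff, mem_Sset_l, Set.mem_insert_iff, Set.mem_singleton_iff]
    grind
  · refine ⟨fun h => ht h.1, by simp [Ssub], fun s j => ?_⟩
    simp only [Ssub, Set.mem_sdiff, mem_Sset_l, Set.mem_insert_iff, Set.mem_singleton_iff]
    grind
  · refine ⟨fun h => ht h.1, by simp [Ssub], fun s j => ?_⟩
    simp only [Ssub, Set.mem_sdiff, mem_Sset_l, Set.mem_singleton_iff]
    grind
  · refine ⟨ht, by simpa [Ssub] using hf, fun s j => ?_⟩
    simp only [Ssub, mem_Sset_l]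
    grind

theorem bb_decide {P Q : Prop} [Decidable Q] (h : P ↔ Q) : bb P = decide Q := by
  rw [Bool.eq_iff_iff, bb_true, h, decide_eq_true_iff]

/-- The indicator of `S'` in the layers. -/
theorem layers (k h : ℕ) (h0 : 0 < h) (h4 : h ≤ 4) :
    ((fun j => bb (Sum.inl ((0 : Fin (k + 2)), j) ∈ Ssub (k + 1) h)) = ![true, true, true, true]) ∧
    (∀ s : Fin (k + 2), s ≠ 0 → s ≠ Fin.last (k + 1) →
      (fun j => bb (Sum.inl (s, j) ∈ Ssub (k + 1) h)) = ![false, true, false, true]) ∧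
    ((fun j => bb (Sum.inl (Fin.last (k + 1), j) ∈ Ssub (k + 1) h)) =
      ![false, decide (2 ≤ h), false, decide (3 ≤ h)]) := by
  obtain ⟨-, -, hm⟩ := mem_Ssub (t := k + 1) h h0 h4
  have hne : (0 : Fin (k + 2)) ≠ Fin.last (k + 1) := by
    intro h; have := congrArg Fin.val h; simp at this
  refine ⟨?_, ?_, ?_⟩
  · funext j
    rw [bb_decide (hm 0 j)]
    fin_cases j <;> simp [hne]
  · intro s hs hs'
    funext j
    rw [bb_decide (hm s j)]
    fin_cases j <;> simp [hs, hs']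
  · funext j
    rw [bb_decide (hm _ j)]
    fin_cases j <;> simp [hne.symm, Nat.succ_le_iff]
end Final

/-- For every even integer `n ≥ 18`, writing `n = i + 8(t+1)` with
`t ≥ 1` and `0 < i ≤ 8`, the graph `G''_n = G'_t⟨S_{i/2}⟩` is a brick on `n`
vertices whose number of perfect matchings is exactly `(5n + 8 − i)/8 = ⌈5n/8⌉`. -/
theorem stmt10 (n t i : ℕ) (hne : Even n) (hn : 18 ≤ n) (ht : 1 ≤ t)
    (hi0 : 0 < i) (hi8 : i ≤ 8) (heq : n = i + 8 * (t + 1)) :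
    IsBrick (expand (G't t) (Ssub t (i / 2))) ∧
      Fintype.card (ExpandVerts (G't t) (Ssub t (i / 2))) = n ∧
      numPM (expand (G't t) (Ssub t (i / 2))) = (5 * n + 8 - i) / 8 ∧
      (5 * n + 8 - i) / 8 = (5 * n + 7) / 8 := by
  obtain ⟨k, rfl⟩ : ∃ k, t = k + 1 := ⟨t - 1, by omega⟩
  have hie : i % 2 = 0 := by
    rw [Nat.even_iff] at hne; omega
  obtain ⟨h, hh⟩ : ∃ h, h = i / 2 := ⟨_, rfl⟩
  rw [← hh]
  have h0 : 0 < h := by omega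
  have h4 : h ≤ 4 := by omega
  obtain ⟨hS, hf, -⟩ := mem_Ssub (t := k + 1) h h0 h4
  obtain ⟨l1, l2, l3⟩ := layers k h h0 h4
  have hb : (decide (2 ≤ h)).toNat + (decide (3 ≤ h)).toNat + (decide (4 ≤ h)).toNat = h - 1 := by
    interval_cases h <;> rfl
  have hcard : Fintype.card (ExpandVerts (G't (k + 1)) (Ssub (k + 1) h)) = n := by
    rw [card_expand _ hS, Fintype.sum_sum_type, Fintype.sum_prod_type, Fin.sum_univ_succ,
      Fin.sum_univ_castSucc (n := k)]
    have e1 : ∀ j, bb (Sum.inl ((0 : Fin (k + 2)), j) ∈ Ssub (k + 1) h) = _ := congrFun l1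
    have e2 : ∀ (s : Fin k) (j : Fin 4),
        bb (Sum.inl (s.castSucc.succ, j) ∈ Ssub (k + 1) h) = _ := fun s => congrFun
      (l2 s.castSucc.succ (Fin.succ_ne_zero _) (by
        rw [← Fin.succ_last, ne_eq, Fin.succ_inj]; exact Fin.castSucc_ne_last _))
    have e3 : ∀ j, bb (Sum.inl (Fin.last (k + 1), j) ∈ Ssub (k + 1) h) = _ := congrFun l3
    rw [← Fin.succ_last] at e3
    simp only [e1, e2, e3, Fin.sum_univ_four, Fintype.sum_bool, bb_decide hf, bb_false.2 hS]
    simp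
    omega
  refine ⟨⟨⟨by omega, fun X hX => expand_conn _ hS X hX⟩, ?_⟩, hcard, ?_, by omega⟩
  · exact bicritical_expand (cub_G't _ hS) bicrit
  · rw [numPM_expand (cub_G't _ hS), cfg_count _ hS, bb_decide hf,
      total_count _ (decide (2 ≤ h)) (decide (3 ≤ h)) (decide (4 ≤ h))]
    · omega
    · funext j; exact congrArg msk (congrFun l1 j)
    · intro s hs hs'
      funext j; exact congrArg msk (congrFun (l2 s hs hs') j)
    · funext j; exact congrArg msk (congrFun l3 j)
end

section
/- For every even integer n > 17 there exists a brick on n vertices that has exactly ⌈5n/8⌉ perfect matchings. -/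
open SimpleGraph

set_option linter.unusedSectionVars false

namespace Ins

/-- `f` encodes a perfect matching of the subgraph induced by `S`. -/
def IsPM {V : Type} (G : SimpleGraph V) (S : Finset V) (f : V → V) : Prop :=
  ∀ v, f (f v) = v ∧ (v ∈ S → G.Adj v (f v)) ∧ (v ∉ S → f v = v)

open scoped Classical in
noncomputable def cnt {V : Type} [Fintype V] [DecidableEq V] (G : SimpleGraph V) (S : Finset V) : ℕ :=
  (Finset.univ.filter (fun f : V → V => IsPM G S f)).card

section basic
variable {V W : Type} [Fintype V] [DecidableEq V] [Fintype W] [DecidableEq W]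

lemma IsPM.mem {G : SimpleGraph V} {S : Finset V} {f : V → V} (h : IsPM G S f) {v : V}
    (hv : v ∈ S) : f v ∈ S := by
  by_contra hc
  have h1 := (h (f v)).2.2 hc
  rw [(h v).1] at h1
  have := (h v).2.1 hv
  rw [← h1] at this
  exact G.loopless.irrefl _ this

lemma cnt_pos {G : SimpleGraph V} {S : Finset V} : 0 < cnt G S ↔ ∃ f, IsPM G S f := by
  classical
  unfold cnt
  rw [Finset.card_pos]
  constructor
  · rintro ⟨f, hf⟩
    exact ⟨f, by simpa using hf⟩
  · rintro ⟨f, hf⟩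
    exact ⟨f, by simpa using hf⟩

lemma cnt_empty (G : SimpleGraph V) : cnt G ∅ = 1 := by
  classical
  unfold cnt
  rw [Finset.card_eq_one]
  refine ⟨id, ?_⟩
  ext f
  simp only [Finset.mem_filter, Finset.mem_univ, true_and, Finset.mem_singleton]
  constructor
  · intro h
    funext v
    exact (h v).2.2 (by simp)
  · rintro rfl v
    simp

lemma fiber (G : SimpleGraph V) (S : Finset V) (v w : V) (hv : v ∈ S) (hw : w ∈ S)
    (ha : G.Adj v w) [DecidablePred (IsPM G S)] [DecidablePred (IsPM G (S \ {v, w}))] :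
    ((Finset.univ.filter (IsPM G S)).filter (fun f => f v = w)).card =
      (Finset.univ.filter (IsPM G (S \ {v, w}))).card := by
  have hne : v ≠ w := ha.ne
  refine Finset.card_nbij' (fun f u => if u = v ∨ u = w then u else f u)
    (fun g u => if u = v then w else if u = w then v else g u) ?_ ?_ ?_ ?_
  · intro f hf
    simp only [Finset.coe_filter, Finset.mem_filter, Finset.mem_univ, true_and, Set.mem_ofPred_eq] at hf ⊢
    obtain ⟨h, h1⟩ := hf
    intro u
    have := h u
    have := h v
    have := h w
    have := h (f u)
    refine ⟨?_, ?_, ?_⟩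
    · grind
    · simp only [Finset.mem_sdiff, Finset.mem_insert, Finset.mem_singleton]
      rintro ⟨h3, h4⟩
      rw [if_neg h4]
      exact (h u).2.1 h3
    · simp only [Finset.mem_sdiff, Finset.mem_insert, Finset.mem_singleton]
      grind
  · intro f h
    simp only [Finset.coe_filter, Finset.mem_filter, Finset.mem_univ, true_and, Set.mem_ofPred_eq] at h ⊢
    refine ⟨?_, by simp⟩
    have e1 : f v = v := (h v).2.2 (by simp)
    have e2 : f w = w := (h w).2.2 (by simp)
    intro u
    have := h u
    have := h (f u)
    have hs := ha.symm
    simp only [Finset.mem_sdiff, Finset.mem_insert, Finset.mem_singleton] at *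
    grind
  · intro f hf
    simp only [Finset.coe_filter, Finset.mem_filter, Finset.mem_univ, true_and, Set.mem_ofPred_eq] at hf
    obtain ⟨h, h1⟩ := hf
    funext u
    have := h v
    grind
  · intro f h
    simp only [Finset.coe_filter, Finset.mem_univ, true_and, Set.mem_ofPred_eq] at h
    have e1 : f v = v := (h v).2.2 (by simp)
    have e2 : f w = w := (h w).2.2 (by simp)
    funext u
    grind

open scoped Classical in
lemma cnt_rec (G : SimpleGraph V) (S : Finset V) (v : V) (hv : v ∈ S) :
    cnt G S = ∑ w : V, if w ∈ S ∧ G.Adj v w then cnt G (S \ {v, w}) else 0 := by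
  conv_lhs => unfold cnt
  rw [Finset.card_eq_sum_card_fiberwise (f := fun f : V → V => f v) (t := Finset.univ) (by simp)]
  refine Finset.sum_congr rfl fun w _ => ?_
  split_ifs with h
  · exact fiber G S v w hv h.1 h.2
  · rw [Finset.card_eq_zero, Finset.filter_eq_empty_iff]
    intro f hf hw
    simp only [Finset.mem_filter, Finset.mem_univ, true_and] at hf
    subst hw
    exact h ⟨hf.mem hv, (hf v).2.1 hv⟩

lemma cnt_map (G : SimpleGraph V) (H : SimpleGraph W) (e : V ↪ W) : ∀ (S : Finset V),
    (∀ a ∈ S, ∀ b ∈ S, G.Adj a b ↔ H.Adj (e a) (e b)) → cnt H (S.map e) = cnt G S := by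
  intro S
  induction S using Finset.strongInduction with
  | H S ih =>
    intro h
    classical
    rcases S.eq_empty_or_nonempty with rfl | ⟨v, hv⟩
    · simp [cnt_empty]
    · rw [cnt_rec G S v hv, cnt_rec H (S.map e) (e v) (by simpa using hv)]
      rw [← Finset.sum_subset (Finset.subset_univ (S.map e)) (fun x _ hx => if_neg (fun hc => hx hc.1)),
        ← Finset.sum_subset (Finset.subset_univ S) (fun x _ hx => if_neg (fun hc => hx hc.1)),
        Finset.sum_map]
      refine Finset.sum_congr rfl fun w hw => ?_
      have : S.map e \ {e v, e w} = (S \ {v, w}).map e := by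
        ext x
        simp only [Finset.mem_sdiff, Finset.mem_map, Finset.mem_insert, Finset.mem_singleton]
        constructor
        · rintro ⟨⟨a, ha, rfl⟩, h2⟩
          exact ⟨a, ⟨ha, by simpa using h2⟩, rfl⟩
        · rintro ⟨a, ⟨ha, h2⟩, rfl⟩
          exact ⟨⟨a, ha, rfl⟩, by simpa using h2⟩
      rw [this, ih (S \ {v, w})]
      · simp [hw, h v hv w hw]
      · refine Finset.ssubset_iff_subset_ne.2 ⟨Finset.sdiff_subset, fun hc => ?_⟩
        rw [← hc] at hv
        simp at hv
      · intro a ha b hb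
        simp only [Finset.mem_sdiff] at ha hb
        exact h a ha.1 b hb.1

/-- reachability avoiding two vertices -/
def Av {V : Type} (G : SimpleGraph V) (x y : V) : V → V → Prop :=
  Relation.ReflTransGen (fun a b => G.Adj a b ∧ b ≠ x ∧ b ≠ y)

def Conn3 {V : Type} (G : SimpleGraph V) : Prop :=
  ∀ x y u v, u ≠ x → u ≠ y → v ≠ x → v ≠ y → Av G x y u v

lemma Av.symm {G : SimpleGraph V} {x y u v : V} (h : Av G x y u v) (hx : u ≠ x) (hy : u ≠ y) :
    Av G x y v u := by
  have key : Av G x y v u ∧ v ≠ x ∧ v ≠ y := by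
    induction h with
    | refl => exact ⟨Relation.ReflTransGen.refl, hx, hy⟩
    | tail _ hbc ih => exact ⟨Relation.ReflTransGen.head ⟨hbc.1.symm, ih.2⟩ ih.1, hbc.2⟩
  exact key.1

end basic

/-- A block to be inserted. -/
structure Block (m : ℕ) where
  adj : Fin m → Fin m → Bool
  att : Fin m → Option (Fin 3)
  first : Fin m
  symm : ∀ a b, adj a b = true → adj b a = true
  irrefl : ∀ a, adj a a = false

def comp {m : ℕ} (B : Block m) : ℕ → List (Fin m) → List (Fin 3) → List (List (Fin 3))
  | 0, _, A => [A]
  | _ + 1, [], A => [A]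
  | k + 1, b :: L, A =>
      (L.filter (B.adj b)).flatMap (fun c => comp B k (L.erase c) A) ++
        (match B.att b with
          | none => []
          | some i => if i ∈ A then comp B k L (A.erase i) else [])

def grow {m : ℕ} (B : Block m) (D : List (Fin m)) (E : List (Fin 3)) : ℕ → List (Fin m)
  | 0 => []
  | k + 1 =>
      let L := grow B D E k
      (List.finRange m).filter fun b => !(D.contains b) &&
        ((match B.att b with
          | none => false
          | some i => !(E.contains i)) || L.any (fun c => B.adj b c))

lemma sum_flat {α : Type} (L : List α) (g : α → List ℕ) :
    (L.flatMap g).sum = (L.map (fun a => (g a).sum)).sum := by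
  induction L with
  | nil => simp
  | cons a L ih => simp [ih]

def ins {V : Type} {m : ℕ} (G : SimpleGraph V) (t : Fin 3 → V) (B : Block m) :
    SimpleGraph (V ⊕ Fin m) where
  Adj x y := match x, y with
    | .inl a, .inl b => G.Adj a b ∧ ¬ (a = t 0 ∧ b = t 1) ∧ ¬ (a = t 1 ∧ b = t 0)
    | .inl a, .inr b => ∃ i, B.att b = some i ∧ a = t i
    | .inr b, .inl a => ∃ i, B.att b = some i ∧ a = t i
    | .inr a, .inr b => B.adj a b = true
  symm := ⟨by
    rintro (a | a) (b | b) h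
    · exact ⟨h.1.symm, fun hc => h.2.2 ⟨hc.2, hc.1⟩, fun hc => h.2.1 ⟨hc.2, hc.1⟩⟩
    · exact h
    · exact h
    · exact B.symm _ _ h⟩
  loopless := ⟨by
    rintro (a | a) h
    · exact G.loopless.irrefl _ h.1
    · have := B.irrefl a
      simp_all⟩

section insertion
variable {V : Type} [Fintype V] [DecidableEq V] {m : ℕ} (G : SimpleGraph V) (t : Fin 3 → V)
  (B : Block m)

lemma ins_ll (a b : V) : (ins G t B).Adj (.inl a) (.inl b) ↔
    G.Adj a b ∧ ¬ (a = t 0 ∧ b = t 1) ∧ ¬ (a = t 1 ∧ b = t 0) := Iff.rfl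
lemma ins_rl (a : V) (b : Fin m) : (ins G t B).Adj (.inr b) (.inl a) ↔
    ∃ i, B.att b = some i ∧ a = t i := Iff.rfl
lemma ins_lr (a : V) (b : Fin m) : (ins G t B).Adj (.inl a) (.inr b) ↔
    ∃ i, B.att b = some i ∧ a = t i := Iff.rfl
lemma ins_rr (a b : Fin m) : (ins G t B).Adj (.inr a) (.inr b) ↔ B.adj a b = true := Iff.rfl

def low (W : Finset V) (A : List (Fin 3)) : Finset V :=
  W.filter (fun v => ∀ i, t i = v → i ∈ A)

def mk (W : Finset V) (A : List (Fin 3)) (L : List (Fin m)) : Finset (V ⊕ Fin m) :=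
  (low t W A).disjSum L.toFinset

lemma mem_mk_l (W : Finset V) (A : List (Fin 3)) (L : List (Fin m)) (v : V) :
    (Sum.inl v) ∈ mk t W A L ↔ v ∈ W ∧ ∀ i, t i = v → i ∈ A := by simp [mk, low]
lemma mem_mk_r (W : Finset V) (A : List (Fin 3)) (L : List (Fin m)) (b : Fin m) :
    (Sum.inr b) ∈ mk t W A L ↔ b ∈ L := by simp [mk, low]

lemma comp_sum (ht : Function.Injective t) (W : Finset V) :
    ∀ (k : ℕ) (L : List (Fin m)) (A : List (Fin 3)), L.Nodup → A.Nodup → L.length ≤ k →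
    (∀ i ∈ A, t i ∈ W) →
    cnt (ins G t B) (mk t W A L) =
      ((comp B k L A).map (fun A' => cnt (ins G t B) (mk t W A' []))).sum := by
  intro k
  induction k with
  | zero =>
    intro L A _ _ hl _
    have : L = [] := by simpa using hl
    subst this
    simp [comp]
  | succ k ih =>
    intro L A hL hA hl hW
    cases L with
    | nil => simp [comp]
    | cons b L =>
      classical
      have hbL : b ∉ L := (List.nodup_cons.1 hL).1
      have hL' : L.Nodup := (List.nodup_cons.1 hL).2
      have hl' : L.length ≤ k := by simpa using hl
      rw [cnt_rec _ _ (Sum.inr b) (by simp [mem_mk_r]), Fintype.sum_sum_type]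
      simp only [comp, List.map_append, List.sum_append]
      rw [add_comm]
      congr 1
      · rw [List.map_flatMap, sum_flat]
        have h1 : ((L.filter (B.adj b)).map (fun c =>
            ((comp B k (L.erase c) A).map (fun A' => cnt (ins G t B) (mk t W A' []))).sum)) =
            (L.filter (B.adj b)).map (fun c => cnt (ins G t B) (mk t W A (L.erase c))) := by
          refine List.map_congr_left fun c hc => ?_
          refine (ih (L.erase c) A (hL'.erase c) hA ?_ hW).symm
          exact (List.length_erase_le).trans hl'
        have h1' := congrArg List.sum h1
        refine Eq.trans ?_ h1'.symm
        rw [← List.sum_toFinset _ (hL'.filter _)]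
        rw [← Finset.sum_filter]
        refine Finset.sum_congr ?_ ?_
        · ext c
          simp only [Finset.mem_filter, Finset.mem_univ, true_and, mem_mk_r, ins_rr, List.mem_toFinset,
            List.mem_filter, List.mem_cons]
          constructor
          · rintro ⟨rfl | h, h2⟩
            · simp [B.irrefl] at h2
            · exact ⟨h, h2⟩
          · rintro ⟨h, h2⟩
            exact ⟨Or.inr h, h2⟩
        · intro c hc
          congr 1
          ext x
          rcases x with v | d
          · simp [mem_mk_l]
          · simp only [Finset.mem_sdiff, mem_mk_r, List.mem_cons, Finset.mem_insert, Sum.inr.injEq,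
              Finset.mem_singleton, hL'.mem_erase_iff]
            grind
      · rcases hatt : B.att b with _ | i
        · simp [ins_rl, hatt]
        · by_cases hi : i ∈ A
          · simp only [hi, if_true]
            rw [← ih L (A.erase i) hL' (hA.erase i) hl' (fun j hj => hW j (List.mem_of_mem_erase hj))]
            rw [Finset.sum_eq_single (t i)]
            · rw [if_pos]
              · congr 1
                ext x
                rcases x with v | d
                · simp only [Finset.mem_sdiff, mem_mk_l, Finset.mem_insert, Sum.inl.injEq,
                    Finset.mem_singleton, hA.mem_erase_iff, reduceCtorEq, false_or]
                  constructor
                  · rintro ⟨⟨h1, h2⟩, h3⟩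
                    refine ⟨h1, fun j hj => ⟨?_, h2 j hj⟩⟩
                    rintro rfl
                    exact h3 hj.symm
                  · rintro ⟨h1, h2⟩
                    refine ⟨⟨h1, fun j hj => (h2 j hj).2⟩, ?_⟩
                    rintro rfl
                    exact (h2 i rfl).1 rfl
                · simp only [Finset.mem_sdiff, mem_mk_r, List.mem_cons, Finset.mem_insert, Sum.inr.injEq,
                    Finset.mem_singleton, reduceCtorEq, or_false]
                  grind
              · refine ⟨?_, ?_⟩
                · rw [mem_mk_l]
                  refine ⟨hW i hi, fun j hj => ?_⟩
                  rw [ht hj]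
                  exact hi
                · rw [ins_rl]
                  exact ⟨i, hatt, rfl⟩
            · intro v _ hv
              rw [if_neg]
              rintro ⟨_, h2⟩
              rw [ins_rl] at h2
              obtain ⟨j, hj, rfl⟩ := h2
              rw [hatt] at hj
              cases hj
              exact hv rfl
            · simp
          · simp only [hi, if_false, List.map_nil, List.sum_nil]
            refine Finset.sum_eq_zero fun v _ => ?_
            rw [if_neg]
            rintro ⟨h1, h2⟩
            rw [ins_rl] at h2
            obtain ⟨j, hj, rfl⟩ := h2
            rw [hatt] at hj
            cases hj
            rw [mem_mk_l] at h1
            exact hi (h1.2 i rfl)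

lemma mk_nil (W : Finset V) (A : List (Fin 3)) :
    mk (m := m) t W A [] = (low t W A).map Function.Embedding.inl := by
  ext x
  rcases x with v | d
  · simp [mem_mk_l, low]
  · simp [mem_mk_r]

lemma cnt_low (T : Finset V) (hT : ¬ (t 0 ∈ T ∧ t 1 ∈ T)) :
    cnt (ins G t B) (T.map Function.Embedding.inl) = cnt G T := by
  refine cnt_map _ _ _ _ ?_
  intro a ha b hb
  simp only [Function.Embedding.inl_apply, ins_ll]
  constructor
  · intro h
    refine ⟨h, ?_, ?_⟩
    · rintro ⟨rfl, rfl⟩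
      exact hT ⟨ha, hb⟩
    · rintro ⟨rfl, rfl⟩
      exact hT ⟨hb, ha⟩
  · exact fun h => h.1

lemma cnt_split (T : Finset V) (h0 : t 0 ∈ T) (h1 : t 1 ∈ T) (ha : G.Adj (t 0) (t 1)) :
    cnt G T = cnt (ins G t B) (T.map Function.Embedding.inl) + cnt G (T \ {t 0, t 1}) := by
  classical
  rw [cnt_rec G T (t 0) h0, cnt_rec (ins G t B) (T.map Function.Embedding.inl) (.inl (t 0)) (by simpa using h0),
    Fintype.sum_sum_type]
  have z : (∑ d : Fin m, if Sum.inr d ∈ T.map Function.Embedding.inl ∧ (ins G t B).Adj (.inl (t 0)) (.inr d)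
      then cnt (ins G t B) (T.map Function.Embedding.inl \ {.inl (t 0), .inr d}) else 0) = 0 := by
    refine Finset.sum_eq_zero fun d _ => ?_
    simp
  rw [z, add_zero]
  have e : cnt G (T \ {t 0, t 1}) = ∑ w : V, if w = t 1 then cnt G (T \ {t 0, w}) else 0 := by
    simp
  rw [e, ← Finset.sum_add_distrib]
  refine Finset.sum_congr rfl fun w _ => ?_
  by_cases hw : w = t 1
  · subst hw
    simp [h1, ha, ins_ll]
  · have e2 : (T.map Function.Embedding.inl \ {.inl (t 0), .inl w} : Finset (V ⊕ Fin m)) =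
        (T \ {t 0, w}).map Function.Embedding.inl := by
      ext x
      rcases x with v | d <;> simp
    rw [e2, cnt_low _ _ _ _ (by simp)]
    have : ¬ (t 0 = t 1 ∧ w = t 0) := fun hc => ha.ne hc.1
    simp [hw, ins_ll, this]

end insertion

structure Good {V : Type} [Fintype V] [DecidableEq V] (G : SimpleGraph V) (t : Fin 3 → V) (c : ℕ) :
    Prop where
  inj : Function.Injective t
  adj : G.Adj (t 0) (t 1)
  conn : Conn3 G
  bic : ∀ x y, x ≠ y → 0 < cnt G (Finset.univ \ {x, y})
  total : cnt G Finset.univ = c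
  u0 : cnt G (Finset.univ \ {t 0, t 2}) = 1
  u1 : cnt G (Finset.univ \ {t 1, t 2}) = 1

structure BOK {m : ℕ} (B : Block m) (d1 d2 : ℕ) : Prop where
  a0 : B.att B.first = some 0
  tot : (comp B m (List.finRange m) [0, 1, 2]).Perm
    ([0, 1, 2] :: [2] :: (List.replicate d1 [1] ++ List.replicate d2 [0]))
  c1 : comp B m (List.finRange m) [1] = [[1]]
  c2 : comp B m ((List.finRange m).erase B.first) [0, 1] = [[0]]
  b1 : ∀ A ∈ [[], [0], [1], [2], [0, 1], [0, 2], [1, 2], [0, 1, 2]], A ∈ comp B m (List.finRange m) A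
  b1a : [] ∈ comp B m (List.finRange m) [0, 1]
  b1b : [2] ∈ comp B m (List.finRange m) [0, 1, 2]
  b2 : ∀ A ∈ [[0, 1, 2], [1, 2], [0, 2], [0, 1]], ∀ b, ∃ i ∈ A,
    (A.erase i ∈ comp B m ((List.finRange m).erase b) A) ∧ ¬ (0 ∈ A.erase i ∧ 1 ∈ A.erase i)
  b3 : ∀ b c, b ≠ c → ∃ A' ∈ [[0], [1], [2], [0, 1, 2]],
    A' ∈ comp B m (((List.finRange m).erase b).erase c) [0, 1, 2]
  g0 : ∀ b c e : Fin m, e ≠ b → e ≠ c → e ∈ grow B [b, c] [] m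
  g1 : ∀ (b : Fin m) (i : Fin 3) (e : Fin m), e ≠ b → e ∈ grow B [b] [i] m
  g2 : ∀ (i j : Fin 3) (e : Fin m), e ∈ grow B [] [i, j] m

section step
variable {V : Type} [Fintype V] [DecidableEq V] {m : ℕ} {G : SimpleGraph V} {t : Fin 3 → V}
  {B : Block m} {c d1 d2 : ℕ}

lemma pos_of_mem {α : Type} (L : List α) (g : α → ℕ) (a : α) (ha : a ∈ L) (hp : 0 < g a) :
    0 < (L.map g).sum := by
  induction L with
  | nil => simp at ha
  | cons b L ih =>
    simp only [List.map_cons, List.sum_cons]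
    rcases List.mem_cons.1 ha with rfl | h
    · omega
    · have := ih h
      omega

lemma len_erase (b : Fin m) : ((List.finRange m).erase b).length ≤ m :=
  (List.length_erase_le).trans (by simp)

lemma exists_nb (hG : Good G t c) (y : V) (hy : y ≠ t 0) :
    ∃ w, G.Adj (t 0) w ∧ w ≠ t 1 ∧ w ≠ y := by
  have h01 : t 0 ≠ t 1 := hG.adj.ne
  have h02 : t 0 ≠ t 2 := fun h => by simpa using hG.inj h
  have h12 : t 1 ≠ t 2 := fun h => by simpa using hG.inj h
  have key : ∀ y, y ≠ t 0 → y ≠ t 1 → ∃ w, G.Adj (t 0) w ∧ w ≠ t 1 ∧ w ≠ y := by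
    intro y hy0 hy1
    obtain ⟨f, hf⟩ := cnt_pos.1 (hG.bic (t 1) y hy1.symm)
    have hm : t 0 ∈ Finset.univ \ {t 1, y} := by simp [h01, hy0.symm]
    refine ⟨f (t 0), (hf _).2.1 hm, ?_⟩
    have := hf.mem hm
    simpa using this
  by_cases hy1 : y = t 1
  · obtain ⟨w, h1, h2, _⟩ := key (t 2) h02.symm h12.symm
    exact ⟨w, h1, h2, hy1 ▸ h2⟩
  · exact key y hy hy1

lemma cnt0_pos (hG : Good G t c) : 0 < cnt (ins G t B) (Finset.univ.map Function.Embedding.inl) := by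
  classical
  have h02 : t 0 ≠ t 2 := fun h => by simpa using hG.inj h
  obtain ⟨w, h1, h2, _⟩ := exists_nb hG (t 2) h02.symm
  rw [cnt_rec _ _ (Sum.inl (t 0)) (by simp), Fintype.sum_sum_type]
  refine Nat.add_pos_left ?_ _
  refine Finset.sum_pos' (fun _ _ => Nat.zero_le _) ⟨w, Finset.mem_univ _, ?_⟩
  have e2 : (Finset.univ.map Function.Embedding.inl \ {.inl (t 0), .inl w} : Finset (V ⊕ Fin m)) =
      (Finset.univ \ {t 0, w}).map Function.Embedding.inl := by
    ext x
    rcases x with v | d <;> simp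
  rw [if_pos, e2, cnt_low _ _ _ _ (by simp)]
  · exact hG.bic _ _ h1.ne
  · refine ⟨by simp, ?_⟩
    rw [ins_ll]
    exact ⟨h1, fun h => h2 h.2, fun h => hG.adj.ne h.1⟩

lemma low_full : low t Finset.univ [0, 1, 2] = Finset.univ := by
  ext v
  simp [low, Fin.forall_fin_succ]

lemma low_0 (ht : Function.Injective t) : low t Finset.univ [0] = Finset.univ \ {t 1, t 2} := by
  have h01 : t 0 ≠ t 1 := fun h => by simpa using ht h
  have h02 : t 0 ≠ t 2 := fun h => by simpa using ht h
  ext v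
  simp [low, Fin.forall_fin_succ, eq_comm]

lemma low_1 (_ht : Function.Injective t) : low t Finset.univ [1] = Finset.univ \ {t 0, t 2} := by
  ext v
  simp [low, Fin.forall_fin_succ, eq_comm]

lemma low_2 (_ht : Function.Injective t) : low t Finset.univ [2] = Finset.univ \ {t 0, t 1} := by
  ext v
  simp [low, Fin.forall_fin_succ, eq_comm]

lemma val_0 (hG : Good G t c) : cnt (ins G t B) (mk t Finset.univ [0] []) = 1 := by
  rw [mk_nil, low_0 hG.inj, cnt_low _ _ _ _ (by simp), hG.u1]

lemma val_1 (hG : Good G t c) : cnt (ins G t B) (mk t Finset.univ [1] []) = 1 := by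
  rw [mk_nil, low_1 hG.inj, cnt_low _ _ _ _ (by simp), hG.u0]

lemma val_2 (hG : Good G t c) : cnt (ins G t B) (mk t Finset.univ [2] []) =
    cnt G (Finset.univ \ {t 0, t 1}) := by
  rw [mk_nil, low_2 hG.inj, cnt_low _ _ _ _ (by simp)]

lemma step_total (hG : Good G t c) (hB : BOK B d1 d2) :
    cnt (ins G t B) Finset.univ = c + (d1 + d2) := by
  have e : (Finset.univ : Finset (V ⊕ Fin m)) = mk t Finset.univ [0, 1, 2] (List.finRange m) := by
    ext x
    rcases x with v | d
    · simp [mem_mk_l, Fin.forall_fin_succ]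
    · simp [mem_mk_r]
  rw [e, comp_sum G t B hG.inj Finset.univ m _ _ (List.nodup_finRange m) (by decide) (by simp) (by simp),
    (hB.tot.map _).sum_eq]
  simp only [List.map_cons, List.map_append, List.map_replicate, List.sum_cons, List.sum_append,
    List.sum_replicate, val_0 hG, val_1 hG, val_2 hG]
  have := cnt_split G t B Finset.univ (by simp) (by simp) hG.adj
  rw [hG.total] at this
  rw [mk_nil, low_full]
  simp only [smul_eq_mul, mul_one]
  omega

lemma step_u0 (hG : Good G t c) (hB : BOK B d1 d2) :
    cnt (ins G t B) (Finset.univ \ {.inl (t 0), .inl (t 2)}) = 1 := by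
  have e : (Finset.univ \ {.inl (t 0), .inl (t 2)} : Finset (V ⊕ Fin m)) =
      mk t Finset.univ [1] (List.finRange m) := by
    ext x
    rcases x with v | d
    · simp [mem_mk_l, Fin.forall_fin_succ, eq_comm]
    · simp [mem_mk_r]
  rw [e, comp_sum G t B hG.inj Finset.univ m _ _ (List.nodup_finRange m) (by decide) (by simp) (by simp),
    hB.c1]
  simp [val_1 hG]

lemma step_u1 (hG : Good G t c) (hB : BOK B d1 d2) :
    cnt (ins G t B) (Finset.univ \ {.inr B.first, .inl (t 2)}) = 1 := by
  have e : (Finset.univ \ {.inr B.first, .inl (t 2)} : Finset (V ⊕ Fin m)) =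
      mk t Finset.univ [0, 1] ((List.finRange m).erase B.first) := by
    ext x
    rcases x with v | d
    · simp [mem_mk_l, Fin.forall_fin_succ, eq_comm]
    · simp [mem_mk_r, (List.nodup_finRange m).mem_erase_iff]
  rw [e, comp_sum G t B hG.inj Finset.univ m _ _ ((List.nodup_finRange m).erase _) (by decide)
    (len_erase _) (by simp),
    hB.c2]
  simp [val_0 hG]

lemma step_b3 (hG : Good G t c) (hB : BOK B d1 d2) (b b' : Fin m) (hb : b ≠ b') :
    0 < cnt (ins G t B) (Finset.univ \ {.inr b, .inr b'}) := by
  have hn := ((List.nodup_finRange m).erase b)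
  have e : (Finset.univ \ {.inr b, .inr b'} : Finset (V ⊕ Fin m)) =
      mk t Finset.univ [0, 1, 2] (((List.finRange m).erase b).erase b') := by
    ext x
    rcases x with v | d
    · simp [mem_mk_l, Fin.forall_fin_succ]
    · simp [mem_mk_r, hn.mem_erase_iff, (List.nodup_finRange m).mem_erase_iff, and_comm]
  rw [e, comp_sum G t B hG.inj Finset.univ m _ _ (hn.erase _) (by decide)
    ((List.length_erase_le).trans (len_erase _)) (by simp)]
  obtain ⟨A', h1, h2⟩ := hB.b3 b b' hb
  refine pos_of_mem _ _ A' h2 ?_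
  simp only [List.mem_cons, List.not_mem_nil, or_false] at h1
  rcases h1 with rfl | rfl | rfl | rfl
  · simp [val_0 hG]
  · simp [val_1 hG]
  · rw [val_2 hG]
    exact hG.bic _ _ hG.adj.ne
  · rw [mk_nil, low_full]
    exact cnt0_pos hG

lemma step_b2 (hG : Good G t c) (hB : BOK B d1 d2) (u : V) (b : Fin m) :
    0 < cnt (ins G t B) (Finset.univ \ {.inl u, .inr b}) := by
  have h01 : t 0 ≠ t 1 := fun h => by simpa using hG.inj h
  have h02 : t 0 ≠ t 2 := fun h => by simpa using hG.inj h
  have h12 : t 1 ≠ t 2 := fun h => by simpa using hG.inj h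
  have hA : ∃ A ∈ [[0, 1, 2], [1, 2], [0, 2], [0, 1]], ∀ i, i ∈ A ↔ t i ≠ u := by
    by_cases h0 : u = t 0
    · exact ⟨[1, 2], by simp, by subst h0; simp [Fin.forall_fin_succ, h01.symm, h02.symm]⟩
    by_cases h1 : u = t 1
    · exact ⟨[0, 2], by simp, by subst h1; simp [Fin.forall_fin_succ, h01, h12.symm]⟩
    by_cases h2 : u = t 2
    · exact ⟨[0, 1], by simp, by subst h2; simp [Fin.forall_fin_succ, h02, h12]⟩
    · exact ⟨[0, 1, 2], by simp, by
        simp [Fin.forall_fin_succ, Ne.symm h0, Ne.symm h1, Ne.symm h2]⟩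
  obtain ⟨A, hA1, hA2⟩ := hA
  have hAn : A.Nodup := by
    simp only [List.mem_cons, List.not_mem_nil, or_false] at hA1
    rcases hA1 with rfl | rfl | rfl | rfl <;> decide
  have e : (Finset.univ \ {.inl u, .inr b} : Finset (V ⊕ Fin m)) =
      mk t (Finset.univ \ {u}) A ((List.finRange m).erase b) := by
    ext x
    rcases x with v | d
    · simp only [Finset.mem_sdiff, Finset.mem_univ, true_and, Finset.mem_insert, Sum.inl.injEq,
        Finset.mem_singleton, reduceCtorEq, or_false, mem_mk_l, hA2]
      constructor
      · intro h
        exact ⟨h, fun i hi => hi ▸ h⟩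
      · exact fun h => h.1
    · simp [mem_mk_r, (List.nodup_finRange m).mem_erase_iff]
  rw [e, comp_sum G t B hG.inj _ m _ _ ((List.nodup_finRange m).erase _) hAn
    (len_erase _) (by intro i hi; simpa using (hA2 i).1 hi)]
  obtain ⟨i, hi, h1, h2⟩ := hB.b2 A hA1 b
  refine pos_of_mem _ _ _ h1 ?_
  have el : low t (Finset.univ \ {u}) (A.erase i) = Finset.univ \ {u, t i} := by
    ext v
    simp only [low, Finset.mem_filter, Finset.mem_sdiff, Finset.mem_univ, true_and,
      Finset.mem_singleton, hAn.mem_erase_iff, hA2, Finset.mem_insert]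
    constructor
    · rintro ⟨h1, h2⟩ (rfl | rfl)
      · exact h1 rfl
      · exact (h2 i rfl).1 rfl
    · intro h
      refine ⟨fun hc => h (Or.inl hc), fun j hj => ⟨?_, ?_⟩⟩
      · rintro rfl
        exact h (Or.inr hj.symm)
      · rw [hj]
        exact fun hc => h (Or.inl hc)
  rw [mk_nil, cnt_low, el]
  · exact hG.bic _ _ ((hA2 i).1 hi).symm
  · simp only [low, Finset.mem_filter]
    rintro ⟨h3, h4⟩
    exact h2 ⟨h3.2 0 rfl, h4.2 1 rfl⟩

lemma step_b1 (hG : Good G t c) (hB : BOK B d1 d2) (u v : V) (huv : u ≠ v) :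
    0 < cnt (ins G t B) (Finset.univ \ {.inl u, .inl v}) := by
  classical
  set W : Finset V := Finset.univ \ {u, v} with hW
  set A : List (Fin 3) := [0, 1, 2].filter (fun i => t i ∈ W) with hAdef
  have hA2 : ∀ i, i ∈ A ↔ t i ∈ W := by
    intro i
    rw [hAdef]
    fin_cases i <;> simp
  have hA1 : A ∈ ([[], [0], [1], [2], [0, 1], [0, 2], [1, 2], [0, 1, 2]] : List (List (Fin 3))) := by
    rw [hAdef]
    by_cases h0 : t 0 ∈ W <;> by_cases h1 : t 1 ∈ W <;> by_cases h2 : t 2 ∈ W <;> simp [h0, h1, h2]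
  have hAn : A.Nodup := List.Nodup.filter _ (by decide)
  have e : (Finset.univ \ {.inl u, .inl v} : Finset (V ⊕ Fin m)) =
      mk t W A (List.finRange m) := by
    ext x
    rcases x with z | d
    · simp only [Finset.mem_sdiff, Finset.mem_univ, true_and, Finset.mem_insert, Sum.inl.injEq,
        Finset.mem_singleton, mem_mk_l, hA2]
      have : z ∈ W ↔ ¬ (z = u ∨ z = v) := by simp [hW]
      rw [← this]
      constructor
      · intro h
        exact ⟨h, fun i hi => hi ▸ h⟩
      · exact fun h => h.1
    · simp [mem_mk_r]
  have hlow : low t W A = W := by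
    ext z
    simp only [low, Finset.mem_filter, hA2]
    constructor
    · exact fun h => h.1
    · intro h
      exact ⟨h, fun i hi => hi ▸ h⟩
  rw [e, comp_sum G t B hG.inj _ m _ _ (List.nodup_finRange m) hAn
    (by simp) (fun i hi => (hA2 i).1 hi)]
  have hpos : 0 < cnt G W := hG.bic u v huv
  by_cases h : t 0 ∈ W ∧ t 1 ∈ W
  · rw [cnt_split G t B W h.1 h.2 hG.adj] at hpos
    by_cases hp : 0 < cnt (ins G t B) (W.map Function.Embedding.inl)
    · refine pos_of_mem _ _ _ (hB.b1 A hA1) ?_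
      rw [mk_nil, hlow]
      exact hp
    · have hp2 : 0 < cnt G (W \ {t 0, t 1}) := by omega
      by_cases h2 : t 2 ∈ W
      · have hA : A = [0, 1, 2] := by simp [hAdef, h.1, h.2, h2]
        rw [hA]
        refine pos_of_mem _ _ _ hB.b1b ?_
        have : low t W [2] = W \ {t 0, t 1} := by
          ext z
          simp [low, Fin.forall_fin_succ, eq_comm]
        rw [mk_nil, this, cnt_low _ _ _ _ (by simp)]
        exact hp2
      · have hA : A = [0, 1] := by simp [hAdef, h.1, h.2, h2]
        rw [hA]
        refine pos_of_mem _ _ _ hB.b1a ?_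
        have : low t W [] = W \ {t 0, t 1} := by
          ext z
          simp only [low, Fin.forall_fin_succ, Finset.mem_filter, List.not_mem_nil, imp_false,
            Finset.mem_sdiff, Finset.mem_insert, Finset.mem_singleton]
          have : z ∈ W → t 2 ≠ z := by
            rintro hz rfl
            exact h2 hz
          simp [eq_comm]
          grind
        rw [mk_nil, this, cnt_low _ _ _ _ (by simp)]
        exact hp2
  · refine pos_of_mem _ _ _ (hB.b1 A hA1) ?_
    rw [mk_nil, hlow, cnt_low _ _ _ _ h]
    exact hpos

lemma step_bic (hG : Good G t c) (hB : BOK B d1 d2) (x y : V ⊕ Fin m) (hxy : x ≠ y) :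
    0 < cnt (ins G t B) (Finset.univ \ {x, y}) := by
  rcases x with u | b <;> rcases y with v | b'
  · exact step_b1 hG hB u v (fun h => hxy (by rw [h]))
  · exact step_b2 hG hB u b'
  · rw [Finset.pair_comm]
    exact step_b2 hG hB v b
  · exact step_b3 hG hB b b' (fun h => hxy (by rw [h]))

end step

section conn
variable {V : Type} [Fintype V] [DecidableEq V] {m : ℕ} {G : SimpleGraph V} {t : Fin 3 → V}
  {B : Block m} {c d1 d2 : ℕ}

lemma grow_sound (D : List (Fin m)) (E : List (Fin 3)) (x y : V ⊕ Fin m)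
    (hD : ∀ b, b ∉ D → (Sum.inr b : V ⊕ Fin m) ≠ x ∧ (Sum.inr b : V ⊕ Fin m) ≠ y)
    (hE : ∀ j, j ∉ E → (Sum.inl (t j) : V ⊕ Fin m) ≠ x ∧ (Sum.inl (t j) : V ⊕ Fin m) ≠ y) :
    ∀ (k : ℕ) (b : Fin m), b ∈ grow B D E k →
      b ∉ D ∧ ∃ i, i ∉ E ∧ Av (ins G t B) x y (.inr b) (.inl (t i)) := by
  intro k
  induction k with
  | zero => intro b hb; simp [grow] at hb
  | succ k ih =>
    intro b hb
    simp only [grow, List.mem_filter, List.mem_finRange, true_and, Bool.and_eq_true,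
      Bool.or_eq_true, List.any_eq_true] at hb
    obtain ⟨h1, h2⟩ := hb
    refine ⟨by simpa using h1, ?_⟩
    rcases h2 with h2 | ⟨b', h3, h4⟩
    · rcases hatt : B.att b with _ | i
      · simp [hatt] at h2
      · have hi : i ∉ E := by simpa [hatt] using h2
        refine ⟨i, hi, Relation.ReflTransGen.single ⟨?_, hE i hi⟩⟩
        rw [ins_rl]
        exact ⟨i, hatt, rfl⟩
    · obtain ⟨h5, i, hi, hav⟩ := ih b' h3
      refine ⟨i, hi, Relation.ReflTransGen.head ⟨?_, hD b' h5⟩ hav⟩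
      rw [ins_rr]
      exact h4

lemma lift_av (x' y' : V) (x y : V ⊕ Fin m) (a b : V)
    (hal : ∀ z, z ≠ x' → z ≠ y' → (Sum.inl z : V ⊕ Fin m) ≠ x ∧ (Sum.inl z : V ⊕ Fin m) ≠ y)
    (hpq : t 0 ≠ x' → t 0 ≠ y' → t 1 ≠ x' → t 1 ≠ y' →
      Av (ins G t B) x y (.inl (t 0)) (.inl (t 1)))
    (hax : a ≠ x') (hay : a ≠ y') (h : Av G x' y' a b) :
    Av (ins G t B) x y (.inl a) (.inl b) := by
  have key : Av (ins G t B) x y (.inl a) (.inl b) ∧ b ≠ x' ∧ b ≠ y' := by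
    induction h with
    | refl => exact ⟨Relation.ReflTransGen.refl, hax, hay⟩
    | @tail b d hab hbd ih =>
      refine ⟨Relation.ReflTransGen.trans ih.1 ?_, hbd.2⟩
      by_cases h1 : b = t 0 ∧ d = t 1
      · rw [h1.1, h1.2]
        rw [h1.1] at ih
        rw [h1.2] at hbd
        exact hpq ih.2.1 ih.2.2 hbd.2.1 hbd.2.2
      by_cases h2 : b = t 1 ∧ d = t 0
      · rw [h2.1, h2.2]
        rw [h2.1] at ih
        rw [h2.2] at hbd
        have hz := hal (t 0) hbd.2.1 hbd.2.2
        exact Av.symm (hpq hbd.2.1 hbd.2.2 ih.2.1 ih.2.2) hz.1 hz.2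
      · refine Relation.ReflTransGen.single ⟨?_, hal d hbd.2.1 hbd.2.2⟩
        rw [ins_ll]
        exact ⟨hbd.1, h1, h2⟩
  exact key.1

lemma pq_blocked (hG : Good G t c) (z : V) (h0 : z ≠ t 0) (h1 : z ≠ t 1) (x y : V ⊕ Fin m)
    (hal : ∀ a, a ≠ z → (Sum.inl a : V ⊕ Fin m) ≠ x ∧ (Sum.inl a : V ⊕ Fin m) ≠ y) :
    Av (ins G t B) x y (.inl (t 0)) (.inl (t 1)) := by
  obtain ⟨w, hw1, hw2, hw3⟩ := exists_nb hG z h0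
  have hw0 : w ≠ t 0 := hw1.ne.symm
  refine Relation.ReflTransGen.head (b := .inl w) ⟨?_, hal w hw3⟩ ?_
  · rw [ins_ll]
    exact ⟨hw1, fun h => hw2 h.2, fun h => hG.adj.ne h.1⟩
  · exact lift_av (t 0) z x y w (t 1) (fun a _ ha => hal a ha) (fun h => absurd rfl h) hw0 hw3
      (hG.conn _ _ _ _ hw0 hw3 hG.adj.ne.symm h1.symm)

lemma low_conn (hG : Good G t c) (hB : BOK B d1 d2) (x y : V ⊕ Fin m) (a b : V)
    (hax : Sum.inl a ≠ x) (hay : Sum.inl a ≠ y) (hbx : Sum.inl b ≠ x) (hby : Sum.inl b ≠ y) :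
    Av (ins G t B) x y (.inl a) (.inl b) := by
  have h01 : t 0 ≠ t 1 := fun h => by simpa using hG.inj h
  have h02 : t 0 ≠ t 2 := fun h => by simpa using hG.inj h
  have h12 : t 1 ≠ t 2 := fun h => by simpa using hG.inj h
  rcases x with x' | bx <;> rcases y with y' | bz
  · have hax' : a ≠ x' := fun h => hax (by rw [h])
    have hay' : a ≠ y' := fun h => hay (by rw [h])
    have hbx' : b ≠ x' := fun h => hbx (by rw [h])
    have hby' : b ≠ y' := fun h => hby (by rw [h])
    refine lift_av x' y' _ _ a b (fun z h1 h2 => by simp [h1, h2]) ?_ hax' hay' (hG.conn _ _ _ _ hax' hay' hbx' hby')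
    intro h1 h2 h3 h4
    obtain ⟨_, i, hi, hav⟩ := grow_sound (G := G) (t := t) (B := B) [] [0, 2] (.inl x') (.inl y') (by simp)
      (by
        intro j hj
        fin_cases j
        · simp at hj
        · simp [h3, h4]
        · simp at hj) m B.first (hB.g2 0 2 _)
    have hi1 : i = 1 := by
      fin_cases i
      · simp at hi
      · rfl
      · simp at hi
    subst hi1
    have hs : (ins G t B).Adj (.inl (t 0)) (.inr B.first) ∧
        (Sum.inr B.first : V ⊕ Fin m) ≠ .inl x' ∧ (Sum.inr B.first : V ⊕ Fin m) ≠ .inl y' := by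
      refine ⟨?_, by simp, by simp⟩
      rw [ins_lr]
      exact ⟨0, hB.a0, rfl⟩
    exact Relation.ReflTransGen.head hs hav
  · have hax' : a ≠ x' := fun h => hax (by rw [h])
    have hbx' : b ≠ x' := fun h => hbx (by rw [h])
    refine lift_av x' x' _ _ a b (by simp) ?_ hax' hax' (hG.conn _ _ _ _ hax' hax' hbx' hbx')
    intro h1 _ h3 _
    exact pq_blocked hG x' h1.symm h3.symm _ _ (by simp)
  · have hax' : a ≠ y' := fun h => hay (by rw [h])
    have hbx' : b ≠ y' := fun h => hby (by rw [h])
    refine lift_av y' y' _ _ a b (by simp) ?_ hax' hax' (hG.conn _ _ _ _ hax' hax' hbx' hbx')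
    intro h1 _ h3 _
    exact pq_blocked hG y' h1.symm h3.symm _ _ (by simp)
  · have hz : ∃ z, a ≠ z ∧ b ≠ z := by
      by_contra hc
      push Not at hc
      have k0 := hc (t 0)
      have k1 := hc (t 1)
      have k2 := hc (t 2)
      by_cases e0 : a = t 0
      · exact h12 ((k1 (e0 ▸ h01)).symm.trans (k2 (e0 ▸ h02)))
      · have f0 := k0 e0
        by_cases e1 : a = t 1
        · exact h02 (f0.symm.trans (k2 (e1 ▸ h12)))
        · exact h01 (f0.symm.trans (k1 e1))
    obtain ⟨z, hz1, hz2⟩ := hz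
    refine lift_av z z _ _ a b (by simp) ?_ hz1 hz1 (hG.conn _ _ _ _ hz1 hz1 hz2 hz2)
    intro _ _ _ _
    exact pq_blocked hG (t 2) h02.symm h12.symm _ _ (by simp)

lemma att_idx (hG : Good G t c) (u : V) : ∃ i, ∀ j, j ≠ i → t j ≠ u := by
  by_cases h : ∃ i, t i = u
  · obtain ⟨i, rfl⟩ := h
    exact ⟨i, fun j hj hc => hj (hG.inj hc)⟩
  · push Not at h
    exact ⟨0, fun j _ => h j⟩

lemma high_conn (hG : Good G t c) (hB : BOK B d1 d2) (x y : V ⊕ Fin m) (b : Fin m)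
    (hbx : Sum.inr b ≠ x) (hby : Sum.inr b ≠ y) :
    ∃ v : V, Sum.inl v ≠ x ∧ Sum.inl v ≠ y ∧ Av (ins G t B) x y (.inr b) (.inl v) := by
  have main : ∀ D E, b ∈ grow B D E m →
      (∀ b, b ∉ D → (Sum.inr b : V ⊕ Fin m) ≠ x ∧ (Sum.inr b : V ⊕ Fin m) ≠ y) →
      (∀ j, j ∉ E → (Sum.inl (t j) : V ⊕ Fin m) ≠ x ∧ (Sum.inl (t j) : V ⊕ Fin m) ≠ y) →
      ∃ v : V, Sum.inl v ≠ x ∧ Sum.inl v ≠ y ∧ Av (ins G t B) x y (.inr b) (.inl v) := by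
    intro D E h hD hE
    obtain ⟨_, i, hi, hav⟩ := grow_sound (G := G) (t := t) (B := B) D E x y hD hE m b h
    exact ⟨t i, (hE i hi).1, (hE i hi).2, hav⟩
  rcases x with x' | bx <;> rcases y with y' | bz
  · obtain ⟨i, hi⟩ := att_idx hG x'
    obtain ⟨j, hj⟩ := att_idx hG y'
    refine main [] [i, j] (hB.g2 i j b) (by simp) ?_
    intro k hk
    simp only [List.mem_cons, List.not_mem_nil, or_false, not_or] at hk
    simpa using ⟨hi k hk.1, hj k hk.2⟩
  · obtain ⟨i, hi⟩ := att_idx hG x'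
    refine main [bz] [i] (hB.g1 bz i b (fun h => hby (by rw [h]))) (by simp) ?_
    intro k hk
    simpa using hi k (by simpa using hk)
  · obtain ⟨i, hi⟩ := att_idx hG y'
    refine main [bx] [i] (hB.g1 bx i b (fun h => hbx (by rw [h]))) (by simp) ?_
    intro k hk
    simpa using hi k (by simpa using hk)
  · exact main [bx, bz] [] (hB.g0 bx bz b (fun h => hbx (by rw [h])) (fun h => hby (by rw [h])))
      (by simp) (by simp)

lemma step_conn (hG : Good G t c) (hB : BOK B d1 d2) : Conn3 (ins G t B) := by
  have h : ∀ x y u, u ≠ x → u ≠ y → ∃ v : V, Sum.inl v ≠ x ∧ Sum.inl v ≠ y ∧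
      Av (ins G t B) x y u (.inl v) := by
    intro x y u hx hy
    rcases u with a | b
    · exact ⟨a, hx, hy, Relation.ReflTransGen.refl⟩
    · exact high_conn hG hB x y b hx hy
  intro x y u v hux huy hvx hvy
  obtain ⟨a, ha1, ha2, ha3⟩ := h x y u hux huy
  obtain ⟨b, hb1, hb2, hb3⟩ := h x y v hvx hvy
  exact (ha3.trans (low_conn hG hB x y a b ha1 ha2 hb1 hb2)).trans (hb3.symm hvx hvy)

theorem step (hG : Good G t c) (hB : BOK B d1 d2) :
    Good (ins G t B) ![.inl (t 0), .inr B.first, .inl (t 2)] (c + (d1 + d2)) where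
  inj := by
    have h02 : t 0 ≠ t 2 := fun h => by simpa using hG.inj h
    intro i j
    fin_cases i <;> fin_cases j <;> simp [h02, h02.symm]
  adj := by
    change (ins G t B).Adj (.inl (t 0)) (.inr B.first)
    rw [ins_lr]
    exact ⟨0, hB.a0, rfl⟩
  conn := step_conn hG hB
  bic := step_bic hG hB
  total := step_total hG hB
  u0 := step_u0 hG hB
  u1 := step_u1 hG hB

end conn

def edgeIn {m : ℕ} (E : List (ℕ × ℕ)) (a b : Fin m) : Bool :=
  E.contains (a.val, b.val) || E.contains (b.val, a.val)

def bl33 : Block 6 where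
  adj := edgeIn [(0,1),(1,2),(0,2),(2,3),(3,4),(4,5),(3,5)]
  att := ![some 0, some 2, none, none, some 2, some 1]
  first := 0
  symm := by decide +kernel
  irrefl := by decide +kernel

def bl35 : Block 8 where
  adj := edgeIn [(0,1),(1,2),(0,2),(2,3),(3,4),(4,5),(5,6),(6,7),(3,7),(4,6)]
  att := ![some 0, some 2, none, none, none, some 2, none, some 1]
  first := 0
  symm := by decide +kernel
  irrefl := by decide +kernel

def bl55 : Block 10 where
  adj := edgeIn [(0,1),(1,2),(2,3),(3,4),(0,4),(1,3),(4,5),(5,6),(6,7),(7,8),(8,9),(5,9),(6,8)]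
  att := ![some 0, none, some 2, none, none, none, none, some 2, none, some 1]
  first := 0
  symm := by decide +kernel
  irrefl := by decide +kernel

lemma ok33 : BOK bl33 2 2 := by
  constructor <;> decide +kernel
lemma ok35 : BOK bl35 3 2 := by
  constructor <;> decide +kernel
lemma ok55 : BOK bl55 3 3 := by
  constructor <;> decide +kernel

lemma cnt_pair (a b : Fin 4) (hab : a ≠ b) : cnt (⊤ : SimpleGraph (Fin 4)) {a, b} = 1 := by
  classical
  rw [cnt_rec _ _ a (by simp), Finset.sum_eq_single b]
  · rw [if_pos ⟨by simp, hab⟩, sdiff_self]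
    exact cnt_empty _
  · intro w _ hw
    rw [if_neg]
    rintro ⟨h1, h2⟩
    simp only [Finset.mem_insert, Finset.mem_singleton] at h1
    rcases h1 with h1 | h1
    · exact h2 h1.symm
    · exact hw h1
  · simp

lemma base_cnt : cnt (⊤ : SimpleGraph (Fin 4)) Finset.univ = 3 := by
  classical
  rw [cnt_rec _ _ 0 (by simp)]
  have h1 : (Finset.univ \ {0, 1} : Finset (Fin 4)) = {2, 3} := by decide
  have h2 : (Finset.univ \ {0, 2} : Finset (Fin 4)) = {1, 3} := by decide
  have h3 : (Finset.univ \ {0, 3} : Finset (Fin 4)) = {1, 2} := by decide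
  rw [Fin.sum_univ_four, h1, h2, h3, cnt_pair 2 3 (by decide), cnt_pair 1 3 (by decide),
    cnt_pair 1 2 (by decide)]
  simp

lemma base : Good (⊤ : SimpleGraph (Fin 4)) ![0, 1, 2] 3 where
  inj := by decide
  adj := by decide
  conn := by
    intro x y u v hux huy hvx hvy
    by_cases h : u = v
    · subst h
      exact Relation.ReflTransGen.refl
    · exact Relation.ReflTransGen.single ⟨h, hvx, hvy⟩
  bic := by
    intro x y hxy
    have : ∀ x y : Fin 4, x ≠ y → ∃ a b, a ≠ b ∧ Finset.univ \ {x, y} = ({a, b} : Finset (Fin 4)) := by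
      decide
    obtain ⟨a, b, hab, h⟩ := this x y hxy
    rw [h, cnt_pair a b hab]
    exact one_pos
  total := base_cnt
  u0 := by
    have : (Finset.univ \ {0, 2} : Finset (Fin 4)) = {1, 3} := by decide
    exact (congrArg _ this).trans (cnt_pair 1 3 (by decide))
  u1 := by
    have : (Finset.univ \ {1, 2} : Finset (Fin 4)) = {0, 3} := by decide
    exact (congrArg _ this).trans (cnt_pair 0 3 (by decide))

def Ex (n c : ℕ) : Prop :=
  ∃ (V : Type) (_ : Fintype V) (_ : DecidableEq V) (G : SimpleGraph V) (t : Fin 3 → V),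
    Fintype.card V = n ∧ Good G t c

lemma Ex.step {n c m d1 d2 : ℕ} {B : Block m} (h : Ex n c) (hB : BOK B d1 d2) :
    Ex (n + m) (c + (d1 + d2)) := by
  obtain ⟨V, i1, i2, G, t, hc, hG⟩ := h
  exact ⟨V ⊕ Fin m, inferInstance, inferInstance, ins G t B, _, by simp [hc], Ins.step hG hB⟩

lemma Ex.iter {n c : ℕ} (h : Ex n c) (k : ℕ) : Ex (n + 8 * k) (c + 5 * k) := by
  induction k with
  | zero => exact h
  | succ k ih =>
    have h2 : Ex (n + 8 * k + 8) (c + 5 * k + (3 + 2)) := Ex.step ih ok35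
    have e1 : n + 8 * (k + 1) = n + 8 * k + 8 := by ring
    have e2 : c + 5 * (k + 1) = c + 5 * k + (3 + 2) := by ring
    rw [e1, e2]
    exact h2

lemma ex_base : Ex 4 3 := ⟨Fin 4, inferInstance, inferInstance, ⊤, _, by simp, base⟩

lemma ex_all (n : ℕ) (hne : Even n) (hn : 17 < n) : Ex n ((5 * n + 7) / 8) := by
  obtain ⟨k, hk⟩ := hne
  have h4 := ex_base
  have h10 : Ex 10 7 := Ex.step ex_base ok33
  have h14 : Ex 14 9 := Ex.step ex_base ok55
  have h24 : Ex 24 15 := Ex.step h14 ok55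
  have hm : n % 8 = 0 ∨ n % 8 = 2 ∨ n % 8 = 4 ∨ n % 8 = 6 := by omega
  rcases hm with h | h | h | h
  · have := h24.iter ((n - 24) / 8)
    convert this using 1 <;> omega
  · have := h10.iter ((n - 10) / 8)
    convert this using 1 <;> omega
  · have := h4.iter ((n - 4) / 8)
    convert this using 1 <;> omega
  · have := h14.iter ((n - 14) / 8)
    convert this using 1 <;> omega

section final
variable {V : Type} [Fintype V] [DecidableEq V]

def toSub (G : SimpleGraph V) (f : V → V) : G.Subgraph where
  verts := Set.univ
  Adj a b := G.Adj a b ∧ f a = b ∧ f b = a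
  adj_sub h := h.1
  edge_vert _ := Set.mem_univ _
  symm := ⟨fun _ _ h => ⟨h.1.symm, h.2.2, h.2.1⟩⟩

lemma numPM_eq (G : SimpleGraph V) : numPM G = cnt G Finset.univ := by
  classical
  have e : {M : G.Subgraph | M.IsPerfectMatching} =
      toSub G '' (Finset.univ.filter (fun f : V → V => IsPM G Finset.univ f) : Finset (V → V)) := by
    ext M
    simp only [Set.mem_ofPred_eq, Set.mem_image, Finset.coe_filter, Finset.mem_univ, true_and]
    constructor
    · intro hM
      have hM' := SimpleGraph.Subgraph.isPerfectMatching_iff.1 hM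
      choose f hf hf2 using hM'
      have inv : ∀ v, f (f v) = v := fun v => (hf2 (f v) v (hf v).symm).symm
      refine ⟨f, fun v => ⟨inv v, fun _ => (hf v).adj_sub, fun h => absurd (Finset.mem_univ _) h⟩, ?_⟩
      refine SimpleGraph.Subgraph.ext ?_ ?_
      · exact (Set.eq_univ_of_forall hM.2).symm
      · funext a b
        refine propext ⟨?_, ?_⟩
        · rintro ⟨_, rfl, _⟩
          exact hf a
        · intro h
          exact ⟨h.adj_sub, (hf2 a b h).symm, (hf2 b a h.symm).symm⟩
    · rintro ⟨f, hf, rfl⟩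
      rw [SimpleGraph.Subgraph.isPerfectMatching_iff]
      intro v
      exact ⟨f v, ⟨(hf v).2.1 (Finset.mem_univ _), rfl, (hf v).1⟩, fun w hw => hw.2.1.symm⟩
  unfold numPM cnt
  rw [e, Set.InjOn.ncard_image, Set.ncard_coe_finset]
  intro f hf g hg hfg
  simp only [Finset.coe_filter, Finset.mem_univ, true_and, Set.mem_ofPred_eq] at hf hg
  funext v
  have h1 : (toSub G f).Adj v (f v) := ⟨(hf v).2.1 (Finset.mem_univ _), rfl, (hf v).1⟩
  rw [hfg] at h1
  exact h1.2.1.symm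

lemma av_reach {G : SimpleGraph V} {x y u v : V} {s : Set V} (hs : s ⊆ {x, y}) (h : Av G x y u v)
    (hu : u ∈ sᶜ) (hv : v ∈ sᶜ) :
    (G.induce (sᶜ : Set V)).Reachable ⟨u, hu⟩ ⟨v, hv⟩ := by
  have key : ∃ hv' : v ∈ sᶜ, (G.induce (sᶜ : Set V)).Reachable ⟨u, hu⟩ ⟨v, hv'⟩ := by
    clear hv
    induction h with
    | refl => exact ⟨hu, SimpleGraph.Reachable.refl _⟩
    | @tail b d _ hbd ih =>
      obtain ⟨hb, hr⟩ := ih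
      have hd : d ∈ sᶜ := fun hc => by
        rcases hs hc with h | h
        · exact hbd.2.1 h
        · exact hbd.2.2 h
      refine ⟨hd, hr.trans (SimpleGraph.Adj.reachable ?_)⟩
      exact hbd.1
  exact key.2

lemma three_conn {G : SimpleGraph V} (hc : 4 ≤ Fintype.card V) (h : Conn3 G) : ThreeConnected G := by
  refine ⟨hc, fun s hs => ?_⟩
  have hne : ∀ s : Set V, s.ncard ≤ 2 → ∃ v, v ∉ s := by
    intro s hs
    by_contra hcon
    push Not at hcon
    rw [Set.eq_univ_of_forall hcon, Set.ncard_univ, Nat.card_eq_fintype_card] at hs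
    omega
  rw [SimpleGraph.connected_iff]
  constructor
  · rintro ⟨u, hu⟩ ⟨v, hv⟩
    have : ∃ x y, s ⊆ {x, y} ∧ u ≠ x ∧ u ≠ y ∧ v ≠ x ∧ v ≠ y := by
      have h3 : s.ncard = 0 ∨ s.ncard = 1 ∨ s.ncard = 2 := by omega
      rcases h3 with h3 | h3 | h3
      · rw [Set.ncard_eq_zero] at h3
        subst h3
        obtain ⟨z, hz⟩ := hne {u, v} ((Set.ncard_insert_le _ _).trans (by simp))
        simp only [Set.mem_insert_iff, Set.mem_singleton_iff, not_or] at hz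
        exact ⟨z, z, by simp, Ne.symm hz.1, Ne.symm hz.1, Ne.symm hz.2, Ne.symm hz.2⟩
      · obtain ⟨x, rfl⟩ := Set.ncard_eq_one.1 h3
        exact ⟨x, x, by simp, hu, hu, hv, hv⟩
      · obtain ⟨x, y, _, rfl⟩ := Set.ncard_eq_two.1 h3
        simp only [Set.mem_compl_iff, Set.mem_insert_iff, Set.mem_singleton_iff, not_or] at hu hv
        exact ⟨x, y, subset_rfl, hu.1, hu.2, hv.1, hv.2⟩
    obtain ⟨x, y, hs, h1, h2, h3, h4⟩ := this
    exact av_reach hs (h x y u v h1 h2 h3 h4) hu hv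
  · obtain ⟨v, hv⟩ := hne s hs
    exact ⟨⟨v, hv⟩⟩

lemma brick {G : SimpleGraph V} (hc : 4 ≤ Fintype.card V) (h : Conn3 G)
    (hb : ∀ x y, x ≠ y → 0 < cnt G (Finset.univ \ {x, y})) : IsBrick G := by
  refine ⟨three_conn hc h, fun x y hxy => ?_⟩
  obtain ⟨f, hf⟩ := cnt_pos.1 (hb x y hxy)
  refine ⟨{ verts := Set.univ
            Adj := fun a b => G.Adj a.1 b.1 ∧ f a.1 = b.1 ∧ f b.1 = a.1
            adj_sub := fun h => h.1
            edge_vert := fun _ => Set.mem_univ _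
            symm := ⟨fun _ _ h => ⟨h.1.symm, h.2.2, h.2.1⟩⟩ }, ?_⟩
  rw [SimpleGraph.Subgraph.isPerfectMatching_iff]
  rintro ⟨v, hv⟩
  have hvm : v ∈ Finset.univ \ {x, y} := by simpa using hv
  have hfm := hf.mem hvm
  refine ⟨⟨f v, by simpa using hfm⟩, ⟨(hf v).2.1 hvm, rfl, (hf v).1⟩, ?_⟩
  rintro ⟨w, hw⟩ h
  exact Subtype.ext h.2.1.symm

end final

lemma transfer {n c : ℕ} (hn : 4 ≤ n) (h : Ex n c) :
    ∃ G : SimpleGraph (Fin n), IsBrick G ∧ numPM G = c := by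
  obtain ⟨V, i1, i2, G, t, hc, hG⟩ := h
  have e : V ≃ Fin n := Fintype.equivFinOfCardEq hc
  have hcnt : ∀ S : Finset V, cnt (G.comap e.symm) (S.map e.toEmbedding) = cnt G S := by
    intro S
    refine cnt_map _ _ _ _ ?_
    intro a _ b _
    simp
  refine ⟨G.comap e.symm, brick (by simpa using hn) ?_ ?_, ?_⟩
  · intro x y u v h1 h2 h3 h4
    have := hG.conn (e.symm x) (e.symm y) (e.symm u) (e.symm v) (by simpa using h1)
      (by simpa using h2) (by simpa using h3) (by simpa using h4)
    have h5 : Av (G.comap e.symm) x y (e (e.symm u)) (e (e.symm v)) := by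
      generalize e.symm u = a at this
      generalize e.symm v = b at this
      induction this with
      | refl => exact Relation.ReflTransGen.refl
      | tail _ hab ih =>
        exact Relation.ReflTransGen.tail ih ⟨by simpa using hab.1, fun hc => hab.2.1 (by simp [← hc]),
          fun hc => hab.2.2 (by simp [← hc])⟩
    simpa using h5
  · intro x y hxy
    have := hG.bic (e.symm x) (e.symm y) (by simpa using hxy)
    rw [← hcnt] at this
    convert this using 2
    ext z
    simp [Finset.mem_map_equiv]
  · rw [numPM_eq, ← hG.total, ← hcnt]
    congr 1
    simp

end Ins

/-- For every even integer `n > 17` there exists a brick on `n`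
vertices that has exactly `⌈5n/8⌉` perfect matchings. -/
theorem stmt11 (n : ℕ) (hne : Even n) (hn : 17 < n) :
    ∃ G : SimpleGraph (Fin n), IsBrick G ∧ numPM G = (5 * n + 7) / 8 :=
  Ins.transfer (by omega) (Ins.ex_all n hne hn)
end
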